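/- Let M be a connected, non-compact surface. Then the singular homology groups H_j(ΛM; ℤ) of the free loop space ΛM of M vanish for all j ≥ 2. -/

import Mathlib

open CategoryTheory

/-- The singular chain complex of a topological space `X` with integer coefficients:
the alternating face map complex of the free simplicial abelian group on the singular
simplicial set of `X`. -/
noncomputable def singularChainComplex (X : TopCat) : ChainComplex AddCommGrpCat ℕ :=
  (AlgebraicTopology.alternatingFaceMapComplex AddCommGrpCat).obj
    (((SimplicialObject.whiskering (Type) AddCommGrpCat).obj AddCommGrpCat.free).obj
      (TopCat.toSSet.obj X))

/-- The `n`-th singular homology group `H_n(X; ℤ)` of a topological space `X`. -/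
noncomputable def singularHomology (X : TopCat) (n : ℕ) : AddCommGrpCat :=
  (singularChainComplex X).homology n

/-- The free loop space `ΛM = C(S¹, M)` of a topological space `M`, with the
compact-open topology. -/
def freeLoopSpace (M : Type) [TopologicalSpace M] : Type := C(Circle, M)

noncomputable instance (M : Type) [TopologicalSpace M] :
    TopologicalSpace (freeLoopSpace M) :=
  inferInstanceAs (TopologicalSpace C(Circle, M))

namespace FLS

/-- Length-indexed presimplicial set. -/
structure PSS where
  obj : ℕ → Type
  d : ∀ {m : ℕ}, Fin (m + 1) → obj (m + 1) → obj m
  dd : ∀ {m : ℕ} (i j : Fin (m + 1)), i ≤ j → ∀ x : obj (m + 2),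
    d i (d j.succ x) = d j (d i.castSucc x)

/-- Chains. -/
abbrev PSS.C (S : PSS) (m : ℕ) : Type := S.obj m →₀ ℤ

/-- basic chain -/
noncomputable abbrev PSS.g (S : PSS) {m : ℕ} (x : S.obj m) : S.C m := Finsupp.single x 1

/-- linear extension -/
noncomputable abbrev lext {α N : Type} [AddCommGroup N] (f : α → N) : (α →₀ ℤ) →ₗ[ℤ] N :=
  Finsupp.linearCombination ℤ f

theorem lext_single {α N : Type} [AddCommGroup N] (f : α → N) (x : α) :
    lext f (Finsupp.single x 1) = f x := by simp

/-- boundary -/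
noncomputable def PSS.bd (S : PSS) {m : ℕ} : S.C (m + 1) →ₗ[ℤ] S.C m :=
  lext fun x => ∑ i : Fin (m + 1), (-1 : ℤ) ^ (i : ℕ) • S.g (S.d i x)

theorem PSS.bd_g (S : PSS) {m : ℕ} (x : S.obj (m + 1)) :
    S.bd (S.g x) = ∑ i : Fin (m + 1), (-1 : ℤ) ^ (i : ℕ) • S.g (S.d i x) := by
  simp [PSS.bd, PSS.g]

theorem lin_ext {α N : Type} [AddCommGroup N] {f f' : (α →₀ ℤ) →ₗ[ℤ] N}
    (h : ∀ x, f (Finsupp.single x 1) = f' (Finsupp.single x 1)) : f = f' := by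
  apply Finsupp.lhom_ext'
  intro x
  apply LinearMap.ext_ring
  exact h x

theorem PSS.bd_bd (S : PSS) {m : ℕ} (c : S.C (m + 2)) : S.bd (S.bd c) = 0 := by
  have : S.bd (m := m) ∘ₗ S.bd (m := m + 1) = 0 := by
    apply lin_ext
    intro x
    rw [LinearMap.comp_apply]
    rw [S.bd_g, map_sum]
    simp only [map_smul, S.bd_g, LinearMap.zero_apply, Finset.smul_sum]
    rw [Finset.sum_comm, ← Finset.sum_product']
    let P := Fin (m + 1) × Fin (m + 2)
    let T : Finset P := {ij : P | (ij.2 : ℕ) ≤ (ij.1 : ℕ)}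
    rw [Finset.univ_product_univ, ← Finset.sum_add_sum_compl T, ← eq_neg_iff_add_eq_zero,
      ← Finset.sum_neg_distrib]
    let φ : ∀ ij : P, ij ∈ T → P := fun ij hij =>
      (Fin.castLT ij.2 (lt_of_le_of_lt (Finset.mem_filter.mp hij).right (Fin.is_lt ij.1)), ij.1.succ)
    apply Finset.sum_bij φ
    · intro ij hij
      simp_rw [T, φ, Finset.compl_filter, Finset.mem_filter_univ, Fin.val_succ,
        Fin.val_castLT] at hij ⊢
      lia
    · rintro ⟨i, j⟩ hij ⟨i', j'⟩ hij' h
      rw [Prod.mk_inj]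
      exact ⟨by simpa [φ] using! congr_arg Prod.snd h,
        by simpa [φ, Fin.castSucc_castLT] using! congr_arg Fin.castSucc (congr_arg Prod.fst h)⟩
    · rintro ⟨i', j'⟩ hij'
      simp_rw [T, Finset.compl_filter, Finset.mem_filter_univ, not_le] at hij'
      refine ⟨(j'.pred <| ?_, Fin.castSucc i'), ?_, ?_⟩
      · rintro rfl
        simp only [Fin.val_zero, not_lt_zero] at hij'
      · simpa [T] using! Nat.le_sub_one_of_lt hij'
      · simp only [φ, Fin.castLT_castSucc, Fin.succ_pred]
    · rintro ⟨i, j⟩ hij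
      have hij' : (j : ℕ) ≤ i := by simpa [T] using hij
      dsimp only [φ]
      rw [S.dd _ _ (by rw [Fin.le_def]; simpa using hij'), Fin.castSucc_castLT, smul_smul, smul_smul,
        ← neg_smul]
      congr 1
      simp only [Fin.val_succ, Fin.val_castLT, pow_succ]
      ring
  exact LinearMap.congr_fun this c

/-- morphisms -/
structure PSS.Hom (S T : PSS) where
  f : ∀ {m : ℕ}, S.obj m → T.obj m
  comm : ∀ {m : ℕ} (i : Fin (m + 1)) (x : S.obj (m + 1)), f (S.d i x) = T.d i (f x)

/-- pushforward -/
noncomputable def PSS.Hom.push {S T : PSS} (φ : S.Hom T) {m : ℕ} : S.C m →ₗ[ℤ] T.C m :=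
  lext fun x => T.g (φ.f x)

theorem PSS.Hom.push_g {S T : PSS} (φ : S.Hom T) {m : ℕ} (x : S.obj m) :
    φ.push (S.g x) = T.g (φ.f x) := lext_single _ _

theorem PSS.Hom.bd_push {S T : PSS} (φ : S.Hom T) {m : ℕ} (c : S.C (m + 1)) :
    T.bd (φ.push c) = φ.push (S.bd c) := by
  have : T.bd (m := m) ∘ₗ φ.push = φ.push ∘ₗ S.bd := by
    apply lin_ext
    intro x
    simp only [LinearMap.comp_apply]
    rw [φ.push_g, S.bd_g, T.bd_g, map_sum]
    simp only [map_smul, φ.push_g, φ.comm]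
  exact LinearMap.congr_fun this c

/-- cycle: no condition in length 0. -/
def PSS.Cyc (S : PSS) : ∀ {m : ℕ}, S.C m → Prop
  | 0, _ => True
  | _ + 1, c => S.bd c = 0

theorem PSS.cyc_bd (S : PSS) {m : ℕ} (c : S.C (m + 1)) : S.Cyc (S.bd c) := by
  cases m with
  | zero => trivial
  | succ m => exact S.bd_bd c

theorem map_mem_of_supported {α N : Type} [AddCommGroup N] (L : (α →₀ ℤ) →ₗ[ℤ] N) (s : Set α)
    (Q : Submodule ℤ N) (h : ∀ x ∈ s, L (Finsupp.single x 1) ∈ Q) {c : α →₀ ℤ}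
    (hc : c ∈ Finsupp.supported ℤ ℤ s) : L c ∈ Q := by
  have : Finsupp.supported ℤ ℤ s ≤ Q.comap L := by
    rw [Finsupp.supported_eq_span_single, Submodule.span_le]
    rintro _ ⟨x, hx, rfl⟩
    exact h x hx
  exact this hc

theorem eq_of_supported {α N : Type} [AddCommGroup N] (L L' : (α →₀ ℤ) →ₗ[ℤ] N) (s : Set α)
    (h : ∀ x ∈ s, L (Finsupp.single x 1) = L' (Finsupp.single x 1)) {c : α →₀ ℤ}
    (hc : c ∈ Finsupp.supported ℤ ℤ s) : L c = L' c := by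
  have := map_mem_of_supported (L - L') s ⊥ (fun x hx => by simp [h x hx]) hc
  simpa [sub_eq_zero] using this

theorem single_mem_supported' {α : Type} {s : Set α} {x : α} (hx : x ∈ s) :
    (Finsupp.single x 1 : α →₀ ℤ) ∈ Finsupp.supported ℤ ℤ s :=
  Finsupp.single_mem_supported ℤ 1 hx

/-! ### Singular simplices -/

/-- the standard simplex with m vertices -/
abbrev Dl (m : ℕ) : Type := stdSimplex ℝ (Fin m)

/-- coface -/
noncomputable def cof {m : ℕ} (i : Fin (m + 1)) : C(Dl m, Dl (m + 1)) :=
  ⟨stdSimplex.map i.succAbove, stdSimplex.continuous_map _⟩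

theorem cof_cof {m : ℕ} (i j : Fin (m + 1)) (h : i ≤ j) :
    (cof j.succ).comp (cof i) = (cof i.castSucc).comp (cof j) := by
  ext1 x
  simp only [cof, ContinuousMap.comp_apply, ContinuousMap.coe_mk, stdSimplex.map_comp_apply]
  congr 1
  ext1 k
  simp only [Function.comp_apply]
  have h1 : ((i : ℕ)) ≤ j := h
  apply Fin.ext
  simp only [Fin.succAbove, Fin.lt_def]
  split_ifs <;> simp_all <;> omega

/-- singular presimplicial set -/
noncomputable abbrev Sing (X : Type) [TopologicalSpace X] : PSS where
  obj m := C(Dl m, X)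
  d i σ := σ.comp (cof i)
  dd i j h x := by
    rw [ContinuousMap.comp_assoc, ContinuousMap.comp_assoc, cof_cof i j h]

/-- continuous maps act -/
noncomputable def sMap {X Y : Type} [TopologicalSpace X] [TopologicalSpace Y] (f : C(X, Y)) :
    (Sing X).Hom (Sing Y) where
  f σ := f.comp σ
  comm i x := by
    change f.comp (ContinuousMap.comp x (cof i)) = (f.comp x).comp (cof i)
    rfl

section
variable {X : Type} [TopologicalSpace X]

/-- chains in W -/
noncomputable def Ch (W : Set X) (m : ℕ) : Submodule ℤ ((Sing X).C m) :=
  Finsupp.supported ℤ ℤ {σ : C(Dl m, X) | ∀ x, σ x ∈ W}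

theorem Ch_mono {W W' : Set X} (h : W ⊆ W') (m : ℕ) : Ch W m ≤ Ch W' m :=
  Finsupp.supported_mono fun _ hσ x => h (hσ x)

theorem g_mem_Ch {W : Set X} {m : ℕ} {σ : C(Dl m, X)} (h : ∀ x, σ x ∈ W) :
    (Sing X).g σ ∈ Ch W m := single_mem_supported' (s := {σ : C(Dl m, X) | ∀ x, σ x ∈ W}) h

theorem mem_Ch_univ {m : ℕ} (c : (Sing X).C m) : c ∈ Ch (Set.univ : Set X) m := by
  rw [Ch, Finsupp.mem_supported]
  exact fun σ _ x => trivial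

theorem bd_mem_Ch {W : Set X} {m : ℕ} {c : (Sing X).C (m + 1)} (h : c ∈ Ch W (m + 1)) :
    (Sing X).bd c ∈ Ch W m := by
  refine map_mem_of_supported _ _ _ ?_ h
  intro σ hσ
  rw [PSS.bd_g]
  refine Submodule.sum_mem _ fun i _ => Submodule.smul_mem _ _ (g_mem_Ch fun x => hσ _)

theorem push_mem_Ch {Y : Type} [TopologicalSpace Y] (f : C(X, Y)) {W : Set X} {W' : Set Y}
    (hf : ∀ x ∈ W, f x ∈ W') {m : ℕ} {c : (Sing X).C m} (h : c ∈ Ch W m) :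
    (sMap f).push c ∈ Ch W' m := by
  refine map_mem_of_supported _ _ _ ?_ h
  intro σ hσ
  rw [PSS.Hom.push_g]
  exact g_mem_Ch fun x => hf _ (hσ x)

theorem push_eq_of_Ch {Y : Type} [TopologicalSpace Y] (f f' : C(X, Y)) {W : Set X}
    (hf : ∀ x ∈ W, f x = f' x) {m : ℕ} {c : (Sing X).C m} (h : c ∈ Ch W m) :
    (sMap f).push c = (sMap f').push c := by
  refine eq_of_supported _ _ _ ?_ h
  intro σ hσ
  rw [PSS.Hom.push_g, PSS.Hom.push_g]
  congr 1
  exact ContinuousMap.ext fun x => hf _ (hσ x)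

theorem push_id {m : ℕ} (c : (Sing X).C m) : (sMap (ContinuousMap.id X)).push c = c := by
  have : (sMap (ContinuousMap.id X)).push (m := m) = LinearMap.id := by
    apply lin_ext; intro x; rw [PSS.Hom.push_g]; rfl
  exact LinearMap.congr_fun this c

theorem push_comp {Y Z : Type} [TopologicalSpace Y] [TopologicalSpace Z] (f : C(X, Y))
    (h : C(Y, Z)) {m : ℕ} (c : (Sing X).C m) :
    (sMap h).push ((sMap f).push c) = (sMap (h.comp f)).push c := by
  have : (sMap h).push (m := m) ∘ₗ (sMap f).push = (sMap (h.comp f)).push := by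
    apply lin_ext; intro x; rw [LinearMap.comp_apply, PSS.Hom.push_g, PSS.Hom.push_g, PSS.Hom.push_g]
    rfl
  exact LinearMap.congr_fun this c

/-- compact support of a chain -/
theorem exists_compact_support {m : ℕ} (c : (Sing X).C m) :
    ∃ K : Set X, IsCompact K ∧ c ∈ Ch K m := by
  refine ⟨⋃ σ ∈ c.support, Set.range (fun x => (show C(Dl m, X) from σ) x), ?_, ?_⟩
  · refine c.support.finite_toSet.isCompact_biUnion fun σ _ => ?_
    exact isCompact_range (ContinuousMap.continuous _)
  · rw [Ch, Finsupp.mem_supported]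
    intro σ hσ x
    exact Set.mem_biUnion hσ ⟨x, rfl⟩

theorem Ch_inter {W W' : Set X} {m : ℕ} {c : (Sing X).C m} (h : c ∈ Ch W m) (h' : c ∈ Ch W' m) :
    c ∈ Ch (W ∩ W') m := by
  rw [Ch, Finsupp.mem_supported] at *
  exact fun σ hσ x => ⟨h hσ x, h' hσ x⟩

/-- chains in an open/any subset lift to the subtype -/
theorem exists_lift_Ch {W : Set X} {m : ℕ} {c : (Sing X).C m} (h : c ∈ Ch W m) :
    ∃ c' : (Sing W).C m, (sMap (⟨Subtype.val, continuous_subtype_val⟩ : C(W, X))).push c' = c := by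
  have : Ch W m ≤ LinearMap.range
      ((sMap (⟨Subtype.val, continuous_subtype_val⟩ : C(W, X))).push (m := m)) := by
    rw [Ch, Finsupp.supported_eq_span_single, Submodule.span_le]
    rintro _ ⟨(σ : C(Dl m, X)), hσ, rfl⟩
    refine ⟨(Sing W).g (⟨fun x => ⟨σ x, hσ x⟩, by fun_prop⟩ : C(Dl m, W)), ?_⟩
    rw [PSS.Hom.push_g]
    rfl
  exact this h

theorem push_injective {Y : Type} [TopologicalSpace Y] (f : C(X, Y)) (hf : Function.Injective f)
    (m : ℕ) : Function.Injective ((sMap f).push (m := m)) := by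
  have : ((sMap f).push (m := m)) = Finsupp.lmapDomain ℤ ℤ (fun σ : C(Dl m, X) => f.comp σ) := by
    apply lin_ext
    intro σ
    rw [PSS.Hom.push_g]
    exact (Finsupp.mapDomain_single).symm
  rw [this]
  apply Finsupp.mapDomain_injective
  intro σ τ h
  exact ContinuousMap.ext fun x => hf (DFunLike.congr_fun (F := C(Dl m, Y)) h x)

end

end FLS

namespace FLS

/-! ### Tuples -/

/-- tuples of points -/
abbrev Tup (E : Type) : PSS where
  obj m := Fin m → E
  d i v := v ∘ i.succAbove
  dd i j h x := by
    funext k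
    simp only [Function.comp_apply]
    congr 1
    have h1 : ((i : ℕ)) ≤ j := h
    apply Fin.ext
    simp only [Fin.succAbove, Fin.lt_def]
    split_ifs <;> simp_all <;> omega

/-- cone -/
noncomputable def cone {E : Type} (b : E) {m : ℕ} : (Tup E).C m →ₗ[ℤ] (Tup E).C (m + 1) :=
  lext fun v => (Tup E).g (Fin.cons b v : Fin (m + 1) → E)

theorem cone_g {E : Type} (b : E) {m : ℕ} (v : Fin m → E) :
    cone b ((Tup E).g v) = (Tup E).g (Fin.cons b v : Fin (m + 1) → E) := lext_single _ _

theorem cons_comp_succ {E : Type} (b : E) {m : ℕ} (v : Fin (m + 1) → E) (j : Fin (m + 1)) :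
    (Fin.cons b v : Fin (m + 2) → E) ∘ j.succ.succAbove = Fin.cons b (v ∘ j.succAbove) := by
  funext k
  refine Fin.cases ?_ (fun k => ?_) k
  · simp
  · simp

theorem bd_cone {E : Type} (b : E) {m : ℕ} (c : (Tup E).C (m + 1)) :
    (Tup E).bd (cone b c) = c - cone b ((Tup E).bd c) := by
  have : (Tup E).bd ∘ₗ cone b (m := m + 1) = LinearMap.id - cone b ∘ₗ (Tup E).bd := by
    apply lin_ext
    intro v
    simp only [LinearMap.comp_apply, LinearMap.sub_apply, LinearMap.id_apply]
    have e1 := cone_g b v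
    rw [e1, PSS.bd_g, PSS.bd_g, Fin.sum_univ_succ, map_sum, sub_eq_add_neg, ← Finset.sum_neg_distrib]
    congr 1
    · simp [Function.comp_def]
    · refine Finset.sum_congr rfl fun j _ => ?_
      rw [map_smul, cone_g, ← neg_smul]
      congr 1
      · simp [pow_succ]
      · congr 1
        exact cons_comp_succ b v j
  exact LinearMap.congr_fun this c

theorem bd_cone_zero {E : Type} (b : E) (c : (Tup E).C 0) :
    (Tup E).bd (cone b c) = c := by
  have : (Tup E).bd ∘ₗ cone b (m := 0) = LinearMap.id := by
    apply lin_ext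
    intro v
    simp only [LinearMap.comp_apply, LinearMap.id_apply]
    have e1 := cone_g b v
    rw [e1, PSS.bd_g]
    simp
  exact LinearMap.congr_fun this c

theorem bd_cone_cyc {E : Type} (b : E) {m : ℕ} (c : (Tup E).C m) (h : (Tup E).Cyc c) :
    (Tup E).bd (cone b c) = c := by
  cases m with
  | zero => exact bd_cone_zero b c
  | succ m =>
    have h' : (Tup E).bd c = 0 := h
    rw [bd_cone, h', map_zero, sub_zero]

/-- functoriality -/
abbrev tMap {E EF : Type} (f : E → EF) : (Tup E).Hom (Tup EF) where
  f v := f ∘ v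
  comm _ _ := rfl

theorem tMap_cone {E EF : Type} (f : E → EF) (b : E) {m : ℕ} (c : (Tup E).C m) :
    (tMap f).push (cone b c) = cone (f b) ((tMap f).push c) := by
  have : (tMap f).push ∘ₗ cone b (m := m) = cone (f b) ∘ₗ (tMap f).push := by
    apply lin_ext
    intro v
    simp only [LinearMap.comp_apply]
    have e1 := cone_g b v
    have e2 := (tMap f).push_g v
    rw [e1, e2, cone_g, PSS.Hom.push_g]
    congr 1
    funext k
    refine Fin.cases ?_ (fun k => ?_) k <;> simp
  exact LinearMap.congr_fun this c

section
variable {E : Type} [NormedAddCommGroup E] [NormedSpace ℝ E]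
variable {EF : Type} [NormedAddCommGroup EF] [NormedSpace ℝ EF]

/-- barycenter -/
noncomputable def bar {m : ℕ} (v : Fin (m + 1) → E) : E := ((m : ℝ) + 1)⁻¹ • ∑ i, v i

theorem map_bar (L : E →ₗ[ℝ] EF) {m : ℕ} (v : Fin (m + 1) → E) : L (bar v) = bar (L ∘ v) := by
  simp [bar]

/-- barycentric subdivision -/
noncomputable def sd : ∀ m : ℕ, (Tup E).C m →ₗ[ℤ] (Tup E).C m
  | 0 => LinearMap.id
  | m + 1 => lext fun v : Fin (m + 1) → E => cone (bar v) (sd m ((Tup E).bd ((Tup E).g v)))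

theorem sd_g {m : ℕ} (v : Fin (m + 1) → E) :
    sd (m + 1) ((Tup E).g v) = cone (bar v) (sd m ((Tup E).bd ((Tup E).g v))) := by
  simp only [sd]
  exact lext_single _ _

theorem bd_sd (m : ℕ) (c : (Tup E).C (m + 1)) : (Tup E).bd (sd (m + 1) c) = sd m ((Tup E).bd c) := by
  have : (Tup E).bd ∘ₗ sd (E := E) (m + 1) = sd m ∘ₗ (Tup E).bd := by
    induction m with
    | zero =>
      apply lin_ext
      intro v
      simp only [LinearMap.comp_apply]
      have e := sd_g v
      rw [e, bd_cone_zero]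
    | succ m ih =>
      apply lin_ext
      intro v
      simp only [LinearMap.comp_apply]
      have e := sd_g v
      rw [e, bd_cone_cyc]
      have := LinearMap.congr_fun (ih ((Tup E).bd ((Tup E).g v))) ((Tup E).bd ((Tup E).g v))
      simp only [LinearMap.comp_apply, PSS.bd_bd, map_zero] at this
      exact this
  exact LinearMap.congr_fun this c

/-- homotopy from id to sd -/
noncomputable def sdD : ∀ m : ℕ, (Tup E).C m →ₗ[ℤ] (Tup E).C (m + 1)
  | 0 => 0
  | m + 1 => lext fun v : Fin (m + 1) → E =>
      cone (bar v) ((Tup E).g v - sd (m + 1) ((Tup E).g v) - sdD m ((Tup E).bd ((Tup E).g v)))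

theorem sdD_g {m : ℕ} (v : Fin (m + 1) → E) :
    sdD (m + 1) ((Tup E).g v) =
      cone (bar v) ((Tup E).g v - sd (m + 1) ((Tup E).g v) - sdD m ((Tup E).bd ((Tup E).g v))) := by
  simp only [sdD]
  exact lext_single _ _

theorem bd_sdD (m : ℕ) (c : (Tup E).C (m + 1)) :
    (Tup E).bd (sdD (m + 1) c) = c - sd (m + 1) c - sdD m ((Tup E).bd c) := by
  have : (Tup E).bd ∘ₗ sdD (E := E) (m + 1) = LinearMap.id - sd (m + 1) - sdD m ∘ₗ (Tup E).bd := by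
    induction m with
    | zero =>
      apply lin_ext
      intro v
      simp only [LinearMap.comp_apply, LinearMap.sub_apply, LinearMap.id_apply]
      have e := sdD_g v
      rw [e, bd_cone]
      simp only [map_sub]
      rw [bd_sd]
      simp [sd, sdD]
    | succ m ih =>
      apply lin_ext
      intro v
      simp only [LinearMap.comp_apply, LinearMap.sub_apply, LinearMap.id_apply]
      have e := sdD_g v
      rw [e, bd_cone]
      simp only [map_sub]
      rw [bd_sd]
      have := LinearMap.congr_fun (ih ((Tup E).bd ((Tup E).g v))) ((Tup E).bd ((Tup E).g v))
      simp only [LinearMap.comp_apply, LinearMap.sub_apply, LinearMap.id_apply, PSS.bd_bd,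
        map_zero] at this
      rw [this]
      simp
  exact LinearMap.congr_fun this c

theorem tMap_sd (L : E →ₗ[ℝ] EF) {m : ℕ} (c : (Tup E).C m) :
    (tMap L).push (sd m c) = sd m ((tMap L).push c) := by
  have : (tMap L).push ∘ₗ sd m = sd m ∘ₗ (tMap L).push := by
    induction m with
    | zero => rfl
    | succ m ih =>
      apply lin_ext
      intro v
      simp only [LinearMap.comp_apply]
      have e := sd_g v
      have e2 := (tMap L).push_g v
      have := LinearMap.congr_fun (ih ((Tup E).bd ((Tup E).g v))) ((Tup E).bd ((Tup E).g v))
      simp only [LinearMap.comp_apply] at this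
      rw [e, e2, tMap_cone, this, sd_g, ← PSS.Hom.bd_push, PSS.Hom.push_g, map_bar]
  exact LinearMap.congr_fun this c

theorem tMap_sdD (L : E →ₗ[ℝ] EF) {m : ℕ} (c : (Tup E).C m) :
    (tMap L).push (sdD m c) = sdD m ((tMap L).push c) := by
  have : (tMap L).push ∘ₗ sdD m = sdD m ∘ₗ (tMap L).push := by
    induction m with
    | zero => simp [sdD]
    | succ m ih =>
      apply lin_ext
      intro v
      simp only [LinearMap.comp_apply]
      have e := sdD_g v
      have e2 := (tMap L).push_g v
      have := LinearMap.congr_fun (ih ((Tup E).bd ((Tup E).g v))) ((Tup E).bd ((Tup E).g v))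
      simp only [LinearMap.comp_apply] at this
      rw [e, e2, tMap_cone, sdD_g]
      simp only [map_sub]
      rw [this, ← PSS.Hom.bd_push, tMap_sd, PSS.Hom.push_g, map_bar]
  exact LinearMap.congr_fun this c

/-- prism -/
noncomputable def pri : ∀ m : ℕ, (Tup E).C m →ₗ[ℤ] (Tup (E × ℝ)).C (m + 1)
  | 0 => 0
  | m + 1 => lext fun v : Fin (m + 1) → E =>
      cone (bar v, (0 : ℝ)) ((tMap (fun x : E => (x, (1 : ℝ)))).push ((Tup E).g v)
        - (tMap (fun x : E => (x, (0 : ℝ)))).push ((Tup E).g v) - pri m ((Tup E).bd ((Tup E).g v)))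

theorem pri_g {m : ℕ} (v : Fin (m + 1) → E) :
    pri (m + 1) ((Tup E).g v) =
      cone (bar v, (0 : ℝ)) ((tMap (fun x : E => (x, (1 : ℝ)))).push ((Tup E).g v)
        - (tMap (fun x : E => (x, (0 : ℝ)))).push ((Tup E).g v)
        - pri m ((Tup E).bd ((Tup E).g v))) := by
  simp only [pri]
  exact lext_single _ _

theorem bd_pri (m : ℕ) (c : (Tup E).C (m + 1)) :
    (Tup (E × ℝ)).bd (pri (m + 1) c) = (tMap (fun x : E => (x, (1 : ℝ)))).push c
        - (tMap (fun x : E => (x, (0 : ℝ)))).push c - pri m ((Tup E).bd c) := by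
  have : (Tup (E × ℝ)).bd ∘ₗ pri (E := E) (m + 1) = (tMap (fun x : E => (x, (1 : ℝ)))).push
        - (tMap (fun x : E => (x, (0 : ℝ)))).push - pri m ∘ₗ (Tup E).bd := by
    induction m with
    | zero =>
      apply lin_ext
      intro v
      simp only [LinearMap.comp_apply, LinearMap.sub_apply]
      have e := pri_g v
      have h0 : ∀ (a b : (Tup (E × ℝ)).obj 0), a = b := fun a b => Subsingleton.elim _ _
      rw [e, bd_cone]
      simp only [map_sub]
      rw [PSS.Hom.bd_push, PSS.Hom.bd_push]
      have : (tMap (fun x : E => (x, (1 : ℝ)))).push (m := 0) =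
        (tMap (fun x : E => (x, (0 : ℝ)))).push := by
        apply lin_ext
        intro v
        have e2 := (tMap (fun x : E => (x, (1 : ℝ)))).push_g v
        have e3 := (tMap (fun x : E => (x, (0 : ℝ)))).push_g v
        rw [e2, e3]
        congr 1
        exact h0 _ _
      rw [this]
      simp [pri]
    | succ m ih =>
      apply lin_ext
      intro v
      simp only [LinearMap.comp_apply, LinearMap.sub_apply]
      have e := pri_g v
      rw [e, bd_cone]
      simp only [map_sub]
      rw [PSS.Hom.bd_push, PSS.Hom.bd_push]
      have := LinearMap.congr_fun (ih ((Tup E).bd ((Tup E).g v))) ((Tup E).bd ((Tup E).g v))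
      simp only [LinearMap.comp_apply, LinearMap.sub_apply, PSS.bd_bd,
        map_zero] at this
      rw [this]
      simp
  exact LinearMap.congr_fun this c

theorem tMap_pri (L : E →ₗ[ℝ] EF) {m : ℕ} (c : (Tup E).C m) :
    (tMap (Prod.map L id)).push (pri m c) = pri m ((tMap L).push c) := by
  have : (tMap (Prod.map L id)).push ∘ₗ pri m = pri m ∘ₗ (tMap L).push := by
    induction m with
    | zero => simp [pri]
    | succ m ih =>
      apply lin_ext
      intro v
      simp only [LinearMap.comp_apply]
      have e := pri_g v
      have e2 := (tMap L).push_g v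
      have := LinearMap.congr_fun (ih ((Tup E).bd ((Tup E).g v))) ((Tup E).bd ((Tup E).g v))
      simp only [LinearMap.comp_apply] at this
      rw [e, e2, tMap_cone, pri_g]
      simp only [map_sub]
      rw [this, ← PSS.Hom.bd_push, PSS.Hom.push_g]
      simp only [PSS.Hom.push_g, Prod.map, map_bar, id]
      rfl
  exact LinearMap.congr_fun this c

/-! supports -/

/-- tuples in `K` -/
noncomputable abbrev TS {F : Type} (K : Set F) (m : ℕ) : Submodule ℤ ((Tup F).C m) :=
  Finsupp.supported ℤ ℤ {v : Fin m → F | ∀ i, v i ∈ K}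

theorem TS_bd {F : Type} {K : Set F} {m : ℕ} {c : (Tup F).C (m + 1)} (h : c ∈ TS K (m + 1)) :
    (Tup F).bd c ∈ TS K m := by
  refine map_mem_of_supported _ _ _ ?_ h
  intro v hv
  rw [PSS.bd_g]
  refine Submodule.sum_mem _ fun i _ => Submodule.smul_mem _ _ (single_mem_supported' ?_)
  exact fun k => hv _

theorem TS_cone {F : Type} {K : Set F} {m : ℕ} {c : (Tup F).C m} (h : c ∈ TS K m) {b : F}
    (hb : b ∈ K) : cone b c ∈ TS K (m + 1) := by
  refine map_mem_of_supported _ _ _ ?_ h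
  intro v hv
  have e := cone_g b v
  rw [e]
  refine single_mem_supported' ?_
  intro i
  refine Fin.cases ?_ (fun k => ?_) i
  · simpa
  · simpa using hv k

theorem TS_push {F F' : Type} (f : F → F') {K : Set F} {K' : Set F'} (hf : ∀ x ∈ K, f x ∈ K')
    {m : ℕ} {c : (Tup F).C m} (h : c ∈ TS K m) : (tMap f).push c ∈ TS K' m := by
  refine map_mem_of_supported _ _ _ ?_ h
  intro v hv
  rw [PSS.Hom.push_g]
  refine single_mem_supported' ?_
  exact fun i => hf _ (hv i)

theorem bar_mem {K : Set E} (hK : Convex ℝ K) {m : ℕ} {v : Fin (m + 1) → E} (hv : ∀ i, v i ∈ K) :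
    bar v ∈ K := by
  rw [bar, Finset.smul_sum]
  apply hK.sum_mem
  · intro i _; positivity
  · simp
    field_simp
  · intro i _; exact hv i

theorem TS_sd {K : Set E} (hK : Convex ℝ K) {m : ℕ} {c : (Tup E).C m} (h : c ∈ TS K m) :
    sd m c ∈ TS K m := by
  induction m with
  | zero => exact h
  | succ m ih =>
    refine map_mem_of_supported _ _ _ ?_ h
    intro v hv
    have e := sd_g v
    rw [e]
    exact TS_cone (ih (TS_bd (single_mem_supported' hv))) (bar_mem hK hv)

theorem TS_sdD {K : Set E} (hK : Convex ℝ K) {m : ℕ} {c : (Tup E).C m} (h : c ∈ TS K m) :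
    sdD m c ∈ TS K (m + 1) := by
  induction m with
  | zero => simp [sdD]
  | succ m ih =>
    refine map_mem_of_supported _ _ _ ?_ h
    intro v hv
    have e := sdD_g v
    rw [e]
    have h1 := single_mem_supported' (s := {v : Fin (m + 1) → E | ∀ i, v i ∈ K}) hv
    refine TS_cone ?_ (bar_mem hK hv)
    exact Submodule.sub_mem _ (Submodule.sub_mem _ h1 (TS_sd hK h1)) (ih (TS_bd h1))

theorem TS_pri {K : Set E} (hK : Convex ℝ K) {m : ℕ} {c : (Tup E).C m} (h : c ∈ TS K m) :
    pri m c ∈ TS (K ×ˢ (Set.Icc (0 : ℝ) 1)) (m + 1) := by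
  induction m with
  | zero => simp [pri]
  | succ m ih =>
    refine map_mem_of_supported _ _ _ ?_ h
    intro v hv
    have e := pri_g v
    rw [e]
    have h1 := single_mem_supported' (s := {v : Fin (m + 1) → E | ∀ i, v i ∈ K}) hv
    refine TS_cone ?_ (by simpa using bar_mem hK hv)
    refine Submodule.sub_mem _ (Submodule.sub_mem _ (TS_push _ ?_ h1) (TS_push _ ?_ h1)) (ih (TS_bd h1))
    · intro x hx; simpa
    · intro x hx; simpa

/-- mesh -/
noncomputable abbrev Mesh (E : Type) [NormedAddCommGroup E] (δ : ℝ) (m : ℕ) :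
    Submodule ℤ ((Tup E).C m) :=
  Finsupp.supported ℤ ℤ {v : Fin m → E | ∀ i j, dist (v i) (v j) ≤ δ}

theorem dist_bar_le {m : ℕ} {v : Fin (m + 1) → E} {δ : ℝ} (hv : ∀ i j, dist (v i) (v j) ≤ δ)
    (j : Fin (m + 1)) : dist (bar v) (v j) ≤ (m / (m + 1)) * δ := by
  have e : bar v - v j = ((m : ℝ) + 1)⁻¹ • ∑ i, (v i - v j) := by
    rw [Finset.sum_sub_distrib, smul_sub, bar]
    simp only [Finset.sum_const, Finset.card_univ, Fintype.card_fin]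
    rw [← Nat.cast_smul_eq_nsmul ℝ, smul_smul]
    push_cast
    rw [inv_mul_cancel₀ (by positivity), one_smul]
  have h2 : ‖∑ i, (v i - v j)‖ ≤ m * δ := by
    rw [← Finset.sum_erase (a := j) Finset.univ (by simp)]
    refine (norm_sum_le _ _).trans ?_
    refine (Finset.sum_le_card_nsmul _ _ δ fun i _ => ?_).trans ?_
    · rw [← dist_eq_norm]; exact hv i j
    · simp
  rw [dist_eq_norm, e, norm_smul, Real.norm_of_nonneg (by positivity)]
  calc _ ≤ ((m : ℝ) + 1)⁻¹ * (m * δ) := by gcongr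
    _ = _ := by ring

theorem sd_mesh (n : ℕ) {δ : ℝ} (hδ : 0 ≤ δ) {m : ℕ} (hm : m ≤ n + 1) (v : Fin m → E)
    (hv : ∀ i j, dist (v i) (v j) ≤ δ) :
    sd m ((Tup E).g v) ∈ Mesh E ((n / (n + 1)) * δ) m ⊓ TS (convexHull ℝ (Set.range v)) m := by
  induction m with
  | zero =>
    refine ⟨single_mem_supported' ?_, single_mem_supported' ?_⟩
    · exact fun i => i.elim0
    · exact fun i => i.elim0
  | succ m ih =>
    refine ⟨?_, TS_sd (convex_convexHull ℝ _) (single_mem_supported' fun i =>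
      subset_convexHull ℝ _ ⟨i, rfl⟩)⟩
    rw [sd_g, PSS.bd_g, map_sum, map_sum]
    refine Submodule.sum_mem _ fun i _ => ?_
    rw [map_smul, map_smul]
    refine Submodule.smul_mem _ _ ?_
    have h1 := ih (by omega) (v ∘ i.succAbove) (fun a b => hv _ _)
    have h2 : sd m ((Tup E).g (v ∘ i.succAbove)) ∈ Finsupp.supported ℤ ℤ
      ({w : Fin m → E | ∀ i j, dist (w i) (w j) ≤ (n / (n + 1)) * δ} ∩
       {w : Fin m → E | ∀ k, w k ∈ convexHull ℝ (Set.range (v ∘ i.succAbove))}) := by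
      rw [Finsupp.supported_inter]; exact h1
    refine map_mem_of_supported _ _ _ ?_ h2
    rintro w ⟨hw1, hw2⟩
    have e := cone_g (bar v) w
    rw [e]
    refine single_mem_supported' ?_
    have hc : ∀ k, dist (bar v) (w k) ≤ (n / (n + 1)) * δ := by
      intro k
      have : convexHull ℝ (Set.range (v ∘ i.succAbove)) ⊆
          Metric.closedBall (bar v) ((n / (n + 1)) * δ) := by
        apply convexHull_min _ (convex_closedBall _ _)
        rintro _ ⟨k, rfl⟩
        rw [Metric.mem_closedBall, dist_comm]
        refine (dist_bar_le hv _).trans ?_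
        refine mul_le_mul_of_nonneg_right ?_ hδ
        rw [div_le_div_iff₀ (by positivity) (by positivity)]
        have : (m : ℝ) ≤ n := by exact_mod_cast Nat.le_of_succ_le_succ hm
        nlinarith
      have := this (hw2 k)
      rwa [Metric.mem_closedBall, dist_comm] at this
    intro a b
    refine Fin.cases ?_ (fun a => ?_) a <;> refine Fin.cases ?_ (fun b => ?_) b
    · simp only [Fin.cons_zero, dist_self]; positivity
    · simpa using hc b
    · simpa [dist_comm] using hc a
    · simpa using hw1 a b

theorem sd_mem_mesh (n : ℕ) {δ : ℝ} (hδ : 0 ≤ δ) {c : (Tup E).C (n + 1)}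
    (hc : c ∈ Mesh E δ (n + 1)) : sd (n + 1) c ∈ Mesh E ((n / (n + 1)) * δ) (n + 1) := by
  refine map_mem_of_supported _ _ _ ?_ hc
  intro v hv
  exact (sd_mesh n hδ le_rfl v hv).1

theorem sd_iter_mem_mesh (n : ℕ) {δ : ℝ} (hδ : 0 ≤ δ) {c : (Tup E).C (n + 1)}
    (hc : c ∈ Mesh E δ (n + 1)) (k : ℕ) :
    ((sd (n + 1))^[k] c) ∈ Mesh E ((n / (n + 1)) ^ k * δ) (n + 1) := by
  induction k with
  | zero => simpa using hc
  | succ k ih =>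
    rw [Function.iterate_succ', Function.comp_apply, pow_succ', mul_assoc]
    exact sd_mem_mesh n (by positivity) ih

theorem sd_iter_mem_TS {K : Set E} (hK : Convex ℝ K) {m : ℕ} {c : (Tup E).C m} (h : c ∈ TS K m)
    (k : ℕ) : ((sd m)^[k] c) ∈ TS K m := by
  induction k with
  | zero => simpa using h
  | succ k ih =>
    rw [Function.iterate_succ', Function.comp_apply]
    exact TS_sd hK ih

end
end FLS

namespace FLS

theorem cof_self {m : ℕ} (i : Fin (m + 1)) (x : Dl m) : (cof i x) i = 0 := by
  change (stdSimplex.map i.succAbove x) i = 0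
  rw [stdSimplex.map_coe, FunOnFinite.linearMap_apply_apply]
  apply Finset.sum_eq_zero
  intro k hk
  exact absurd (Finset.mem_filter.mp hk).2 (Fin.succAbove_ne i k)

theorem cof_succAbove {m : ℕ} (i : Fin (m + 1)) (x : Dl m) (k : Fin m) :
    (cof i x) (i.succAbove k) = x k := by
  change (stdSimplex.map i.succAbove x) _ = _
  rw [stdSimplex.map_coe, FunOnFinite.linearMap_apply_apply]
  rw [Finset.sum_eq_single k]
  · intro b hb hk
    exact absurd (Fin.succAbove_right_injective (Finset.mem_filter.mp hb).2) hk
  · simp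

section
variable {E : Type} [NormedAddCommGroup E] [NormedSpace ℝ E]

/-- affine simplex -/
noncomputable def comb {m : ℕ} (v : Fin m → E) : C(Dl m, E) :=
  ⟨fun x => ∑ i, x.1 i • v i, by
    refine continuous_finsetSum _ fun i _ => Continuous.smul ?_ continuous_const
    exact (continuous_apply i).comp continuous_subtype_val⟩

theorem comb_apply {m : ℕ} (v : Fin m → E) (x : Dl m) : comb v x = ∑ i, x i • v i := rfl

theorem comb_mem {K : Set E} (hK : Convex ℝ K) {m : ℕ} {v : Fin m → E} (hv : ∀ i, v i ∈ K)
    (x : Dl m) : comb v x ∈ K :=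
  hK.sum_mem (fun i _ => x.2.1 i) x.2.2 fun i _ => hv i

variable {X : Type} [TopologicalSpace X] {Y : Type} [TopologicalSpace Y]

/-- realization -/
noncomputable abbrev real (F : C(E, X)) : (Tup E).Hom (Sing X) where
  f v := F.comp (comb v)
  comm i v := by
    refine ContinuousMap.ext fun x => ?_
    simp only [ContinuousMap.comp_apply, comb_apply]
    rw [Fin.sum_univ_succAbove _ i, cof_self]
    simp only [cof_succAbove, zero_smul, zero_add, Function.comp_apply]

/-- retraction to the simplex -/
noncomputable def rtr (m : ℕ) : C(Fin (m + 1) → ℝ, Dl (m + 1)) where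
  toFun x := ⟨fun i => (max (x i) 0 + max (1 - ∑ j, max (x j) 0) 0) /
      (∑ i, (max (x i) 0 + max (1 - ∑ j, max (x j) 0) 0)), by
    have hpos : 0 < ∑ i, (max (x i) 0 + max (1 - ∑ j, max (x j) 0) 0) := by
      rw [Finset.sum_add_distrib]
      have h0 : 0 ≤ ∑ j, max (x j) 0 := Finset.sum_nonneg fun i _ => le_max_right _ _
      simp only [Finset.sum_const, Finset.card_univ, Fintype.card_fin, nsmul_eq_mul]
      set s := ∑ j, max (x j) 0
      have h1 : 1 - s ≤ max (1 - s) 0 := le_max_left _ _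
      have h2 : 0 ≤ max (1 - s) 0 := le_max_right _ _
      push_cast
      nlinarith [mul_nonneg (Nat.cast_nonneg (α := ℝ) m) h2]
    refine ⟨fun i => ?_, ?_⟩
    · have : 0 ≤ max (x i) 0 := le_max_right _ _
      have : 0 ≤ max (1 - ∑ j, max (x j) 0) 0 := le_max_right _ _
      positivity
    · rw [← Finset.sum_div, div_self hpos.ne']⟩
  continuous_toFun := by
    refine Continuous.subtype_mk ?_ _
    refine continuous_pi fun i => ?_
    refine Continuous.div (by fun_prop) (by fun_prop) fun x => ?_
    have hpos : 0 < ∑ i, (max (x i) 0 + max (1 - ∑ j, max (x j) 0) 0) := by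
      rw [Finset.sum_add_distrib]
      have h0 : 0 ≤ ∑ j, max (x j) 0 := Finset.sum_nonneg fun i _ => le_max_right _ _
      simp only [Finset.sum_const, Finset.card_univ, Fintype.card_fin, nsmul_eq_mul]
      set s := ∑ j, max (x j) 0
      have h1 : 1 - s ≤ max (1 - s) 0 := le_max_left _ _
      have h2 : 0 ≤ max (1 - s) 0 := le_max_right _ _
      push_cast
      nlinarith [mul_nonneg (Nat.cast_nonneg (α := ℝ) m) h2]
    exact hpos.ne'

theorem rtr_of_mem {m : ℕ} (x : Fin (m + 1) → ℝ) (hx : x ∈ stdSimplex ℝ (Fin (m + 1))) :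
    rtr m x = ⟨x, hx⟩ := by
  apply Subtype.ext
  funext i
  simp only [rtr, ContinuousMap.coe_mk]
  have h1 : ∀ i, max (x i) 0 = x i := fun i => max_eq_left (hx.1 i)
  simp only [h1, hx.2]
  simp [hx.2]

theorem rtr_coe {m : ℕ} (x : Dl (m + 1)) : rtr m x.1 = x := rtr_of_mem _ x.2

/-- vertices -/
noncomputable def iot (m : ℕ) : Fin m → (Fin m → ℝ) := fun i => Pi.single i 1

theorem comb_iot {m : ℕ} (x : Dl m) : comb (iot m) x = x.1 := by
  rw [comb_apply]
  funext k
  simp [iot, Finset.sum_apply, Pi.single_apply]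
  rfl

theorem iot_mem (m : ℕ) : (Tup (Fin m → ℝ)).g (iot m) ∈ TS (stdSimplex ℝ (Fin m)) m :=
  single_mem_supported' fun i => single_mem_stdSimplex ℝ i

theorem real_iot {m : ℕ} (σ : C(Dl (m + 1), X)) :
    (real (σ.comp (rtr m))).push ((Tup _).g (iot (m + 1))) = (Sing X).g σ := by
  rw [PSS.Hom.push_g]
  congr 1
  refine ContinuousMap.ext fun x => ?_
  change σ (rtr m (comb (iot _) x)) = σ x
  rw [comb_iot, rtr_coe]

/-- linear map given by a tuple -/
noncomputable abbrev lin {m : ℕ} (v : Fin m → E) : (Fin m → ℝ) →ₗ[ℝ] E :=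
  Fintype.linearCombination ℝ v

theorem lin_iot {m : ℕ} (v : Fin m → E) : lin v ∘ iot m = v := by
  funext i
  simp [lin, iot, Fintype.linearCombination_apply, Pi.single_apply]

theorem comb_lin {m k : ℕ} (v : Fin m → E) (w : Fin k → (Fin m → ℝ)) (x : Dl k) :
    comb (lin v ∘ w) x = lin v (comb w x) := by
  simp [comb_apply, map_sum]

theorem real_lin {m k : ℕ} (F : C(E, X)) (v : Fin (m + 1) → E)
    {θ : (Tup (Fin (m + 1) → ℝ)).C k} (hθ : θ ∈ TS (stdSimplex ℝ (Fin (m + 1))) k) :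
    (real ((F.comp (comb v)).comp (rtr m))).push θ =
      (real F).push ((tMap (lin v)).push θ) := by
  rw [← LinearMap.comp_apply (f := (real F).push)]
  refine eq_of_supported _ _ _ ?_ hθ
  intro w hw
  rw [LinearMap.comp_apply]
  have e1 := (tMap (lin v)).push_g w
  have e2 := (real ((F.comp (comb v)).comp (rtr m))).push_g w
  rw [e1, e2, PSS.Hom.push_g]
  congr 1
  refine ContinuousMap.ext fun x => ?_
  change F (comb v (rtr m (comb w x))) = F (comb (lin v ∘ w) x)
  rw [comb_lin, rtr_of_mem _ (comb_mem (convex_stdSimplex ℝ _) hw x), comb_apply]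
  rfl

theorem real_mem_Ch (F : C(E, X)) {W : Set X} (hF : ∀ x, F x ∈ W) {k : ℕ} (θ : (Tup E).C k) :
    (real F).push θ ∈ Ch W k := by
  refine map_mem_of_supported (real F).push Set.univ _ ?_ (by simp)
  intro w _
  rw [PSS.Hom.push_g]
  exact g_mem_Ch fun x => hF _

/-! S and T -/
/-- subdivision operator -/
noncomputable def Sd : ∀ m : ℕ, (Sing X).C m →ₗ[ℤ] (Sing X).C m
  | 0 => LinearMap.id
  | m + 1 => lext fun σ : C(Dl (m + 1), X) =>
      (real (σ.comp (rtr m))).push (sd (m + 1) ((Tup _).g (iot (m + 1))))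

theorem Sd_g {m : ℕ} (σ : C(Dl (m + 1), X)) : Sd (m + 1) ((Sing X).g σ) =
    (real (σ.comp (rtr m))).push (sd (m + 1) ((Tup _).g (iot (m + 1)))) := by
  simp only [Sd]; exact lext_single _ _

/-- homotopy -/
noncomputable def Td : ∀ m : ℕ, (Sing X).C m →ₗ[ℤ] (Sing X).C (m + 1)
  | 0 => 0
  | m + 1 => lext fun σ : C(Dl (m + 1), X) =>
      (real (σ.comp (rtr m))).push (sdD (m + 1) ((Tup _).g (iot (m + 1))))

theorem Td_g {m : ℕ} (σ : C(Dl (m + 1), X)) : Td (m + 1) ((Sing X).g σ) =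
    (real (σ.comp (rtr m))).push (sdD (m + 1) ((Tup _).g (iot (m + 1)))) := by
  simp only [Td]; exact lext_single _ _

theorem Sd_real (F : C(E, X)) {m : ℕ} (c : (Tup E).C m) :
    Sd m ((real F).push c) = (real F).push (sd m c) := by
  cases m with
  | zero => rfl
  | succ m =>
    rw [← LinearMap.comp_apply, ← LinearMap.comp_apply (f := (real F).push)]
    refine LinearMap.congr_fun (lin_ext fun v => ?_) c
    rw [LinearMap.comp_apply, LinearMap.comp_apply]
    have e1 := (real F).push_g v
    rw [e1, Sd_g]
    refine (real_lin F v (TS_sd (convex_stdSimplex ℝ _) (iot_mem _))).trans ?_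
    rw [tMap_sd, PSS.Hom.push_g]
    change _ = (real F).push (sd (m + 1) ((Tup E).g v))
    congr 3
    exact lin_iot v

theorem Td_real (F : C(E, X)) {m : ℕ} (c : (Tup E).C m) :
    Td m ((real F).push c) = (real F).push (sdD m c) := by
  cases m with
  | zero => simp [Td, sdD]
  | succ m =>
    rw [← LinearMap.comp_apply, ← LinearMap.comp_apply (f := (real F).push)]
    refine LinearMap.congr_fun (lin_ext fun v => ?_) c
    rw [LinearMap.comp_apply, LinearMap.comp_apply]
    have e1 := (real F).push_g v
    rw [e1, Td_g]
    refine (real_lin F v (TS_sdD (convex_stdSimplex ℝ _) (iot_mem _))).trans ?_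
    rw [tMap_sdD, PSS.Hom.push_g]
    change _ = (real F).push (sdD (m + 1) ((Tup E).g v))
    congr 3
    exact lin_iot v

theorem bd_Sd {m : ℕ} (c : (Sing X).C (m + 1)) : (Sing X).bd (Sd (m + 1) c) = Sd m ((Sing X).bd c) := by
  rw [← LinearMap.comp_apply, ← LinearMap.comp_apply]
  refine LinearMap.congr_fun (lin_ext fun σ => ?_) c
  rw [LinearMap.comp_apply, LinearMap.comp_apply]
  have e := Sd_g σ
  have e2 := real_iot σ
  rw [e, PSS.Hom.bd_push, bd_sd, ← Sd_real, ← PSS.Hom.bd_push, e2]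

theorem bd_Td {m : ℕ} (c : (Sing X).C (m + 1)) :
    (Sing X).bd (Td (m + 1) c) = c - Sd (m + 1) c - Td m ((Sing X).bd c) := by
  have : (Sing X).bd ∘ₗ Td (m + 1) = LinearMap.id - Sd (m + 1) - Td m ∘ₗ (Sing X).bd := by
    refine lin_ext fun σ => ?_
    simp only [LinearMap.comp_apply, LinearMap.sub_apply, LinearMap.id_apply]
    have e := Sd_g σ
    have e' := Td_g σ
    have e2 := real_iot σ
    rw [e, e', PSS.Hom.bd_push, bd_sdD, map_sub, map_sub, ← Td_real, ← PSS.Hom.bd_push, e2]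
  exact LinearMap.congr_fun this c

theorem Sd_mem {W : Set X} {m : ℕ} {c : (Sing X).C m} (h : c ∈ Ch W m) : Sd m c ∈ Ch W m := by
  cases m with
  | zero => exact h
  | succ m =>
    refine map_mem_of_supported _ _ _ ?_ h
    intro σ hσ
    have e := Sd_g σ
    rw [e]
    exact real_mem_Ch _ (fun x => hσ _) _

theorem Td_mem {W : Set X} {m : ℕ} {c : (Sing X).C m} (h : c ∈ Ch W m) : Td m c ∈ Ch W (m + 1) := by
  cases m with
  | zero => simp [Td]
  | succ m =>
    refine map_mem_of_supported _ _ _ ?_ h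
    intro σ hσ
    have e := Td_g σ
    rw [e]
    exact real_mem_Ch _ (fun x => hσ _) _

theorem sup_map {A B : Type} [AddCommGroup A] [AddCommGroup B] (L : A →ₗ[ℤ] B)
    {P Q : Submodule ℤ A} {P' Q' : Submodule ℤ B} (hP : ∀ x ∈ P, L x ∈ P') (hQ : ∀ x ∈ Q, L x ∈ Q')
    {x : A} (hx : x ∈ P ⊔ Q) : L x ∈ P' ⊔ Q' := by
  obtain ⟨p, hp, q, hq, rfl⟩ := Submodule.mem_sup.mp hx
  rw [map_add]
  exact Submodule.mem_sup.mpr ⟨_, hP p hp, _, hQ q hq, rfl⟩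

theorem Sd_iter_real (F : C(E, X)) {m : ℕ} (c : (Tup E).C m) (k : ℕ) :
    (Sd m)^[k] ((real F).push c) = (real F).push ((sd m)^[k] c) := by
  induction k with
  | zero => rfl
  | succ k ih => rw [Function.iterate_succ', Function.comp_apply, ih, Sd_real,
      Function.iterate_succ', Function.comp_apply]

theorem Sd_iter_mem_sup {U V : Set X} {m : ℕ} {c : (Sing X).C m} (h : c ∈ Ch U m ⊔ Ch V m) (k : ℕ) :
    (Sd m)^[k] c ∈ Ch U m ⊔ Ch V m := by
  induction k with
  | zero => exact h
  | succ k ih =>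
    rw [Function.iterate_succ', Function.comp_apply]
    exact sup_map _ (fun x hx => Sd_mem hx) (fun x hx => Sd_mem hx) ih

theorem simplex_small {U V : Set X} (hU : IsOpen U) (hV : IsOpen V) {n : ℕ}
    (σ : C(Dl (n + 1), X)) (hσ : ∀ x, σ x ∈ U ∪ V) :
    ∃ k : ℕ, (Sd (n + 1))^[k] ((Sing X).g σ) ∈ Ch U (n + 1) ⊔ Ch V (n + 1) := by
  have hcov : (Set.univ : Set (Dl (n + 1))) ⊆ ⋃ b : Bool, σ ⁻¹' (if b then U else V) := by
    intro x _
    rcases hσ x with h | h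
    · exact Set.mem_iUnion.mpr ⟨true, by simpa⟩
    · exact Set.mem_iUnion.mpr ⟨false, by simpa⟩
  obtain ⟨ε, hε, hleb⟩ := lebesgue_number_lemma_of_metric isCompact_univ
    (fun b : Bool => (show IsOpen (σ ⁻¹' (if b then U else V)) by
      apply IsOpen.preimage σ.continuous; cases b <;> simpa)) hcov
  have hc : ∃ k : ℕ, ((n : ℝ) / (n + 1)) ^ k * 1 < ε := by
    have : (n : ℝ) / (n + 1) < 1 := by rw [div_lt_one (by positivity)]; linarith
    obtain ⟨k, hk⟩ := exists_pow_lt_of_lt_one hε this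
    exact ⟨k, by simpa using hk⟩
  obtain ⟨k, hk⟩ := hc
  refine ⟨k, ?_⟩
  have e := real_iot σ
  rw [← e, Sd_iter_real]
  have h1 : (Tup (Fin (n + 1) → ℝ)).g (iot (n + 1)) ∈ Mesh _ 1 (n + 1) := by
    refine single_mem_supported' ?_
    intro i j
    rw [dist_pi_le_iff (by norm_num)]
    intro l
    simp only [iot, Pi.single_apply, Real.dist_eq]
    split_ifs <;> simp
  have h2 := sd_iter_mem_mesh n zero_le_one h1 k
  have h3 := sd_iter_mem_TS (convex_stdSimplex ℝ _) (iot_mem (n + 1)) k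
  have h4 : ((sd (n + 1))^[k] ((Tup _).g (iot (n + 1)))) ∈ Finsupp.supported ℤ ℤ
      ({v : Fin (n + 1) → (Fin (n + 1) → ℝ) | ∀ i j, dist (v i) (v j) ≤ ((n : ℝ) / (n + 1)) ^ k * 1} ∩
       {v | ∀ i, v i ∈ stdSimplex ℝ (Fin (n + 1))}) := by
    rw [Finsupp.supported_inter]; exact ⟨h2, h3⟩
  refine map_mem_of_supported _ _ _ ?_ h4
  rintro w ⟨hw1, hw2⟩
  rw [PSS.Hom.push_g]
  obtain ⟨b, hb⟩ := hleb ⟨w 0, hw2 0⟩ trivial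
  have hin : ∀ x : Dl (n + 1), σ (rtr n (comb w x)) ∈ (if b then U else V) := by
    intro x
    have hm := comb_mem (convex_stdSimplex ℝ _) hw2 x
    rw [rtr_of_mem _ hm]
    apply hb
    rw [Metric.mem_ball]
    change dist (comb w x) (w 0) < ε
    have : comb w x ∈ Metric.ball (w 0) ε := by
      apply comb_mem (convex_ball _ _)
      intro i
      exact lt_of_le_of_lt (hw1 i 0) hk
    exact this
  cases b
  · exact Submodule.mem_sup_right (g_mem_Ch fun x => by simpa using hin x)
  · exact Submodule.mem_sup_left (g_mem_Ch fun x => by simpa using hin x)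

theorem Sd_iter_add {m : ℕ} (k : ℕ) (a b : (Sing X).C m) :
    (Sd m)^[k] (a + b) = (Sd m)^[k] a + (Sd m)^[k] b := by
  simp [← Module.End.coe_pow]

theorem chain_small {U V : Set X} (hU : IsOpen U) (hV : IsOpen V) {n : ℕ}
    {c : (Sing X).C (n + 1)} (hc : c ∈ Ch (U ∪ V) (n + 1)) :
    ∃ k : ℕ, (Sd (n + 1))^[k] c ∈ Ch U (n + 1) ⊔ Ch V (n + 1) := by
  have hc' := hc
  rw [Ch, Finsupp.supported_eq_span_single] at hc'
  induction hc' using Submodule.span_induction with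
  | mem x h =>
    obtain ⟨σ, hσ, rfl⟩ := h
    exact simplex_small hU hV σ hσ
  | zero => exact ⟨0, Submodule.zero_mem _⟩
  | add x y hx hy ihx ihy =>
    rw [← Finsupp.supported_eq_span_single] at hx hy
    obtain ⟨k, hk⟩ := ihx hx
    obtain ⟨l, hl⟩ := ihy hy
    refine ⟨k + l, ?_⟩
    rw [Sd_iter_add]
    refine Submodule.add_mem _ ?_ ?_
    · rw [add_comm k l, Function.iterate_add_apply]; exact Sd_iter_mem_sup hk _
    · rw [Function.iterate_add_apply]; exact Sd_iter_mem_sup hl _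
  | smul a x hx ih =>
    rw [← Finsupp.supported_eq_span_single] at hx
    obtain ⟨k, hk⟩ := ih hx
    refine ⟨k, ?_⟩
    rw [← Module.End.coe_pow, map_smul, Module.End.coe_pow]
    exact Submodule.smul_mem _ _ hk

/-- The small simplices theorem. -/
theorem small_thm {U V : Set X} (hU : IsOpen U) (hV : IsOpen V) {n : ℕ}
    {u : (Sing X).C (n + 1)} (hu : u ∈ Ch (U ∪ V) (n + 1))
    (hbu : (Sing X).bd u ∈ Ch U n ⊔ Ch V n) :
    ∃ s ∈ Ch (U ∪ V) (n + 2), u - (Sing X).bd s ∈ Ch U (n + 1) ⊔ Ch V (n + 1) := by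
  obtain ⟨k, hk⟩ := chain_small hU hV hu
  induction k generalizing u with
  | zero => exact ⟨0, Submodule.zero_mem _, by simpa using hk⟩
  | succ k ih =>
    rw [Function.iterate_succ_apply] at hk
    have h1 : (Sing X).bd (Sd (n + 1) u) ∈ Ch U n ⊔ Ch V n := by
      rw [bd_Sd]
      exact sup_map _ (fun x hx => Sd_mem hx) (fun x hx => Sd_mem hx) hbu
    obtain ⟨s, hs, hs2⟩ := ih (Sd_mem hu) h1 hk
    refine ⟨s + Td (n + 1) u, Submodule.add_mem _ hs (Td_mem hu), ?_⟩
    have e : u - (Sing X).bd (s + Td (n + 1) u) =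
        (Sd (n + 1) u - (Sing X).bd s) + Td n ((Sing X).bd u) := by
      rw [map_add, bd_Td]; abel
    rw [e]
    exact Submodule.add_mem _ hs2 (sup_map _ (fun x hx => Td_mem hx) (fun x hx => Td_mem hx) hbu)

/-! homotopy invariance -/

/-- extended homotopy -/
noncomputable def hext (H : C(X × unitInterval, Y)) (G : C(E, X)) : C(E × ℝ, Y) :=
  ⟨fun p => H (G p.1, Set.projIcc 0 1 zero_le_one p.2), by fun_prop⟩

/-- prism operator -/
noncomputable def Pr (H : C(X × unitInterval, Y)) : ∀ m : ℕ, (Sing X).C m →ₗ[ℤ] (Sing Y).C (m + 1)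
  | 0 => 0
  | m + 1 => lext fun σ : C(Dl (m + 1), X) =>
      (real (hext H (σ.comp (rtr m)))).push (pri (m + 1) ((Tup _).g (iot (m + 1))))

theorem Pr_g (H : C(X × unitInterval, Y)) {m : ℕ} (σ : C(Dl (m + 1), X)) :
    Pr H (m + 1) ((Sing X).g σ) =
    (real (hext H (σ.comp (rtr m)))).push (pri (m + 1) ((Tup _).g (iot (m + 1)))) := by
  simp only [Pr]; exact lext_single _ _

theorem Pr_real (H : C(X × unitInterval, Y)) (F : C(E, X)) {m : ℕ} (c : (Tup E).C m) :
    Pr H m ((real F).push c) = (real (hext H F)).push (pri m c) := by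
  cases m with
  | zero => simp [Pr, pri]
  | succ m =>
    rw [← LinearMap.comp_apply, ← LinearMap.comp_apply (f := (real (hext H F)).push)]
    refine LinearMap.congr_fun (lin_ext fun v => ?_) c
    rw [LinearMap.comp_apply, LinearMap.comp_apply]
    have e1 := (real F).push_g v
    rw [e1, Pr_g]
    have e3 : pri (m + 1) ((Tup E).g v) = (tMap (Prod.map (lin v) id)).push
        (pri (m + 1) ((Tup _).g (iot (m + 1)))) := by
      rw [tMap_pri, PSS.Hom.push_g]
      congr 2
      exact (lin_iot v).symm
    change _ = (real (hext H F)).push (pri (m + 1) ((Tup E).g v))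
    rw [e3, ← LinearMap.comp_apply (f := (real (hext H F)).push)]
    refine eq_of_supported _ _ _ ?_ (TS_pri (convex_stdSimplex ℝ _) (iot_mem _))
    intro w hw
    rw [LinearMap.comp_apply]
    have e4 := (tMap (Prod.map (lin v) (id : ℝ → ℝ))).push_g w
    rw [e4, PSS.Hom.push_g, PSS.Hom.push_g]
    congr 1
    refine ContinuousMap.ext fun x => ?_
    have h1 : comb ((tMap (Prod.map (lin v) (id : ℝ → ℝ))).f w) x = Prod.map (lin v) id (comb w x) := by
      simp only [comb_apply]
      apply Prod.ext
      · simp [Prod.fst_sum, map_sum]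
      · simp [Prod.snd_sum]
    have h2 := comb_mem ((convex_stdSimplex ℝ _).prod (convex_Icc 0 1)) hw x
    change hext H ((F.comp (comb v)).comp (rtr m)) (comb w x) = hext H F (comb _ x)
    rw [h1]
    simp only [hext, ContinuousMap.coe_mk, ContinuousMap.comp_apply, Prod.map, id]
    rw [rtr_of_mem _ h2.1, comb_apply]
    rfl

/-- endpoint inclusion -/
def endp (H : C(X × unitInterval, Y)) (t : unitInterval) : C(X, Y) :=
  ⟨fun x => H (x, t), by fun_prop⟩

theorem bd_Pr (H : C(X × unitInterval, Y)) {m : ℕ} (c : (Sing X).C (m + 1)) :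
    (Sing Y).bd (Pr H (m + 1) c) = (sMap (endp H 1)).push c - (sMap (endp H 0)).push c
      - Pr H m ((Sing X).bd c) := by
  have : (Sing Y).bd ∘ₗ Pr H (m + 1) = (sMap (endp H 1)).push - (sMap (endp H 0)).push
      - Pr H m ∘ₗ (Sing X).bd := by
    refine lin_ext fun σ => ?_
    simp only [LinearMap.comp_apply, LinearMap.sub_apply]
    have e' := Pr_g H σ
    have e2 := real_iot σ
    have e3 : ∀ t : unitInterval, (sMap (endp H t)).push ((Sing X).g σ) =
        (real (hext H (ContinuousMap.comp σ (rtr m)))).push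
        ((tMap (fun x : (Fin (m + 1) → ℝ) => (x, (t : ℝ)))).push ((Tup _).g (iot (m + 1)))) := by
      intro t
      rw [PSS.Hom.push_g, PSS.Hom.push_g, PSS.Hom.push_g]
      congr 1
      refine ContinuousMap.ext fun x => ?_
      have h1 : comb ((tMap (fun x : (Fin (m + 1) → ℝ) => (x, (t : ℝ)))).f (iot (m + 1))) x
          = (x.1, (t : ℝ)) := by
        rw [comb_apply]
        apply Prod.ext
        · rw [Prod.fst_sum]
          exact comb_iot x
        · rw [Prod.snd_sum]
          simp only [Function.comp_apply, Prod.smul_mk, smul_eq_mul]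
          rw [← Finset.sum_mul, stdSimplex.sum_eq_one, one_mul]
      change _ = hext H _ (comb _ x)
      rw [h1]
      simp only [hext, ContinuousMap.coe_mk, ContinuousMap.comp_apply]
      rw [rtr_coe, Set.projIcc_val]
      rfl
    have h1 := e3 1
    have h0 := e3 0
    simp only [Set.Icc.coe_one, Set.Icc.coe_zero] at h1 h0
    rw [e', h1, h0, PSS.Hom.bd_push, bd_pri, map_sub, map_sub, ← Pr_real, ← PSS.Hom.bd_push, e2]
  exact LinearMap.congr_fun this c

theorem Pr_mem (H : C(X × unitInterval, Y)) {W : Set X} {W' : Set Y}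
    (hW : ∀ x ∈ W, ∀ t, H (x, t) ∈ W') {m : ℕ} {c : (Sing X).C m} (h : c ∈ Ch W m) :
    Pr H m c ∈ Ch W' (m + 1) := by
  cases m with
  | zero => simp [Pr]
  | succ m =>
    refine map_mem_of_supported _ _ _ ?_ h
    intro σ hσ
    have e := Pr_g H σ
    rw [e]
    exact real_mem_Ch _ (fun x => hW _ (hσ _) _) _

end
end FLS

namespace FLS
section
variable {X : Type} [TopologicalSpace X] {Y : Type} [TopologicalSpace Y]

theorem Ch_empty {m : ℕ} {c : (Sing X).C (m + 1)} (h : c ∈ Ch (∅ : Set X) (m + 1)) : c = 0 := by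
  rw [Ch, Finsupp.mem_supported] at h
  rw [← Finsupp.support_eq_empty, Finset.eq_empty_iff_forall_notMem]
  intro σ hσ
  exact h hσ (stdSimplex.vertex 0)

/-- constant simplex -/
noncomputable def kap (p : X) (m : ℕ) : (Sing X).C m := (Sing X).g (ContinuousMap.const (Dl m) p)

theorem bd_kap (p : X) (m : ℕ) : (Sing X).bd (kap p (m + 1)) = if Even m then kap p m else 0 := by
  rw [kap, PSS.bd_g]
  have h : ∀ i : Fin (m + 1), (Sing X).g ((Sing X).d i (ContinuousMap.const (Dl (m + 1)) p)) = kap p m :=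
    fun i => rfl
  simp only [h]
  rw [← Finset.sum_smul]
  have := Fin.sum_neg_one_pow (R := ℤ) (m + 1)
  rw [this]
  by_cases hm : Even m
  · rw [if_pos hm, if_neg (by simpa [Nat.even_add_one] using hm), one_smul]
  · rw [if_neg hm, if_pos (by simpa [Nat.even_add_one] using hm), zero_smul]

theorem push_const (p : Y) {m : ℕ} (z : (Sing X).C m) :
    ∃ a : ℤ, (sMap (ContinuousMap.const X p)).push z = a • kap p m := by
  have : ∀ z, (sMap (ContinuousMap.const X p)).push z ∈ Submodule.span ℤ {kap p m} := by
    intro z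
    refine map_mem_of_supported (sMap (ContinuousMap.const X p)).push Set.univ _ ?_ (c := z) (by simp)
    intro w _
    rw [PSS.Hom.push_g]
    exact Submodule.mem_span_singleton_self _
  obtain ⟨a, ha⟩ := Submodule.mem_span_singleton.mp (this z)
  exact ⟨a, ha.symm⟩

theorem kap_mem {W : Set X} {p : X} (hp : p ∈ W) (m : ℕ) : kap p m ∈ Ch W m := g_mem_Ch fun _ => hp

theorem push_const_bd (p : Y) {m : ℕ} (z : (Sing X).C m) (hz : (Sing X).Cyc z) {W : Set Y}
    (hp : p ∈ W) :
    ∃ w ∈ Ch W (m + 1), (Sing Y).bd w = (sMap (ContinuousMap.const X p)).push z := by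
  obtain ⟨a, ha⟩ := push_const p z
  by_cases hm : Even m
  · refine ⟨a • kap p (m + 1), Submodule.smul_mem _ _ (kap_mem hp _), ?_⟩
    rw [map_smul, bd_kap, if_pos hm, ha]
  · obtain ⟨k, rfl⟩ : ∃ k, m = k + 1 := ⟨m - 1, by rcases m with _ | m <;> simp_all⟩
    have h0 : (Sing X).bd z = 0 := hz
    have h1 := (sMap (ContinuousMap.const X p)).bd_push z
    rw [h0, map_zero, ha, map_smul, bd_kap, if_pos (by simpa [Nat.even_add_one] using hm)] at h1
    have h2 : a = 0 := by
      have := DFunLike.congr_fun h1 (ContinuousMap.const (Dl k) p)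
      simpa [kap] using this
    refine ⟨0, Submodule.zero_mem _, ?_⟩
    rw [ha, h2]; simp

/-- acyclic subset -/
def Acyc (W : Set X) : Prop := ∀ m : ℕ, ∀ z ∈ Ch W m, (Sing X).Cyc z →
  ∃ w ∈ Ch W (m + 1), (Sing X).bd w = z

theorem acyc_of_homotopy {W : Set X} (H : C(X × unitInterval, X)) (p : X) (hp : p ∈ W)
    (h0 : ∀ x ∈ W, H (x, 0) = x) (h1 : ∀ x ∈ W, H (x, 1) = p) (hW : ∀ x ∈ W, ∀ t, H (x, t) ∈ W) :
    Acyc W := by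
  intro m z hz hc
  obtain ⟨w, hw, hw2⟩ := push_const_bd (X := X) p z hc hp
  cases m with
  | zero =>
    refine ⟨w, hw, hw2.trans ?_⟩
    have := push_eq_of_Ch (ContinuousMap.const X p) (ContinuousMap.id X) (W := ∅) (m := 0) (c := z)
      (by simp) (by
        rw [Ch, Finsupp.mem_supported]
        intro σ _ x
        have : IsEmpty (Dl 0) := by
          rw [Set.isEmpty_coe_sort]; exact stdSimplex_of_isEmpty_index ℝ (Fin 0)
        exact isEmptyElim x)
    rw [this, push_id]
  | succ m =>
    refine ⟨w - Pr H (m + 1) z, Submodule.sub_mem _ hw (Pr_mem H hW hz), ?_⟩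
    have hc' : (Sing X).bd z = 0 := hc
    rw [map_sub, hw2, bd_Pr, hc', map_zero, sub_zero,
      push_eq_of_Ch (endp H 1) (ContinuousMap.const X p) h1 hz,
      push_eq_of_Ch (endp H 0) (ContinuousMap.id X) h0 hz, push_id]
    abel

theorem acyc_star {E : Type} [NormedAddCommGroup E] [NormedSpace ℝ E] {W : Set E} {p : E}
    (hp : p ∈ W) (h : StarConvex ℝ p W) : Acyc W := by
  let H : C(E × unitInterval, E) := ⟨fun q => (q.2 : ℝ) • p + (1 - (q.2 : ℝ)) • q.1, by fun_prop⟩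
  refine acyc_of_homotopy H p hp ?_ ?_ ?_
  · intro x _; simp [H]
  · intro x _; simp [H]
  · intro x hx t
    exact h hx t.2.1 (by linarith [t.2.2]) (by ring)

/-- vanishing of the relative class of z along A -/
def RZ (A : Set X) {m : ℕ} (z : (Sing X).C m) : Prop :=
  ∃ w : (Sing X).C (m + 1), z - (Sing X).bd w ∈ Ch Aᶜ m

/-- relative vanishing for A in length m + 1 -/
def Van (A : Set X) (m : ℕ) : Prop :=
  ∀ z : (Sing X).C (m + 1), (Sing X).bd z ∈ Ch Aᶜ m → RZ A z

theorem RZ.mono {A B : Set X} (h : A ⊆ B) {m : ℕ} {z : (Sing X).C m} (hz : RZ B z) : RZ A z := by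
  obtain ⟨w, hw⟩ := hz
  exact ⟨w, Ch_mono (Set.compl_subset_compl.mpr h) _ hw⟩

theorem mv {A B : Set X} (hA : IsClosed A) (hB : IsClosed B) {m : ℕ} (z : (Sing X).C (m + 1))
    (zA : RZ A z) (zB : RZ B z) (hv : Van (A ∩ B) (m + 1)) : RZ (A ∪ B) z := by
  obtain ⟨w1, h1⟩ := zA
  obtain ⟨w2, h2⟩ := zB
  have sA : Aᶜ ⊆ (A ∩ B)ᶜ := by rw [Set.compl_inter]; exact Set.subset_union_left
  have sB : Bᶜ ⊆ (A ∩ B)ᶜ := by rw [Set.compl_inter]; exact Set.subset_union_right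
  have e1 : (Sing X).bd (w1 - w2) = (z - (Sing X).bd w2) - (z - (Sing X).bd w1) := by
    rw [map_sub]; abel
  obtain ⟨w3, h3⟩ := hv (w1 - w2) (by
    rw [e1]
    exact Submodule.sub_mem _ (Ch_mono sB _ h2) (Ch_mono sA _ h1))
  rw [Set.compl_inter] at h3
  have hbu : (Sing X).bd (w1 - w2 - (Sing X).bd w3) ∈ Ch Aᶜ (m + 1) ⊔ Ch Bᶜ (m + 1) := by
    rw [map_sub, PSS.bd_bd, sub_zero, e1]
    exact Submodule.sub_mem _ (Submodule.mem_sup_right h2) (Submodule.mem_sup_left h1)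
  obtain ⟨s, hs, hs2⟩ := small_thm hA.isOpen_compl hB.isOpen_compl h3 hbu
  obtain ⟨uA, huA, uB, huB, he⟩ := Submodule.mem_sup.mp hs2
  refine ⟨w1 - uA, ?_⟩
  rw [Set.compl_union]
  have e2 := congrArg (Sing X).bd he
  simp only [map_sub, map_add, PSS.bd_bd, sub_zero] at e2
  refine Ch_inter ?_ ?_
  · rw [map_sub, ← sub_add]
    exact Submodule.add_mem _ h1 (bd_mem_Ch huA)
  · have : z - (Sing X).bd (w1 - uA) = (z - (Sing X).bd w2) - (Sing X).bd uB := by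
      rw [map_sub]
      have : (Sing X).bd uA = (Sing X).bd w1 - (Sing X).bd w2 - (Sing X).bd uB := by
        rw [← e2]; abel
      rw [this]; abel
    rw [this]
    exact Submodule.sub_mem _ h2 (bd_mem_Ch huB)

theorem mv_rev {A B : Set X} (hA : IsClosed A) (hB : IsClosed B) (hX : Acyc (Set.univ : Set X))
    (aA : Acyc Aᶜ) (aB : Acyc Bᶜ) {m : ℕ} (hv : Van (A ∪ B) m) : Van (A ∩ B) (m + 1) := by
  intro z hz
  rw [Set.compl_inter] at hz
  obtain ⟨s, hs, hs2⟩ := small_thm hA.isOpen_compl hB.isOpen_compl hz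
    (by rw [PSS.bd_bd]; exact Submodule.zero_mem _)
  obtain ⟨a, ha, b, hb, he⟩ := Submodule.mem_sup.mp hs2
  have e2 := congrArg (Sing X).bd he
  simp only [map_sub, map_add, PSS.bd_bd, sub_zero] at e2
  have h1 : (Sing X).bd a ∈ Ch (A ∪ B)ᶜ m := by
    rw [Set.compl_union]
    refine Ch_inter (bd_mem_Ch ha) ?_
    rw [eq_neg_of_add_eq_zero_left e2]
    exact Submodule.neg_mem _ (bd_mem_Ch hb)
  obtain ⟨c, hc⟩ := hv a h1
  set e := a - (Sing X).bd c with hedef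
  have hbe : (Sing X).bd e = (Sing X).bd a := by rw [hedef, map_sub, PSS.bd_bd, sub_zero]
  obtain ⟨a', ha', ha2⟩ := aA _ (a - e) (Submodule.sub_mem _ ha
    (Ch_mono (Set.compl_subset_compl.mpr Set.subset_union_left) _ hc))
    (by change (Sing X).bd _ = 0; rw [map_sub, hbe, sub_self])
  obtain ⟨b', hb', hb2⟩ := aB _ (b + e) (Submodule.add_mem _ hb
    (Ch_mono (Set.compl_subset_compl.mpr Set.subset_union_right) _ hc))
    (by change (Sing X).bd _ = 0; rw [map_add, hbe, add_comm]; exact e2)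
  obtain ⟨w, _, hw2⟩ := hX _ (z - s - a' - b') (mem_Ch_univ _) (by
    change (Sing X).bd _ = 0
    simp only [map_sub]
    rw [ha2, hb2, ← he]; abel)
  refine ⟨w, ?_⟩
  have : z - (Sing X).bd w = s + a' + b' := by rw [hw2]; abel
  rw [this, Set.compl_inter]
  exact Submodule.add_mem _ (Submodule.add_mem _ hs (Ch_mono Set.subset_union_left _ ha'))
    (Ch_mono Set.subset_union_right _ hb')

theorem van_univ (hX : Acyc (Set.univ : Set X)) {m : ℕ} : Van (Set.univ : Set X) (m + 1) := by
  intro z hz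
  rw [Set.compl_univ] at hz
  obtain ⟨w, _, hw⟩ := hX _ z (mem_Ch_univ _) (Ch_empty hz)
  exact ⟨w, by rw [hw, sub_self]; exact Submodule.zero_mem _⟩

theorem aux_pos {a b q : ℝ} (ha : 0 ≤ a) (hb : 0 ≤ b) (hab : a + b = 1) (hq : 0 < q) :
    0 < a + b * q := by
  rcases hb.eq_or_lt with h | h
  · subst h; linarith
  · have := mul_pos h hq; linarith

theorem van_plane {m : ℕ} (hm : 3 ≤ m) : Van ({0} : Set (ℝ × ℝ)) m := by
  obtain ⟨k, rfl⟩ : ∃ k, m = k + 1 + 1 + 1 := ⟨m - 3, by omega⟩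
  have hX : Acyc (Set.univ : Set (ℝ × ℝ)) := acyc_star (p := 0) trivial (starConvex_univ _)
  have c2 : Continuous fun p : ℝ × ℝ => p.2 := continuous_snd
  have c1 : Continuous fun p : ℝ × ℝ => p.1 := continuous_fst
  have hL : Van {p : ℝ × ℝ | p.2 = 0} (k + 1 + 1) := by
    have e : {p : ℝ × ℝ | p.2 = 0} = {p | 0 ≤ p.2} ∩ {p | p.2 ≤ 0} := by
      ext p; simp [le_antisymm_iff, and_comm]
    rw [e]
    refine mv_rev (isClosed_le continuous_const c2) (isClosed_le c2 continuous_const) hX ?_ ?_ ?_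
    · refine acyc_star (p := ((0 : ℝ), (-1 : ℝ))) (by simp) ?_
      intro q hq a b ha hb hab
      simp at hq ⊢
      linarith [aux_pos ha hb hab (neg_pos.mpr hq)]
    · refine acyc_star (p := ((0 : ℝ), (1 : ℝ))) (by simp) ?_
      intro q hq a b ha hb hab
      simp at hq ⊢
      linarith [aux_pos ha hb hab hq]
    · have : {p : ℝ × ℝ | 0 ≤ p.2} ∪ {p | p.2 ≤ 0} = Set.univ := by
        ext p; simpa using le_total _ _
      rw [this]
      exact van_univ hX
  have e : ({0} : Set (ℝ × ℝ)) = {p | p.2 = 0 ∧ 0 ≤ p.1} ∩ {p | p.2 = 0 ∧ p.1 ≤ 0} := by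
    ext p
    simp only [Set.mem_singleton_iff, Prod.ext_iff, Prod.fst_zero, Prod.snd_zero, Set.mem_inter_iff,
      Set.mem_setOf_eq]
    constructor
    · rintro ⟨h1, h2⟩; simp [h1, h2]
    · rintro ⟨⟨h1, h2⟩, _, h3⟩; exact ⟨le_antisymm h3 h2, h1⟩
  rw [e]
  refine mv_rev ?_ ?_ hX ?_ ?_ ?_
  · exact (isClosed_eq c2 continuous_const).inter (isClosed_le continuous_const c1)
  · exact (isClosed_eq c2 continuous_const).inter (isClosed_le c1 continuous_const)
  · refine acyc_star (p := ((-1 : ℝ), (0 : ℝ))) (by simp) ?_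
    intro q hq a b ha hb hab
    simp at hq ⊢
    rintro (h | h)
    · subst h; simp at hab; subst hab; simp
    · have := hq h; linarith [aux_pos ha hb hab (neg_pos.mpr this)]
  · refine acyc_star (p := ((1 : ℝ), (0 : ℝ))) (by simp) ?_
    intro q hq a b ha hb hab
    simp at hq ⊢
    rintro (h | h)
    · subst h; simp at hab; subst hab; simp
    · have := hq h; linarith [aux_pos ha hb hab this]
  · have : {p : ℝ × ℝ | p.2 = 0 ∧ 0 ≤ p.1} ∪ {p | p.2 = 0 ∧ p.1 ≤ 0} = {p | p.2 = 0} := by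
      ext p
      have := le_total 0 p.1
      simp; tauto
    rw [this]
    exact hL

theorem van_empty (m : ℕ) : Van (∅ : Set X) m := by
  intro z _
  exact ⟨0, by rw [Set.compl_empty]; exact mem_Ch_univ _⟩

end

end FLS

namespace FLS
section
variable {X : Type} [TopologicalSpace X] {Y : Type} [TopologicalSpace Y]

theorem mem_Ch_of_push (f : C(X, Y)) (hf : Function.Injective f) {W : Set Y} {m : ℕ}
    {c : (Sing X).C m} (h : (sMap f).push c ∈ Ch W m) : c ∈ Ch (f ⁻¹' W) m := by
  classical
  have e : ((sMap f).push (m := m)) = Finsupp.lmapDomain ℤ ℤ (fun σ : C(Dl m, X) => f.comp σ) := by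
    apply lin_ext
    intro σ
    rw [PSS.Hom.push_g]
    exact (Finsupp.mapDomain_single).symm
  have hinj : Function.Injective (fun σ : C(Dl m, X) => f.comp σ) := by
    intro σ τ h
    exact ContinuousMap.ext fun x => hf (DFunLike.congr_fun (F := C(Dl m, Y)) h x)
  rw [e, Ch, Finsupp.mem_supported, Finsupp.lmapDomain_apply,
    Finsupp.mapDomain_support_of_injective hinj] at h
  rw [Ch, Finsupp.mem_supported]
  intro σ hσ x
  exact h (by simpa using ⟨σ, by simpa using hσ, rfl⟩) x

theorem exists_compact_support_in {W : Set X} {m : ℕ} {c : (Sing X).C m} (h : c ∈ Ch W m) :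
    ∃ K : Set X, IsCompact K ∧ K ⊆ W ∧ c ∈ Ch K m := by
  obtain ⟨c', rfl⟩ := exists_lift_Ch h
  obtain ⟨K, hK, hc⟩ := exists_compact_support c'
  refine ⟨Set.image Subtype.val K, hK.image continuous_subtype_val, by simp, ?_⟩
  exact push_mem_Ch (W := K) (W' := Set.image Subtype.val K) _ (fun x hx => Set.mem_image_of_mem _ hx) hc

theorem exists_lift_emb (j : C(Y, X)) (hj : Topology.IsEmbedding j) {m : ℕ} {c : (Sing X).C m}
    (h : c ∈ Ch (Set.range j) m) : ∃ c' : (Sing Y).C m, (sMap j).push c' = c := by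
  obtain ⟨c', rfl⟩ := exists_lift_Ch h
  refine ⟨(sMap (⟨hj.toHomeomorph.symm, hj.toHomeomorph.symm.continuous⟩ : C(Set.range j, Y))).push c', ?_⟩
  rw [push_comp]
  refine congrArg (fun f : C(Set.range j, X) => (sMap f).push c') ?_
  refine ContinuousMap.ext fun x => ?_
  have : hj.toHomeomorph (hj.toHomeomorph.symm x) = x := by simp
  exact congrArg Subtype.val this

/-- points in the surface -/
theorem van_pt [T1Space X] (j : C(ℝ × ℝ, X)) (hj : Topology.IsOpenEmbedding j) {m : ℕ} (hm : 3 ≤ m) :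
    Van ({j 0} : Set X) m := by
  intro z hz
  have hcov : Set.range j ∪ {j 0}ᶜ = Set.univ := by
    rw [Set.eq_univ_iff_forall]
    intro y
    by_cases hy : y = j 0
    · exact Or.inl ⟨0, hy.symm⟩
    · exact Or.inr hy
  obtain ⟨s, -, hs⟩ := small_thm (U := Set.range j) (V := {j 0}ᶜ) hj.isOpen_range
    isClosed_singleton.isOpen_compl (u := z) (by rw [hcov]; exact mem_Ch_univ _)
    (Submodule.mem_sup_right hz)
  obtain ⟨a, ha, b, hb, he⟩ := Submodule.mem_sup.mp hs
  obtain ⟨a', rfl⟩ := exists_lift_emb j hj.isEmbedding ha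
  have e2 := congrArg (Sing X).bd he
  simp only [map_sub, map_add, PSS.bd_bd, sub_zero] at e2
  have h1 : (Sing X).bd ((sMap j).push a') ∈ Ch {j 0}ᶜ m := by
    rw [eq_sub_of_add_eq e2]
    exact Submodule.sub_mem _ hz (bd_mem_Ch hb)
  rw [PSS.Hom.bd_push] at h1
  have h2 := mem_Ch_of_push j hj.injective h1
  obtain ⟨w, hw⟩ := van_plane hm a' (Ch_mono (by
    intro q hq h0
    exact hq (by simpa using congrArg j h0)) _ h2)
  have h3 : (sMap j).push (a' - (Sing _).bd w) ∈ Ch {j 0}ᶜ (m + 1) := push_mem_Ch j (by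
    intro q hq h0
    exact hq (hj.injective h0)) hw
  refine ⟨s + (sMap j).push w, ?_⟩
  have : z - (Sing X).bd (s + (sMap j).push w) =
      (sMap j).push (a' - (Sing _).bd w) + b := by
    rw [map_add, map_sub, PSS.Hom.bd_push]
    rw [← sub_sub, ← he]
    abel
  rw [this]
  exact Submodule.add_mem _ h3 hb

theorem bisect [T2Space X] {K : Set X} (hK : IsCompact K) (f : X → ℝ) (hf : ContinuousOn f K)
    {m : ℕ} (z : (Sing X).C (m + 1)) (h1 : ∀ t, RZ (K ∩ f ⁻¹' {t}) z)
    (h2 : ∀ t, Van (K ∩ f ⁻¹' {t}) (m + 1)) : RZ K z := by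
  have key : ∀ t, ∃ O : Set ℝ, IsOpen O ∧ t ∈ O ∧ RZ (K ∩ f ⁻¹' O) z := by
    intro t
    obtain ⟨w, hw⟩ := h1 t
    obtain ⟨L, hL, hLs, hLc⟩ := exists_compact_support_in hw
    refine ⟨(Set.image f (L ∩ K))ᶜ, ?_, ?_, w, ?_⟩
    · exact ((hL.inter hK).image_of_continuousOn (hf.mono Set.inter_subset_right)).isClosed.isOpen_compl
    · rintro ⟨x, ⟨hxL, hxK⟩, hx⟩
      exact hLs hxL ⟨hxK, hx⟩
    · refine Ch_mono ?_ _ hLc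
      rintro x hxL ⟨hxK, hx⟩
      exact hx ⟨x, ⟨hxL, hxK⟩, rfl⟩
  choose O hO hOt hOz using key
  obtain ⟨a, b, hab, hKab⟩ : ∃ a b : ℝ, a ≤ b ∧ Set.image f K ⊆ Set.Icc a b := by
    obtain ⟨a, ha⟩ := (hK.image_of_continuousOn hf).bddBelow
    obtain ⟨b, hb⟩ := (hK.image_of_continuousOn hf).bddAbove
    exact ⟨a, max a b, le_max_left _ _, fun y hy => ⟨ha hy, (hb hy).trans (le_max_right _ _)⟩⟩
  obtain ⟨t, ht0, htm, ⟨N, hN⟩, htc⟩ := exists_monotone_Icc_subset_open_cover_Icc hab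
    (c := fun t => Subtype.val ⁻¹' O t) (fun t => (hO t).preimage continuous_subtype_val)
    (fun x _ => Set.mem_iUnion.mpr ⟨x, hOt _⟩)
  have hcl : ∀ a b : ℝ, IsClosed (K ∩ f ⁻¹' Set.Icc a b) := fun a b =>
    hf.preimage_isClosed_of_isClosed hK.isClosed isClosed_Icc
  have main : ∀ n, RZ (K ∩ f ⁻¹' Set.Icc a (t n : ℝ)) z := by
    intro n
    induction n with
    | zero => rw [ht0, Set.Icc_self]; exact h1 a
    | succ n ih =>
      have hle : (t n : ℝ) ≤ t (n + 1) := htm (Nat.le_succ n)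
      have hla : a ≤ t n := (t n).2.1
      have e : K ∩ f ⁻¹' Set.Icc a (t (n + 1) : ℝ) =
          (K ∩ f ⁻¹' Set.Icc a (t n : ℝ)) ∪ (K ∩ f ⁻¹' Set.Icc (t n : ℝ) (t (n + 1))) := by
        rw [← Set.inter_union_distrib_left, ← Set.preimage_union, Set.Icc_union_Icc_eq_Icc hla hle]
      rw [e]
      refine mv (hcl _ _) (hcl _ _) z ih ?_ ?_
      · obtain ⟨i, hi⟩ := htc n
        refine RZ.mono ?_ (hOz i)
        rintro x ⟨hx, hx2⟩
        refine ⟨hx, ?_⟩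
        exact @hi ⟨f x, hKab ⟨x, hx, rfl⟩⟩ ⟨hx2.1, hx2.2⟩
      · have : (K ∩ f ⁻¹' Set.Icc a (t n : ℝ)) ∩ (K ∩ f ⁻¹' Set.Icc (t n : ℝ) (t (n + 1))) =
            K ∩ f ⁻¹' {(t n : ℝ)} := by
          ext x
          simp only [Set.mem_inter_iff, Set.mem_preimage, Set.mem_Icc, Set.mem_singleton_iff]
          constructor
          · rintro ⟨⟨h, h1, h2⟩, _, h3, h4⟩; exact ⟨h, le_antisymm h2 h3⟩
          · rintro ⟨h, h1⟩; rw [h1]; exact ⟨⟨h, hla, le_rfl⟩, h, le_rfl, hle⟩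
        rw [this]; exact h2 _
  refine RZ.mono ?_ (main N)
  intro x hx
  refine ⟨hx, ?_⟩
  have := hKab ⟨x, hx, rfl⟩
  rw [Set.mem_preimage, hN N le_rfl]
  exact this

/-- compact sets on which vanishing is pointwise -/
def Good (K : Set X) : Prop :=
  ∀ m, 2 ≤ m → ∀ z : (Sing X).C (m + 1), (∀ x ∈ K, RZ {x} z) → RZ K z

/-- surface: covered by charts -/
def Surf (X : Type) [TopologicalSpace X] : Prop :=
  ∀ x : X, ∃ j : C(ℝ × ℝ, X), Topology.IsOpenEmbedding j ∧ j 0 = x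

theorem Good.van [T1Space X] (hX : Surf X) {K : Set X} (hK : Good K) {m : ℕ} (hm : 3 ≤ m) :
    Van K m := by
  intro z hz
  refine hK m (by omega) z fun x hx => ?_
  obtain ⟨j, hj, rfl⟩ := hX x
  exact van_pt j hj hm z (Ch_mono (Set.compl_subset_compl.mpr (by simpa using hx)) _ hz)

theorem good_bisect [T2Space X] (hX : Surf X) {K : Set X} (hK : IsCompact K) (f : X → ℝ)
    (hf : ContinuousOn f K) (h : ∀ t, Good (K ∩ f ⁻¹' {t})) : Good K := by
  intro m hm z hz
  refine bisect hK f hf z (fun t => h t m hm z fun x hx => hz x hx.1) fun t => ?_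
  exact (h t).van hX (by omega)

theorem good_sub {K : Set X} (hK : K.Subsingleton) : Good K := by
  intro m hm z hz
  rcases hK.eq_empty_or_singleton with rfl | ⟨x, rfl⟩
  · exact ⟨0, by rw [Set.compl_empty]; exact mem_Ch_univ _⟩
  · exact hz x rfl

theorem good_chart [T2Space X] (hX : Surf X) (j : C(ℝ × ℝ, X)) (hj : Topology.IsOpenEmbedding j)
    {K : Set X} (hK : IsCompact K) (hKj : K ⊆ Set.range j) : Good K := by
  let q := Function.invFun j
  have hjq : ∀ x ∈ Set.range j, j (q x) = x := fun x hx => Function.invFun_eq hx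
  have hq : ContinuousOn q (Set.range j) := by
    rw [continuousOn_iff_continuous_domRestrict]
    have : (Set.range j).domRestrict q = hj.isEmbedding.toHomeomorph.symm := by
      ext1 x
      apply hj.injective
      have h2 : hj.isEmbedding.toHomeomorph (hj.isEmbedding.toHomeomorph.symm x) = x := by simp
      exact (hjq _ x.2).trans (congrArg Subtype.val h2).symm
    rw [this]; exact Homeomorph.continuous _
  have c1 : ContinuousOn (fun x => (q x).1) K := continuous_fst.comp_continuousOn (hq.mono hKj)
  have c2 : ContinuousOn (fun x => (q x).2) K := continuous_snd.comp_continuousOn (hq.mono hKj)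
  refine good_bisect hX hK _ c1 fun t => ?_
  have hKt : IsCompact (K ∩ (fun x => (q x).1) ⁻¹' {t}) :=
    hK.of_isClosed_subset (c1.preimage_isClosed_of_isClosed hK.isClosed isClosed_singleton)
      Set.inter_subset_left
  refine good_bisect hX hKt _ (c2.mono Set.inter_subset_left) fun s => good_sub ?_
  rintro x ⟨⟨hx, hx1⟩, hx2⟩ y ⟨⟨hy, hy1⟩, hy2⟩
  rw [← hjq x (hKj hx), ← hjq y (hKj hy)]
  congr 1
  exact Prod.ext (hx1.trans hy1.symm) (hx2.trans hy2.symm)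

theorem good_union [T2Space X] (hX : Surf X) {A B : Set X} (hA : IsClosed A) (hB : IsClosed B)
    (gA : Good A) (gB : Good B) (gAB : Good (A ∩ B)) : Good (A ∪ B) := by
  intro m hm z hz
  exact mv hA hB z (gA m hm z fun x hx => hz x (Or.inl hx)) (gB m hm z fun x hx => hz x (Or.inr hx))
    (gAB.van hX (by omega))

theorem good_compact [T2Space X] (hX : Surf X) {K : Set X} (hK : IsCompact K) : Good K := by
  classical
  choose j hj hj0 using hX
  obtain ⟨t, ht⟩ := hK.elim_finite_subcover (fun x => Set.range (j x)) (fun x => (hj x).isOpen_range)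
    (fun x _ => Set.mem_iUnion.mpr ⟨x, 0, hj0 x⟩)
  obtain ⟨L, hL, hLj, rfl⟩ := hK.finite_compact_cover t _ (fun x _ => (hj x).isOpen_range) ht
  clear ht hK
  have hX : Surf X := fun x => ⟨j x, hj x, hj0 x⟩
  induction t using Finset.induction_on with
  | empty => simpa using good_sub Set.subsingleton_empty
  | insert a s ha ih =>
    rw [Finset.set_biUnion_insert]
    have hc : IsCompact (⋃ x ∈ s, L x) := s.isCompact_biUnion fun i _ => hL i
    exact good_union hX (hL a).isClosed hc.isClosed (good_chart hX (j a) (hj a) (hL a) (hLj a)) ih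
      (good_chart hX (j a) (hj a) ((hL a).inter hc) (Set.inter_subset_left.trans (hLj a)))

theorem push_hom [T2Space X] (j : C(ℝ × ℝ, X)) (hj : Topology.IsOpenEmbedding j) {x y : ℝ × ℝ}
    (hx : ‖x‖ < 1) (hy : ‖y‖ < 1) : ∃ H : C(X × unitInterval, X), (∀ p, H (p, 0) = p) ∧
      ∀ p, p ≠ j x → H (p, 1) ≠ j y := by
  classical
  let q := Function.invFun j
  have hjq : ∀ x ∈ Set.range j, j (q x) = x := fun x hx => Function.invFun_eq hx
  have hqj : ∀ x, q (j x) = x := fun x => hj.injective (hjq _ ⟨x, rfl⟩)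
  have hq : ContinuousOn q (Set.range j) := by
    rw [continuousOn_iff_continuous_domRestrict]
    have : (Set.range j).domRestrict q = hj.isEmbedding.toHomeomorph.symm := by
      ext1 x
      apply hj.injective
      have h2 : hj.isEmbedding.toHomeomorph (hj.isEmbedding.toHomeomorph.symm x) = x := by simp
      exact (hjq _ x.2).trans (congrArg Subtype.val h2).symm
    rw [this]; exact Homeomorph.continuous _
  let G : (ℝ × ℝ) × unitInterval → ℝ × ℝ := fun u =>
    u.1 + ((u.2 : ℝ) * max 0 (1 - ‖u.1 - x‖ / 5)) • (y - x)
  have hG : Continuous G := by fun_prop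
  let H : X × unitInterval → X := fun u => if u.1 ∈ Set.range j then j (G (q u.1, u.2)) else u.1
  have hH : Continuous H := by
    rw [← continuousOn_univ]
    have hB : IsClosed (Set.image j (Metric.closedBall x 5)) :=
      ((isCompact_closedBall x 5).image j.continuous).isClosed
    have e : (Set.univ : Set (X × unitInterval)) = (Prod.fst ⁻¹' Set.range j) ∪
        (Prod.fst ⁻¹' (Set.image j (Metric.closedBall x 5))ᶜ) := by
      rw [eq_comm, Set.eq_univ_iff_forall]
      rintro ⟨p, t⟩
      by_cases hp : p ∈ Set.range j
      · exact Or.inl hp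
      · right
        rintro ⟨r, _, hr⟩
        exact hp ⟨r, hr⟩
    rw [e]
    refine ContinuousOn.union_of_isOpen ?_ ?_ (hj.isOpen_range.preimage continuous_fst)
      (hB.isOpen_compl.preimage continuous_fst)
    · have : ContinuousOn (fun u : X × unitInterval => j (G (q u.1, u.2))) (Prod.fst ⁻¹' Set.range j) := by
        refine j.continuous.comp_continuousOn (hG.comp_continuousOn ?_)
        exact (hq.comp continuous_fst.continuousOn (fun u hu => hu)).prodMk continuous_snd.continuousOn
      refine this.congr fun u hu => ?_
      exact if_pos hu
    · refine continuous_fst.continuousOn.congr fun u hu => ?_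
      by_cases h : u.1 ∈ Set.range j
      · obtain ⟨r, hr⟩ := h
        have h5 : 5 < ‖r - x‖ := by
          by_contra hcon
          refine hu ⟨r, ?_, hr⟩
          rw [Metric.mem_closedBall, dist_eq_norm]; linarith
        have : H u = j (G (q u.1, u.2)) := if_pos ⟨r, hr⟩
        rw [this, ← hr, hqj]
        congr 1
        simp only [G]
        rw [max_eq_left (by linarith)]
        simp
      · exact if_neg h
  refine ⟨⟨H, hH⟩, ?_, ?_⟩
  · intro p
    change H (p, 0) = p
    by_cases h : p ∈ Set.range j
    · have : H (p, 0) = j (G (q p, 0)) := if_pos h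
      rw [this]
      simp [G, hjq p h]
    · exact if_neg h
  · intro p hp
    change H (p, 1) ≠ j y
    by_cases h : p ∈ Set.range j
    · have : H (p, 1) = j (G (q p, 1)) := if_pos h
      rw [this]
      intro hG2
      have hG3 := hj.injective hG2
      obtain ⟨r, rfl⟩ := h
      rw [hqj] at hG3
      simp only [G, Set.Icc.coe_one, one_mul] at hG3
      set l := max 0 (1 - ‖r - x‖ / 5) with hl
      have e : r - x = (1 - l) • (y - x) := by
        rw [sub_smul, one_smul, ← sub_eq_zero, ← sub_eq_zero.mpr hG3]; abel
      have hl1 : 1 - l ≤ ‖r - x‖ / 5 := by linarith [le_max_right 0 (1 - ‖r - x‖ / 5)]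
      have hl0 : 0 ≤ 1 - l := by
        have : l ≤ 1 := max_le zero_le_one (by linarith [div_nonneg (norm_nonneg (r - x)) (by norm_num : (0:ℝ) ≤ 5)])
        linarith
      have n1 : ‖r - x‖ = (1 - l) * ‖y - x‖ := by
        conv_lhs => rw [e]
        rw [norm_smul, Real.norm_of_nonneg hl0]
      have n2 : ‖y - x‖ ≤ 2 := by linarith [norm_sub_le y x]
      have n3 : (1 - l) * ‖y - x‖ ≤ (‖r - x‖ / 5) * 2 :=
        mul_le_mul hl1 n2 (norm_nonneg _) (by positivity)
      have n4 : ‖r - x‖ = 0 := le_antisymm (by linarith) (norm_nonneg _)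
      rw [norm_eq_zero, sub_eq_zero] at n4
      exact hp (by rw [n4])
    · have : H (p, 1) = p := if_neg h
      rw [this]
      rintro rfl
      exact h ⟨y, rfl⟩

theorem rz_loc [T2Space X] (j : C(ℝ × ℝ, X)) (hj : Topology.IsOpenEmbedding j) {x y : ℝ × ℝ}
    (hx : ‖x‖ < 1) (hy : ‖y‖ < 1) {m : ℕ} (z : (Sing X).C (m + 1)) (hz : (Sing X).bd z = 0)
    (h : RZ {j x} z) : RZ {j y} z := by
  obtain ⟨H, H0, H1⟩ := push_hom j hj hx hy
  obtain ⟨w, hw⟩ := h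
  have e := bd_Pr H z
  have e0 : endp H 0 = ContinuousMap.id X := ContinuousMap.ext H0
  rw [hz, map_zero, sub_zero, e0, push_id] at e
  refine ⟨(sMap (endp H 1)).push w - Pr H (m + 1) z, ?_⟩
  have e2 : z - (Sing X).bd ((sMap (endp H 1)).push w - Pr H (m + 1) z) =
      (sMap (endp H 1)).push (z - (Sing X).bd w) := by
    simp only [map_sub, e, PSS.Hom.bd_push]; abel
  rw [e2]
  exact push_mem_Ch _ (fun p hp => H1 p hp) hw

theorem rz_pt [T2Space X] (hX : Surf X)
    (hnc : ∀ (x : X) (K : Set X), IsCompact K → ∃ y ∈ connectedComponent x, y ∉ K)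
    {m : ℕ} (z : (Sing X).C (m + 1)) (hz : (Sing X).bd z = 0) (x : X) : RZ {x} z := by
  have op : ∀ x, ∃ O : Set X, IsOpen O ∧ x ∈ O ∧ ∀ y ∈ O, (RZ {x} z ↔ RZ {y} z) := by
    intro x
    obtain ⟨j, hj, rfl⟩ := hX x
    refine ⟨Set.image j (Metric.ball 0 1), hj.isOpenMap _ Metric.isOpen_ball, ⟨0, by simp, rfl⟩, ?_⟩
    rintro _ ⟨y, hy, rfl⟩
    rw [mem_ball_zero_iff] at hy
    exact ⟨rz_loc j hj (by simp) hy z hz, rz_loc j hj hy (by simp) z hz⟩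
  have hcl : IsClopen {x | ¬ RZ {x} z} := by
    constructor
    · rw [← isOpen_compl_iff, isOpen_iff_forall_mem_open]
      intro x hx
      obtain ⟨O, hO, hxO, h⟩ := op x
      refine ⟨O, fun y hy h2 => h2 ?_, hO, hxO⟩
      exact (h y hy).mp (not_not.mp hx)
    · rw [isOpen_iff_forall_mem_open]
      intro x hx
      obtain ⟨O, hO, hxO, h⟩ := op x
      exact ⟨O, fun y hy h2 => hx ((h y hy).mpr h2), hO, hxO⟩
  by_contra hcon
  obtain ⟨L, hL, hzL⟩ := exists_compact_support z
  obtain ⟨y, hy, hyL⟩ := hnc x L hL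
  refine hcl.connectedComponent_subset hcon hy ⟨0, ?_⟩
  rw [map_zero, sub_zero]
  refine Ch_mono ?_ _ hzL
  rintro p hp rfl
  exact hyL hp

theorem Ch_split {U V : Set X} (hU : IsOpen U) (hV : IsOpen V) (hd : Disjoint U V) {m : ℕ}
    {c : (Sing X).C m} (hc : c ∈ Ch (U ∪ V) m) : c ∈ Ch U m ⊔ Ch V m := by
  refine map_mem_of_supported LinearMap.id _ _ ?_ hc
  intro (σ : C(Dl m, X)) hσ
  have hpre : _root_.IsPreconnected (Set.range σ) := by
    have : _root_.IsPreconnected (Set.univ : Set (Dl m)) := by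
      have := isPreconnected_iff_preconnectedSpace.mp (convex_stdSimplex ℝ (Fin m)).isPreconnected
      exact isPreconnected_univ
    rw [← Set.image_univ]
    exact this.image _ σ.continuous.continuousOn
  by_cases hne : (Set.range σ ∩ U).Nonempty
  · refine Submodule.mem_sup_left (g_mem_Ch fun x => ?_)
    exact hpre.subset_left_of_subset_union hU hV hd (by rintro _ ⟨x, rfl⟩; exact hσ x) hne ⟨x, rfl⟩
  · refine Submodule.mem_sup_right (g_mem_Ch fun x => ?_)
    exact (hσ x).resolve_left fun h => hne ⟨_, ⟨x, rfl⟩, h⟩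

theorem surf_cycle [T2Space X] (hX : Surf X)
    (hnc : ∀ (x : X) (K : Set X), IsCompact K → ∃ y ∈ connectedComponent x, y ∉ K)
    {m : ℕ} (hm : 2 ≤ m) (z : (Sing X).C (m + 1)) (hz : (Sing X).bd z = 0) :
    ∃ w, (Sing X).bd w = z := by
  have : WeaklyLocallyCompactSpace X := ⟨fun x => by
    obtain ⟨j, hj, rfl⟩ := hX x
    exact ⟨Set.image j (Metric.closedBall 0 1), (isCompact_closedBall _ _).image j.continuous,
      hj.isOpenMap.image_mem_nhds (Metric.closedBall_mem_nhds _ one_pos)⟩⟩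
  obtain ⟨L, hL, hzL⟩ := exists_compact_support z
  obtain ⟨A, hA, hLA⟩ := exists_compact_superset hL
  obtain ⟨w, hw⟩ := good_compact hX hA m hm z fun x _ => rz_pt hX hnc z hz x
  have hfr : IsCompact (frontier A) := hA.of_isClosed_subset isClosed_frontier
    hA.isClosed.frontier_subset
  obtain ⟨w', hw'⟩ := (good_compact hX hfr).van hX (m := m + 1) (by omega) w (by
    have e : (Sing X).bd w = z - (z - (Sing X).bd w) := by abel
    rw [e]
    refine Submodule.sub_mem _ (Ch_mono ?_ _ hzL) (Ch_mono ?_ _ hw)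
    · intro x hx hx2; exact hx2.2 (hLA hx)
    · exact Set.compl_subset_compl.mpr hA.isClosed.frontier_subset)
  have hd : Disjoint (interior A) Aᶜ := by
    rw [Set.disjoint_compl_right_iff_subset]; exact interior_subset
  obtain ⟨a, ha, b, hb, he⟩ := Submodule.mem_sup.mp (Ch_split isOpen_interior hA.isClosed.isOpen_compl hd
    (Ch_mono (W' := interior A ∪ Aᶜ) (by
      intro x hx
      by_cases h : x ∈ interior A
      · exact Or.inl h
      · exact Or.inr fun h2 => hx ⟨subset_closure h2, h⟩) _ hw'))
  have e2 := congrArg (Sing X).bd he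
  simp only [map_sub, map_add, PSS.bd_bd, sub_zero] at e2
  refine ⟨a, ?_⟩
  have h1 : (Sing X).bd a - z ∈ Ch (interior A ∩ Aᶜ) (m + 1) := by
    refine Ch_inter (Submodule.sub_mem _ (bd_mem_Ch ha) (Ch_mono hLA _ hzL)) ?_
    have : (Sing X).bd a - z = -((z - (Sing X).bd w) + (Sing X).bd b) := by rw [← e2]; abel
    rw [this]
    exact Submodule.neg_mem _ (Submodule.add_mem _ hw (bd_mem_Ch hb))
  rw [hd.inter_eq] at h1
  exact sub_eq_zero.mp (Ch_empty h1)

end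

end FLS

namespace FLS
section
variable {X : Type} [TopologicalSpace X]

theorem cof_apply_self {m : ℕ} (i : Fin (m + 1)) (y : Dl m) : (cof i y) i = 0 := cof_self i y

/-- points having a vanishing coordinate in I -/
def Fc {m : ℕ} (I : Set (Fin m)) : Set (Dl m) := {x | ∃ i ∈ I, x i = 0}

/-- drop a vanishing coordinate -/
noncomputable def drop {m : ℕ} (i : Fin (m + 1)) : C({x : Dl (m + 1) | x i = 0}, Dl m) :=
  ⟨fun x => ⟨fun k => x.1 (i.succAbove k), fun k => x.1.2.1 _, by
    have := x.1.2.2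
    rw [Fin.sum_univ_succAbove _ i] at this
    have h0 : x.1 i = 0 := x.2
    change x.1 i + _ = 1 at this
    rw [h0, zero_add] at this
    exact this⟩, by
    refine Continuous.subtype_mk (continuous_pi fun k => ?_) _
    exact (continuous_apply (i.succAbove k)).comp
      (continuous_subtype_val.comp continuous_subtype_val)⟩

theorem cof_drop {m : ℕ} (i : Fin (m + 1)) (x : {x : Dl (m + 1) | x i = 0}) :
    cof i (drop i x) = x := by
  apply Subtype.ext
  funext k
  rcases Fin.eq_self_or_eq_succAbove i k with rfl | ⟨l, rfl⟩
  · exact (cof_self k _).trans x.2.symm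
  · exact cof_succAbove i _ l

theorem cof_inj {m : ℕ} (i : Fin (m + 1)) : Function.Injective (cof i) := by
  intro x y h
  apply Subtype.ext
  funext k
  have := congrArg (fun z : Dl (m + 1) => z (i.succAbove k)) h
  exact (cof_succAbove i x k).symm.trans (this.trans (cof_succAbove i y k))

theorem glue {m : ℕ} (I : Set (Fin (m + 1))) (t : Fin (m + 1) → C(Dl m, X))
    (hc : ∀ i ∈ I, ∀ j ∈ I, ∀ y y', cof i y = cof j y' → t i y = t j y') :
    ∃ f : C(Fc I, X), ∀ i (hi : i ∈ I) y, f ⟨cof i y, i, hi, cof_self i y⟩ = t i y := by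
  classical
  let S : I → Set (Fc I) := fun i => {x | x.1 i.1 = 0}
  have hS : ∀ x : Fc I, ∃ i, x ∈ S i := fun x => by
    obtain ⟨i, hi, h⟩ := x.2
    exact ⟨⟨i, hi⟩, h⟩
  let φ : ∀ i : I, S i → X := fun i x => t i.1 (drop i.1 ⟨x.1.1, x.2⟩)
  have hφ : ∀ (i j : I) (x : Fc I) (hi : x ∈ S i) (hj : x ∈ S j), φ i ⟨x, hi⟩ = φ j ⟨x, hj⟩ := by
    intro i j x hi hj
    refine hc _ i.2 _ j.2 _ _ ?_
    rw [cof_drop, cof_drop]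
  have hcov : ⋃ i, S i = Set.univ := by
    rw [Set.eq_univ_iff_forall]; exact fun x => Set.mem_iUnion.mpr (hS x)
  let f := Set.liftCover S φ hφ hcov
  have hcl : ∀ i, IsClosed (S i) := fun i => isClosed_eq
    ((continuous_apply i.1).comp (continuous_subtype_val.comp continuous_subtype_val)) continuous_const
  have hf : Continuous f := by
    refine (locallyFinite_of_finite S).continuous hcov hcl fun i => ?_
    rw [continuousOn_iff_continuous_domRestrict]
    have : (S i).domRestrict f = φ i := by
      ext1 x
      exact Set.liftCover_coe (S := S) (f := φ) (hf := hφ) (hS := hcov) x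
    rw [this]
    refine (t i.1).continuous.comp ((drop i.1).continuous.comp ?_)
    exact Continuous.subtype_mk (continuous_subtype_val.comp continuous_subtype_val) _
  refine ⟨⟨f, hf⟩, fun i hi y => ?_⟩
  have h1 : f ⟨cof i y, i, hi, cof_self i y⟩ = φ ⟨i, hi⟩ ⟨⟨cof i y, i, hi, cof_self i y⟩, cof_self i y⟩ :=
    Set.liftCover_coe (S := S) (f := φ) (hf := hφ) (hS := hcov) (i := ⟨i, hi⟩) ⟨_, _⟩
  refine h1.trans ?_
  change t i (drop i _) = t i y
  congr 1
  apply cof_inj i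
  rw [cof_drop]

theorem compat_pt {m : ℕ} (I : Set (Fin (m + 2))) (t : Fin (m + 2) → C(Dl (m + 1), X))
    (hc : ∀ i j : Fin (m + 1), i ≤ j → i.castSucc ∈ I → j.succ ∈ I →
      (t j.succ).comp (cof i) = (t i.castSucc).comp (cof j)) :
    ∀ i ∈ I, ∀ j ∈ I, ∀ y y', cof i y = cof j y' → t i y = t j y' := by
  have key : ∀ i ∈ I, ∀ j ∈ I, i < j → ∀ y y', cof i y = cof j y' → t i y = t j y' := by
    intro i hi j hj hij y y' h
    obtain ⟨j, rfl⟩ : ∃ j', j = Fin.succ j' := ⟨j.pred (Fin.ne_zero_of_lt hij), by simp⟩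
    obtain ⟨i, rfl⟩ : ∃ i', i = Fin.castSucc i' := ⟨i.castPred (Fin.ne_last_of_lt hij), by simp⟩
    have hle : i ≤ j := by rw [Fin.lt_def] at hij; rw [Fin.le_def]; simp at hij; omega
    -- y vanishes at j, y' vanishes at i
    have hy' : y' i = 0 := by
      have h1 := congrArg (fun z : Dl (m + 2) => z i.castSucc) h
      have h2 : (cof i.castSucc y) i.castSucc = 0 := cof_self _ _
      have h3 : i.castSucc = j.succ.succAbove i := by
        rw [Fin.succAbove_of_castSucc_lt _ _ hij]
      have h4 := cof_succAbove j.succ y' i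
      rw [← h3] at h4
      exact h4.symm.trans (h1.symm.trans h2)
    have e : cof i (drop i ⟨y', hy'⟩) = y' := cof_drop i _
    have e2 : y = cof j (drop i ⟨y', hy'⟩) := by
      apply cof_inj i.castSucc
      rw [h]
      conv_lhs => rw [← e]
      exact DFunLike.congr_fun (cof_cof i j hle) _
    rw [e2]
    conv_rhs => rw [← e]
    exact (DFunLike.congr_fun (hc i j hle hi hj) _).symm
  intro i hi j hj y y' h
  rcases lt_trichotomy i j with hij | rfl | hij
  · exact key i hi j hj hij y y' h
  · rw [cof_inj i h]
  · exact (key j hj i hi hij y' y h.symm).symm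

/-- horn retraction -/
theorem horn_retract {m : ℕ} (k : Fin (m + 2)) :
    ∃ r : C(Dl (m + 2), Fc {i : Fin (m + 2) | i ≠ k}), ∀ x : Fc {i : Fin (m + 2) | i ≠ k}, r x = x := by
  classical
  have hne : (Finset.univ : Finset (Fin (m + 1))).Nonempty := Finset.univ_nonempty
  let μ : Dl (m + 2) → ℝ := fun x => Finset.univ.inf' hne fun l => x (k.succAbove l)
  have hco : ∀ i : Fin (m + 2), Continuous fun x : Dl (m + 2) => x i := fun i =>
    (continuous_apply i).comp continuous_subtype_val
  have hμ : Continuous μ := Continuous.finset_inf'_apply hne fun l _ => hco _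
  have hμle : ∀ x l, μ x ≤ x (k.succAbove l) := fun x l => Finset.inf'_le _ (Finset.mem_univ l)
  have hμ0 : ∀ x, 0 ≤ μ x := fun x => Finset.le_inf' _ _ fun l _ => x.2.1 _
  let y : Dl (m + 2) → Fin (m + 2) → ℝ := fun x => k.insertNth (x k + (m + 1) * μ x)
    (fun l => x (k.succAbove l) - μ x)
  have hy : ∀ x, y x ∈ stdSimplex ℝ (Fin (m + 2)) := by
    intro x
    constructor
    · intro i
      rcases Fin.eq_self_or_eq_succAbove k i with rfl | ⟨l, rfl⟩
      · simp only [y, Fin.insertNth_apply_same]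
        have := x.2.1 i
        have h2 := hμ0 x
        change 0 ≤ x i at this
        positivity
      · simp only [y, Fin.insertNth_apply_succAbove]
        linarith [hμle x l]
    · have := x.2.2
      rw [Fin.sum_univ_succAbove _ k] at this ⊢
      simp only [y, Fin.insertNth_apply_same, Fin.insertNth_apply_succAbove, Finset.sum_sub_distrib]
      change x k + ∑ i, x (k.succAbove i) = 1 at this
      simp
      linarith
  have hyc : Continuous y := by
    refine continuous_pi fun i => ?_
    rcases Fin.eq_self_or_eq_succAbove k i with rfl | ⟨l, rfl⟩
    · simp only [y, Fin.insertNth_apply_same]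
      exact (hco _).add (continuous_const.mul hμ)
    · simp only [y, Fin.insertNth_apply_succAbove]
      exact (hco _).sub hμ
  refine ⟨⟨fun x => ⟨⟨y x, hy x⟩, ?_⟩, ?_⟩, ?_⟩
  · obtain ⟨l, -, hl⟩ := Finset.exists_mem_eq_inf' hne (fun l => x (k.succAbove l))
    refine ⟨k.succAbove l, Fin.succAbove_ne k l, ?_⟩
    change y x (k.succAbove l) = 0
    simp only [y, Fin.insertNth_apply_succAbove]
    exact sub_eq_zero.mpr hl.symm
  · exact Continuous.subtype_mk (Continuous.subtype_mk hyc _) _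
  · rintro ⟨x, i, hi, hx⟩
    obtain ⟨l, rfl⟩ := Fin.exists_succAbove_eq hi
    have h0 : μ x = 0 := le_antisymm ((hμle x l).trans hx.le) (hμ0 x)
    apply Subtype.ext
    apply Subtype.ext
    funext i
    change y x i = x i
    rcases Fin.eq_self_or_eq_succAbove k i with rfl | ⟨l, rfl⟩
    · simp only [y, Fin.insertNth_apply_same, h0, mul_zero, add_zero]
    · simp only [y, Fin.insertNth_apply_succAbove, h0, sub_zero]

theorem horn_fill {m : ℕ} (k : Fin (m + 2)) (t : Fin (m + 2) → C(Dl (m + 1), X))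
    (hc : ∀ i j : Fin (m + 1), i ≤ j → i.castSucc ≠ k → j.succ ≠ k →
      (t j.succ).comp (cof i) = (t i.castSucc).comp (cof j)) :
    ∃ F : C(Dl (m + 2), X), ∀ i, i ≠ k → F.comp (cof i) = t i := by
  obtain ⟨f, hf⟩ := glue _ t (compat_pt {i | i ≠ k} t hc)
  obtain ⟨r, hr⟩ := horn_retract k
  refine ⟨f.comp r, fun i hi => ContinuousMap.ext fun y => ?_⟩
  have := hr ⟨cof i y, i, hi, cof_self i y⟩
  change f (r (cof i y)) = _
  rw [this, hf i hi]

end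

end FLS

namespace FLS

/-- 4-term filling structure with array condition -/
structure WS (A : Type) where
  e : A
  W : A → A → A → A → Prop
  arr : ∀ a01 a02 a03 a04 a12 a13 a14 a23 a24 a34,
    (W a01 a12 a13 a14 → W a02 a12 a23 a24 → W a03 a13 a23 a34 → W a04 a14 a24 a34 → W a01 a02 a03 a04) ∧
    (W a01 a02 a03 a04 → W a02 a12 a23 a24 → W a03 a13 a23 a34 → W a04 a14 a24 a34 → W a01 a12 a13 a14) ∧
    (W a01 a02 a03 a04 → W a01 a12 a13 a14 → W a03 a13 a23 a34 → W a04 a14 a24 a34 → W a02 a12 a23 a24) ∧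
    (W a01 a02 a03 a04 → W a01 a12 a13 a14 → W a02 a12 a23 a24 → W a04 a14 a24 a34 → W a03 a13 a23 a34) ∧
    (W a01 a02 a03 a04 → W a01 a12 a13 a14 → W a02 a12 a23 a24 → W a03 a13 a23 a34 → W a04 a14 a24 a34)
  h0 : ∀ b c d, ∃ a, W a b c d
  h1 : ∀ a c d, ∃ b, W a b c d
  h2 : ∀ a b d, ∃ c, W a b c d
  h3 : ∀ a b c, ∃ d, W a b c d
  d0 : ∀ a, W a a e e
  d1 : ∀ a, W e a a e
  d2 : ∀ a, W e e a a

namespace WS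
variable {A : Type} (S : WS A)

theorem symm {a b : A} (h : S.W a b S.e S.e) : S.W b a S.e S.e :=
  (S.arr a b S.e S.e a S.e S.e S.e S.e S.e).2.2.1 h (S.d0 a) (S.d0 _) (S.d0 _)

theorem trans {a b c : A} (h : S.W a b S.e S.e) (h' : S.W b c S.e S.e) : S.W a c S.e S.e :=
  (S.arr a b S.e S.e c S.e S.e S.e S.e S.e).2.1 h h' (S.d0 _) (S.d0 _)

theorem e01 {a c : A} : S.W a c S.e S.e ↔ S.W S.e a c S.e := by
  have cyc : ∀ a c d, S.W a a S.e S.e → S.W S.e a c S.e → S.W a S.e d S.e → S.W d S.e c S.e :=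
    fun a c d h1 h2 h3 => (S.arr a S.e d S.e a S.e S.e c S.e S.e).2.2.2.1 h3 h1 h2 (S.d0 _)
  have sy : ∀ a d, S.W a S.e d S.e → S.W d S.e a S.e := fun a d h => cyc a a d (S.d0 a) (S.d1 a) h
  constructor
  · intro h
    obtain ⟨d, hd⟩ := S.h2 a S.e S.e
    have h1 := sy _ _ hd
    -- tri 013
    have h2 : S.W d S.e c S.e := (S.arr d S.e a S.e S.e c S.e S.e S.e S.e).2.1 h1 (S.d0 _) h (S.d0 _)
    exact (S.arr S.e a c S.e S.e S.e S.e d S.e S.e).1 (S.d0 _) hd (sy _ _ h2) (S.d0 _)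
  · intro h
    obtain ⟨d, hd⟩ := S.h2 a S.e S.e
    have h1 := sy _ _ hd
    have h2 := cyc a c d (S.d0 a) h hd
    exact (S.arr d S.e a S.e S.e c S.e S.e S.e S.e).2.2.2.1 h1 h2 (S.d0 _) (S.d0 _)

theorem e12 {a c : A} : S.W S.e a c S.e ↔ S.W S.e S.e a c := by
  have cyc : ∀ a c d, S.W S.e S.e a c → S.W S.e a S.e d → S.W S.e d S.e c :=
    fun a c d h2 h3 => (S.arr S.e S.e S.e S.e a S.e d a S.e c).2.2.2.2 (S.d0 _) h3 (S.d1 a) h2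
  have sy : ∀ a d, S.W S.e a S.e d → S.W S.e d S.e a := fun a d h => cyc a a d (S.d2 a) h
  constructor
  · intro h
    obtain ⟨d, hd⟩ := S.h3 S.e a S.e
    have h1 := sy _ _ hd
    have h2 : S.W S.e d S.e c := (S.arr S.e S.e S.e S.e d S.e a S.e c S.e).2.2.1 (S.d0 _) h1 (S.d0 _) h
    exact (S.arr S.e S.e S.e S.e S.e a c S.e S.e d).2.1 (S.d0 _) (S.d0 _) hd (sy _ _ h2)
  · intro h
    obtain ⟨d, hd⟩ := S.h3 S.e a S.e
    have h1 := sy _ _ hd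
    have h2 := cyc a c d h hd
    exact (S.arr S.e S.e S.e S.e d S.e a S.e c S.e).2.2.2.2 (S.d0 _) h1 h2 (S.d0 _)

theorem group (u0 : ∀ a a' b c d, S.W a b c d → S.W a' b c d → a = a')
    (u1 : ∀ a b b' c d, S.W a b c d → S.W a b' c d → b = b')
    (u2 : ∀ a b c c' d, S.W a b c d → S.W a b c' d → c = c')
    (u3 : ∀ a b c d d', S.W a b c d → S.W a b c d' → d = d') :
    ∃ G : AddCommGroup A, G.zero = S.e ∧ ∀ a b c d, S.W a b c d ↔ G.add a c = G.add b d := by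
  let e := S.e
  choose op hop using fun a b => S.h1 a b e
  have P : ∀ a c b, S.W a c b e ↔ c = op a b := fun a c b =>
    ⟨fun h => u1 _ _ _ _ _ h (hop a b), fun h => h ▸ hop a b⟩
  have triv : S.W e e e e := S.d0 e
  have assoc : ∀ a b c, op (op a b) c = op a (op b c) := fun a b c =>
    (P _ _ _).mp ((S.arr a (op a b) b e (op (op a b) c) (op b c) e c e e).2.1 (hop a b)
      (hop (op a b) c) (hop b c) triv)
  have eop : ∀ a, op e a = a := fun a => ((P _ _ _).mp (S.d1 a)).symm
  have ope : ∀ a, op a e = a := fun a => ((P _ _ _).mp (S.d0 a)).symm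
  choose iv hiv using fun a => S.h0 e a e
  have liv : ∀ a, op (iv a) a = e := fun a => ((P _ _ _).mp (hiv a)).symm
  have riv : ∀ a, op a (iv a) = e := fun a => by
    calc op a (iv a) = op (op (iv (iv a)) (iv a)) (op a (iv a)) := by rw [liv, eop]
      _ = op (iv (iv a)) (op (op (iv a) a) (iv a)) := by rw [assoc, assoc]
      _ = e := by rw [liv, eop, liv]
  have move : ∀ a b c w d, S.W a b (op w c) d ↔ S.W (op a w) b c d := by
    intro a b c w d
    have := S.arr a (op a w) w e b (op w c) d c d e
    exact ⟨fun h => this.2.2.1 (hop a w) h (hop w c) (S.d1 d),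
      fun h => this.2.1 (hop a w) h (hop w c) (S.d1 d)⟩
  have mv1 : ∀ a b c d, S.W a b c d ↔ S.W (op a c) b e d := by
    intro a b c d
    rw [← move, ope]
  have b03 : ∀ x, S.W x e e x := fun x => by
    have := (mv1 e e x x).mp (S.d2 x)
    rwa [eop] at this
  have p1 : ∀ x y z, S.W e x y z ↔ y = op z x := by
    intro x y z
    have h := S.arr e x y z e y (op z x) e x e
    constructor
    · intro h0
      have := h.2.1 h0 (b03 x) (S.d0 y) (hop z x)
      exact u2 _ _ _ _ _ this (S.d2 _)
    · intro h0
      refine h.1 ?_ (b03 x) (S.d0 y) (hop z x)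
      rw [← h0]; exact S.d2 y
  have main : ∀ a b c d, S.W a b c d ↔ op a c = op d b := by
    intro a b c d
    rw [mv1, ← p1, mv1 e b (op a c) d, eop]
  have comm : ∀ u v, op u v = op v u := by
    intro u v
    obtain ⟨s, hs⟩ := S.h2 u e v
    have r3 := (S.arr u e s v e (iv u) e e e v).2.2.2.1 hs ((P _ _ _).mpr (riv u).symm) triv (b03 v)
    have h1 := (main _ _ _ _).mp r3
    have h0 := (main _ _ _ _).mp hs
    rw [ope] at h1 h0
    rw [h1] at h0
    calc op u v = op u (op v (op (iv u) u)) := by rw [liv, ope]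
      _ = op (op u (op v (iv u))) u := by rw [assoc, assoc]
      _ = op v u := by rw [h0]
  let G : AddCommGroup A :=
    { add := op, zero := e, neg := iv, add_assoc := assoc, zero_add := eop, add_zero := ope
      neg_add_cancel := liv, add_comm := comm, nsmul := @nsmulRec A ⟨e⟩ ⟨op⟩
      zsmul := @zsmulRec A ⟨e⟩ ⟨op⟩ ⟨iv⟩ (@nsmulRec A ⟨e⟩ ⟨op⟩) }
  refine ⟨G, rfl, fun a b c d => ?_⟩
  change S.W a b c d ↔ op a c = op b d
  rw [main, comm d b]

end WS

/-- row of an array -/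
def row {A : Type} (b : ℕ → ℕ → A) (i : ℕ) : ℕ → A := fun k => if k < i then b k i else b i (k + 1)

/-- N-term filling structure -/
structure RS (N : ℕ) (Z : Type) where
  e : Z
  R : (ℕ → Z) → Prop
  loc : ∀ t t' : ℕ → Z, (∀ k < N, t k = t' k) → R t → R t'
  horn : ∀ k < N, ∀ t : ℕ → Z, ∃ a, R (Function.update t k a)
  arr : ∀ b : ℕ → ℕ → Z, ∀ i ≤ N, (∀ j ≤ N, j ≠ i → R (row b j)) → R (row b i)
  deg : ∀ p, p + 1 < N → ∀ a, R (fun k => if k = p then a else if k = p + 1 then a else e)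

namespace RS
variable {N : ℕ} {Z : Type} (S : RS N Z)

/-- window tuple -/
def win (p : ℕ) (a b c d : Z) : ℕ → Z := fun k =>
  if k = p then a else if k = p + 1 then b else if k = p + 2 then c else if k = p + 3 then d else S.e

/-- window array -/
def warr (p : ℕ) (a01 a02 a03 a04 a12 a13 a14 a23 a24 a34 : Z) : ℕ → ℕ → Z := fun x y =>
  if x = p ∧ y = p + 1 then a01 else if x = p ∧ y = p + 2 then a02 else
  if x = p ∧ y = p + 3 then a03 else if x = p ∧ y = p + 4 then a04 else
  if x = p + 1 ∧ y = p + 2 then a12 else if x = p + 1 ∧ y = p + 3 then a13 else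
  if x = p + 1 ∧ y = p + 4 then a14 else if x = p + 2 ∧ y = p + 3 then a23 else
  if x = p + 2 ∧ y = p + 4 then a24 else if x = p + 3 ∧ y = p + 4 then a34 else S.e

theorem R_e (hN : 4 ≤ N) : S.R (fun _ => S.e) := by
  have := S.deg 0 (by omega) S.e
  simpa using this

theorem row_e (p x : ℕ) (hx : x < p ∨ p + 4 < x) (a01 a02 a03 a04 a12 a13 a14 a23 a24 a34 : Z) :
    row (S.warr p a01 a02 a03 a04 a12 a13 a14 a23 a24 a34) x = fun _ => S.e := by
  funext k
  have key : ∀ x y, (x < p ∨ p + 4 < x ∨ y < p ∨ p + 4 < y) →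
      S.warr p a01 a02 a03 a04 a12 a13 a14 a23 a24 a34 x y = S.e := by
    intro x y h
    simp only [warr]
    rw [if_neg (by omega), if_neg (by omega), if_neg (by omega), if_neg (by omega), if_neg (by omega),
      if_neg (by omega), if_neg (by omega), if_neg (by omega), if_neg (by omega), if_neg (by omega)]
  unfold row
  split_ifs
  · exact key _ _ (by omega)
  · exact key _ _ (by omega)

theorem row_0 (p : ℕ) (a01 a02 a03 a04 a12 a13 a14 a23 a24 a34 : Z) :
    row (S.warr p a01 a02 a03 a04 a12 a13 a14 a23 a24 a34) p = S.win p a01 a02 a03 a04 := by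
  funext k; simp only [row, warr, win]; grind
theorem row_1 (p : ℕ) (a01 a02 a03 a04 a12 a13 a14 a23 a24 a34 : Z) :
    row (S.warr p a01 a02 a03 a04 a12 a13 a14 a23 a24 a34) (p + 1) = S.win p a01 a12 a13 a14 := by
  funext k; simp only [row, warr, win]; grind
theorem row_2 (p : ℕ) (a01 a02 a03 a04 a12 a13 a14 a23 a24 a34 : Z) :
    row (S.warr p a01 a02 a03 a04 a12 a13 a14 a23 a24 a34) (p + 2) = S.win p a02 a12 a23 a24 := by
  funext k; simp only [row, warr, win]; grind
theorem row_3 (p : ℕ) (a01 a02 a03 a04 a12 a13 a14 a23 a24 a34 : Z) :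
    row (S.warr p a01 a02 a03 a04 a12 a13 a14 a23 a24 a34) (p + 3) = S.win p a03 a13 a23 a34 := by
  funext k; simp only [row, warr, win]; grind
theorem row_4 (p : ℕ) (a01 a02 a03 a04 a12 a13 a14 a23 a24 a34 : Z) :
    row (S.warr p a01 a02 a03 a04 a12 a13 a14 a23 a24 a34) (p + 4) = S.win p a04 a14 a24 a34 := by
  funext k; simp only [row, warr, win]; grind

/-- the window structure -/
def ws (p : ℕ) (hp : p + 4 ≤ N) : WS Z where
  e := S.e
  W a b c d := S.R (S.win p a b c d)
  arr a01 a02 a03 a04 a12 a13 a14 a23 a24 a34 := by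
    have key : ∀ i ≤ 4, (∀ j ≤ 4, j ≠ i → S.R (row (S.warr p a01 a02 a03 a04 a12 a13 a14 a23 a24 a34) (p + j))) →
        S.R (row (S.warr p a01 a02 a03 a04 a12 a13 a14 a23 a24 a34) (p + i)) := by
      intro i hi h
      refine S.arr _ _ (by omega) fun j hj hji => ?_
      by_cases hjp : j < p ∨ p + 4 < j
      · rw [S.row_e p j hjp]; exact S.R_e (by omega)
      · obtain ⟨j', rfl⟩ : ∃ j', j = p + j' := ⟨j - p, by omega⟩
        exact h j' (by omega) (by omega)
    rw [← S.row_0 p a01 a02 a03 a04 a12 a13 a14 a23 a24 a34, ← S.row_1 p a01 a02 a03 a04 a12 a13 a14 a23 a24 a34,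
      ← S.row_2 p a01 a02 a03 a04 a12 a13 a14 a23 a24 a34, ← S.row_3 p a01 a02 a03 a04 a12 a13 a14 a23 a24 a34,
      ← S.row_4 p a01 a02 a03 a04 a12 a13 a14 a23 a24 a34]
    refine ⟨fun h1 h2 h3 h4 => key 0 (by omega) ?_, fun h1 h2 h3 h4 => key 1 (by omega) ?_,
      fun h1 h2 h3 h4 => key 2 (by omega) ?_, fun h1 h2 h3 h4 => key 3 (by omega) ?_,
      fun h1 h2 h3 h4 => key 4 (by omega) ?_⟩ <;>
    · intro j hj hne
      interval_cases j <;> first | assumption | (exfalso; exact hne rfl)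
  h0 b c d := by
    obtain ⟨a, ha⟩ := S.horn p (by omega) (S.win p S.e b c d)
    refine ⟨a, ?_⟩
    convert ha using 1
    funext k; simp only [win, Function.update_apply]; grind
  h1 b c d := by
    obtain ⟨a, ha⟩ := S.horn (p + 1) (by omega) (S.win p b S.e c d)
    refine ⟨a, ?_⟩
    convert ha using 1
    funext k; simp only [win, Function.update_apply]; grind
  h2 b c d := by
    obtain ⟨a, ha⟩ := S.horn (p + 2) (by omega) (S.win p b c S.e d)
    refine ⟨a, ?_⟩
    convert ha using 1
    funext k; simp only [win, Function.update_apply]; grind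
  h3 b c d := by
    obtain ⟨a, ha⟩ := S.horn (p + 3) (by omega) (S.win p b c d S.e)
    refine ⟨a, ?_⟩
    convert ha using 1
    funext k; simp only [win, Function.update_apply]; grind
  d0 a := by
    convert S.deg p (by omega) a using 1
    funext k; simp only [win]; grind
  d1 a := by
    convert S.deg (p + 1) (by omega) a using 1
    funext k; simp only [win]; grind
  d2 a := by
    convert S.deg (p + 2) (by omega) a using 1
    funext k; simp only [win]; grind

/-- double-row array -/
def darr (p : ℕ) (t t' : ℕ → Z) (w : Z) : ℕ → ℕ → Z := fun x y =>
  if y = p then t x else if x = p then t (y - 1) else if y = p + 1 then t' x else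
  if x = p + 1 then t' (y - 1) else if x + 1 = p ∧ y = p + 2 then w else S.e

theorem drow_p (p : ℕ) (t t' : ℕ → Z) (w : Z) : row (S.darr p t t' w) p = t := by
  funext k; simp only [row, darr]; grind

theorem drow_p1 (p : ℕ) (t t' : ℕ → Z) (w : Z) (h : t p = t' p) :
    row (S.darr p t t' w) (p + 1) = t' := by
  funext k; simp only [row, darr]; grind

theorem drow_lt (p x : ℕ) (hx : x + 1 < p) (t t' : ℕ → Z) (w : Z) :
    row (S.darr p t t' w) x = S.win (p - 1) (t x) (t' x) S.e S.e := by
  funext k; simp only [row, darr, win]; grind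

theorem drow_eq (p : ℕ) (t t' : ℕ → Z) (w : Z) :
    row (S.darr (p + 1) t t' w) p = S.win p (t p) (t' p) w S.e := by
  funext k; simp only [row, darr, win]; grind

theorem drow_gt (p x : ℕ) (hx : p + 2 < x) (t t' : ℕ → Z) (w : Z) :
    row (S.darr p t t' w) x = S.win p (t (x - 1)) (t' (x - 1)) S.e S.e := by
  funext k; simp only [row, darr, win]; grind

theorem drow_p2 (p : ℕ) (t t' : ℕ → Z) (w : Z) :
    row (S.darr (p + 1) t t' w) (p + 3) = S.win p w (t (p + 2)) (t' (p + 2)) S.e := by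
  funext k; simp only [row, darr, win]; grind

theorem drow_p2' (t t' : ℕ → Z) (w : Z) :
    row (S.darr 0 t t' w) 2 = S.win 0 (t 1) (t' 1) S.e S.e := by
  funext k; simp only [row, darr, win]; grind

theorem deg' (p : ℕ) (hp : p + 1 < N) (a : Z) : S.R (S.win p a a S.e S.e) := by
  convert S.deg p hp a using 1
  funext k; simp only [win]; grind

/-- equivalence at position p -/
def E (p : ℕ) (a b : Z) : Prop := S.R (S.win p a b S.e S.e)

theorem win_sh1 (p : ℕ) (a b c : Z) : S.win p S.e a b c = S.win (p + 1) a b c S.e := by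
  funext k; simp only [win]; grind

theorem E_succ (hN : 4 ≤ N) (p : ℕ) (hp : p + 2 < N) (a b : Z) : S.E p a b ↔ S.E (p + 1) a b := by
  unfold E
  by_cases h : p + 4 ≤ N
  · rw [← S.win_sh1]
    exact (S.ws p h).e01
  · obtain ⟨q, rfl⟩ : ∃ q, p = q + 1 := ⟨p - 1, by omega⟩
    have := (S.ws q (by omega)).e12 (a := a) (c := b)
    change S.R (S.win q S.e a b S.e) ↔ S.R (S.win q S.e S.e a b) at this
    rwa [S.win_sh1, S.win_sh1, S.win_sh1] at this

theorem E_iff (hN : 4 ≤ N) (p : ℕ) (hp : p + 1 < N) (a b : Z) : S.E p a b ↔ S.E 0 a b := by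
  induction p with
  | zero => rfl
  | succ p ih => rw [← S.E_succ hN p (by omega), ih (by omega)]

theorem E_equiv (hN : 4 ≤ N) : Equivalence (S.E 0) :=
  ⟨fun a => S.deg' 0 (by omega) a, fun h => (S.ws 0 hN).symm h, fun h h' => (S.ws 0 hN).trans h h'⟩

theorem change (hN : 4 ≤ N) (k : ℕ) (hk : k < N) (t t' : ℕ → Z) (h : ∀ l, l ≠ k → t l = t' l)
    (hR : S.R t) : S.R t' ↔ S.E 0 (t k) (t' k) := by
  rcases Nat.eq_zero_or_pos k with rfl | hk0
  · -- p = 1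
    have key := S.arr (S.darr 1 t t' S.e)
    have hrow : ∀ j ≤ N, j ≠ 0 → j ≠ 1 → j ≠ 2 → S.R (row (S.darr 1 t t' S.e) j) := by
      intro j hj h0 h1 h2
      by_cases h3 : j = 3
      · subst h3
        rw [S.drow_p2 0, h 2 (by omega)]
        have := S.deg' 1 (by omega) (t' 2)
        rwa [← S.win_sh1] at this
      · rw [S.drow_gt 1 j (by omega), h _ (by omega)]
        exact S.deg' 1 (by omega) _
    have r0 : row (S.darr 1 t t' S.e) 0 = S.win 0 (t 0) (t' 0) S.e S.e := S.drow_eq 0 _ _ _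
    have r1 : row (S.darr 1 t t' S.e) 1 = t := S.drow_p 1 _ _ _
    have r2 : row (S.darr 1 t t' S.e) 2 = t' := S.drow_p1 1 _ _ _ (h 1 (by omega))
    constructor
    · intro hR'
      have := key 0 (by omega) fun j hj hne => by
        by_cases h1 : j = 1
        · subst h1; rwa [r1]
        by_cases h2 : j = 2
        · subst h2; rwa [r2]
        exact hrow j hj hne h1 h2
      rwa [r0] at this
    · intro hE
      have := key 2 (by omega) fun j hj hne => by
        by_cases h1 : j = 1
        · subst h1; rwa [r1]
        by_cases h2 : j = 0
        · subst h2; rwa [r0]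
        exact hrow j hj h2 h1 hne
      rwa [r2] at this
  · have key := S.arr (S.darr 0 t t' S.e)
    have rg : ∀ j, 2 ≤ j → row (S.darr 0 t t' S.e) j = S.win 0 (t (j - 1)) (t' (j - 1)) S.e S.e := by
      intro j hj
      rcases hj.eq_or_lt with rfl | hj
      · exact S.drow_p2' _ _ _
      · exact S.drow_gt 0 j (by omega) _ _ _
    have hrow : ∀ j ≤ N, j ≠ 0 → j ≠ 1 → j ≠ k + 1 → S.R (row (S.darr 0 t t' S.e) j) := by
      intro j hj h0 h1 h2
      rw [rg j (by omega), h _ (by omega)]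
      exact S.deg' 0 (by omega) _
    have r0 : row (S.darr 0 t t' S.e) 0 = t := S.drow_p 0 _ _ _
    have r1 : row (S.darr 0 t t' S.e) 1 = t' := S.drow_p1 0 _ _ _ (h 0 (by omega))
    have r2 := rg (k + 1) (by omega)
    rw [Nat.add_sub_cancel] at r2
    constructor
    · intro hR'
      have := key (k + 1) (by omega) fun j hj hne => by
        by_cases h1 : j = 0
        · subst h1; rwa [r0]
        by_cases h2 : j = 1
        · subst h2; rwa [r1]
        exact hrow j hj h1 h2 hne
      rwa [r2] at this
    · intro hE
      have := key 1 (by omega) fun j hj hne => by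
        by_cases h1 : j = 0
        · subst h1; rwa [r0]
        by_cases h2 : j = k + 1
        · subst h2; rwa [r2]
        exact hrow j hj h1 hne h2
      rwa [r1] at this

end RS

end FLS

namespace FLS
namespace RS
variable {N : ℕ} {Z : Type} (S : RS N Z)

theorem R_congr (hN : 4 ≤ N) (t t' : ℕ → Z) (h : ∀ k < N, S.E 0 (t k) (t' k)) (hR : S.R t) : S.R t' := by
  have key : ∀ n ≤ N, S.R (fun k => if k < n then t' k else t k) := by
    intro n
    induction n with
    | zero => intro _; simpa using hR
    | succ n ih =>
      intro hn
      refine (S.change hN n (by omega) _ _ ?_ (ih (by omega))).mpr ?_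
      · intro l hl
        have : l < n ↔ l < n + 1 := by omega
        simp only [this]
      · simpa using h n (by omega)
  refine S.loc _ _ ?_ (key N le_rfl)
  intro k hk
  simp [hk]

/-- setoid -/
def std (hN : 4 ≤ N) : Setoid Z := ⟨S.E 0, S.E_equiv hN⟩

theorem R_out (hN : 4 ≤ N) (t : ℕ → Z) :
    S.R t ↔ S.R (fun k => (Quotient.mk (S.std hN) (t k)).out) := by
  have h : ∀ z, S.E 0 (Quotient.mk (S.std hN) z).out z := fun z => Quotient.mk_out (s := S.std hN) z
  exact ⟨S.R_congr hN _ _ fun k _ => (S.E_equiv hN).symm (h _), S.R_congr hN _ _ fun k _ => h _⟩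

/-- quotient structure -/
noncomputable def quo (hN : 4 ≤ N) : RS N (Quotient (S.std hN)) where
  e := Quotient.mk _ S.e
  R t := S.R (fun k => (t k).out)
  loc t t' h := S.loc _ _ fun k hk => by rw [h k hk]
  horn k hk t := by
    obtain ⟨a, ha⟩ := S.horn k hk (fun k => (t k).out)
    refine ⟨Quotient.mk _ a, ?_⟩
    rw [S.R_out hN] at ha
    convert ha using 3 with l
    by_cases hl : l = k
    · subst hl; simp
    · simp [hl]
  arr b i hi h := by
    have := S.arr (fun x y => (b x y).out) i hi
    have e : ∀ j, row (fun x y => (b x y).out) j = fun k => (row b j k).out := by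
      intro j; funext k; simp only [row]; split_ifs <;> rfl
    simp only [e] at this
    exact this h
  deg p hp a := by
    have := S.deg p hp a.out
    rw [S.R_out hN] at this
    convert this using 3 with l
    by_cases h1 : l = p
    · simp only [h1, if_true, Quotient.out_eq]
    by_cases h2 : l = p + 1
    · simp only [h2, if_true, if_neg (show ¬ p + 1 = p by omega), Quotient.out_eq]
    simp only [if_neg h1, if_neg h2]

theorem quo_R (hN : 4 ≤ N) (t : ℕ → Z) : S.R t ↔ (S.quo hN).R (fun k => Quotient.mk _ (t k)) := S.R_out hN t

theorem quo_E (hN : 4 ≤ N) (a b : Quotient (S.std hN)) (h : (S.quo hN).E 0 a b) : a = b := by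
  obtain ⟨a, rfl⟩ := Quotient.exists_rep a
  obtain ⟨b, rfl⟩ := Quotient.exists_rep b
  refine Quotient.sound ?_
  change S.R _
  rw [S.quo_R hN]
  unfold E at h
  convert h using 2 with l
  simp only [win]
  split_ifs <;> rfl

theorem uniq (hN : 4 ≤ N) (hE : ∀ a b, S.E 0 a b → a = b) (k : ℕ) (hk : k < N) (t t' : ℕ → Z)
    (h : ∀ l, l ≠ k → t l = t' l) (hR : S.R t) (hR' : S.R t') : t k = t' k :=
  hE _ _ ((S.change hN k hk t t' h hR).mp hR')

theorem group0 (hN : 4 ≤ N) (hE : ∀ a b, S.E 0 a b → a = b) (p : ℕ) (hp : p + 4 ≤ N) :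
    ∃ G : AddCommGroup Z, G.zero = S.e ∧
      ∀ a b c d, S.R (S.win p a b c d) ↔ G.add a c = G.add b d := by
  refine (S.ws p hp).group ?_ ?_ ?_ ?_
  · intro a a' b c d h h'
    have := S.uniq hN hE p (by omega) _ _ (by intro l hl; simp [win, hl]) h h'
    simpa [win] using this
  · intro a b b' c d h h'
    have := S.uniq hN hE (p + 1) (by omega) _ _ (by intro l hl; simp [win, hl]) h h'
    simpa [win] using this
  · intro a b c c' d h h'
    have := S.uniq hN hE (p + 2) (by omega) _ _ (by intro l hl; simp [win, hl]) h h'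
    simpa [win] using this
  · intro a b c d d' h h'
    have := S.uniq hN hE (p + 3) (by omega) _ _ (by intro l hl; simp [win, hl]) h h'
    simpa [win] using this

theorem group1 (hN : 4 ≤ N) (hE : ∀ a b, S.E 0 a b → a = b) :
    ∃ G : AddCommGroup Z, G.zero = S.e ∧ ∀ p, p + 4 ≤ N →
      ∀ a b c d, S.R (S.win p a b c d) ↔ G.add a c = G.add b d := by
  obtain ⟨G, hG0, hG⟩ := S.group0 hN hE 0 hN
  refine ⟨G, hG0, fun p => ?_⟩
  induction p with
  | zero => intro _; exact hG
  | succ p ih =>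
    intro hp
    obtain ⟨G', hG0', hG'⟩ := S.group0 hN hE (p + 1) hp
    have ea : ∀ a c, G'.add a c = G.add a c := by
      intro a c
      have h1 := (hG' a (G'.add a c) c S.e).mpr (by rw [← hG0']; exact (G'.add_zero _).symm)
      rw [← S.win_sh1, ih (by omega), ← hG0] at h1
      have := G.zero_add (G'.add a c)
      exact this.symm.trans h1
    intro a b c d
    rw [hG', ea, ea]

theorem alt (hN : 4 ≤ N) (hE : ∀ a b, S.E 0 a b → a = b) :
    ∃ _ : AddCommGroup Z, ∀ t : ℕ → Z, S.R t ↔ ∑ i ∈ Finset.range N, (-1 : ℤ) ^ i • t i = 0 := by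
  obtain ⟨G, hG0', hG'⟩ := S.group1 hN hE
  have hG0 : S.e = 0 := hG0'.symm
  have hG : ∀ p, p + 4 ≤ N → ∀ a b c d, S.R (S.win p a b c d) ↔ a + c = b + d := hG'
  refine ⟨G, ?_⟩
  have h3 : ∀ q, q + 3 ≤ N → ∀ a c b, S.R (S.win q a c b S.e) ↔ c = a + b := by
    intro q hq a c b
    by_cases h : q + 4 ≤ N
    · rw [hG q h, hG0, add_zero, eq_comm]
    · obtain ⟨p, rfl⟩ : ∃ p, q = p + 1 := ⟨q - 1, by omega⟩
      rw [← S.win_sh1, hG p (by omega), hG0, zero_add]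
  have col : ∀ p, p + 3 ≤ N → ∀ t : ℕ → Z,
      S.R t ↔ S.R (fun i => t i + ((if i = p then - t p else 0) + if i = p + 2 then t p else 0)) := by
    intro p hp t
    set t' : ℕ → Z := fun i => t i + ((if i = p then - t p else 0) + if i = p + 2 then t p else 0) with ht'
    have e0 : t' p = 0 := by simp [ht']
    have e1 : t' (p + 1) = t (p + 1) := by simp [ht']
    have e2 : t' (p + 2) = t (p + 2) + t p := by simp [ht']
    have e3 : ∀ k, k ≠ p → k ≠ p + 2 → t' k = t k := by intro k h1 h2; simp [ht', h1, h2]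
    have r1 := S.drow_p (p + 1) t t' (- t p)
    have r2 := S.drow_p1 (p + 1) t t' (- t p) e1.symm
    have hrow : ∀ j ≤ N, j ≠ p + 1 → j ≠ p + 2 → S.R (row (S.darr (p + 1) t t' (- t p)) j) := by
      intro j hj h1 h2
      rcases lt_trichotomy j p with h | h | h
      · rw [S.drow_lt (p + 1) j (by omega), e3 _ (by omega) (by omega)]
        exact S.deg' _ (by omega) _
      · subst h
        rw [S.drow_eq, h3 _ (by omega), e0]; simp
      · by_cases h4 : j = p + 3
        · subst h4
          rw [S.drow_p2, h3 _ (by omega), e2]; abel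
        · rw [S.drow_gt (p + 1) j (by omega), e3 _ (by omega) (by omega)]
          exact S.deg' _ (by omega) _
    constructor
    · intro hR
      have := S.arr (S.darr (p + 1) t t' (- t p)) (p + 2) (by omega) fun j hj hne => by
        by_cases h1 : j = p + 1
        · subst h1; rwa [r1]
        · exact hrow j hj h1 hne
      rwa [r2] at this
    · intro hR
      have := S.arr (S.darr (p + 1) t t' (- t p)) (p + 1) (by omega) fun j hj hne => by
        by_cases h1 : j = p + 2
        · subst h1; rwa [r2]
        · exact hrow j hj hne h1
      rwa [r1] at this
  have main : ∀ n, n + 2 ≤ N → ∀ t : ℕ → Z, (∀ k, k + n + 2 < N → t k = 0) →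
      (S.R t ↔ ∑ i ∈ Finset.range N, (-1 : ℤ) ^ i • t i = 0) := by
    intro n
    induction n with
    | zero =>
      intro hn t ht
      obtain ⟨M, rfl⟩ : ∃ M, N = M + 2 := ⟨N - 2, by omega⟩
      rw [Finset.sum_range_succ, Finset.sum_range_succ, Finset.sum_eq_zero (by
        intro i hi
        rw [ht i (by have := Finset.mem_range.mp hi; omega), smul_zero])]
      have hw : ∀ k < M + 2, t k = S.win M (t M) (t (M + 1)) S.e S.e k := by
        intro k hk
        simp only [win]
        split_ifs with h1 h2
        · rw [h1]
        · rw [h2]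
        · omega
        · omega
        · rw [hG0]; exact ht k (by omega)
      have : S.R t ↔ S.E M (t M) (t (M + 1)) :=
        ⟨S.loc _ _ hw, S.loc _ _ fun k hk => (hw k hk).symm⟩
      rw [this, S.E_iff hN M (by omega)]
      have h2 : S.E 0 (t M) (t (M + 1)) ↔ t M = t (M + 1) :=
        ⟨hE _ _, fun h => by rw [h]; exact S.deg' 0 (by omega) _⟩
      rw [h2, pow_succ, zero_add, mul_neg_one, neg_smul, ← sub_eq_add_neg, ← smul_sub]
      have h4 := neg_one_pow_eq_or ℤ M
      rcases h4 with h4 | h4 <;> rw [h4] <;> simp [sub_eq_zero]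
      exact eq_comm
    | succ n ih =>
      intro hn t ht
      set p := N - (n + 3) with hp
      rw [col p (by omega), ih (by omega)]
      · simp only [smul_add, Finset.sum_add_distrib, smul_ite, smul_zero, Finset.sum_ite_eq',
          Finset.mem_range]
        rw [if_pos (by omega), if_pos (by omega), pow_add]
        simp
      · intro k hk
        by_cases h : k = p
        · subst h; simp
        · rw [ht k (by omega), if_neg h, if_neg (by omega)]; simp
  intro t
  exact main (N - 2) (by omega) t (by omega)

theorem altsum (hN : 4 ≤ N) : ∃ (A : Type) (_ : AddCommGroup A) (q : Z → A),
    ∀ t : ℕ → Z, S.R t ↔ ∑ i ∈ Finset.range N, (-1 : ℤ) ^ i • q (t i) = 0 := by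
  obtain ⟨G, hG⟩ := (S.quo hN).alt hN (S.quo_E hN)
  exact ⟨_, G, Quotient.mk _, fun t => by rw [S.quo_R hN, hG]⟩

end RS
end FLS

namespace FLS
section
variable {X : Type} [TopologicalSpace X]

theorem glue2 {Y : Type} [TopologicalSpace Y] (A B : Set Y) (hA : IsClosed A) (hB : IsClosed B)
    (hAB : ∀ y, y ∈ A ∨ y ∈ B) (f : C(A, X)) (g : C(B, X))
    (hfg : ∀ y (h : y ∈ A) (h' : y ∈ B), f ⟨y, h⟩ = g ⟨y, h'⟩) :
    ∃ F : C(Y, X), (∀ y (h : y ∈ A), F y = f ⟨y, h⟩) ∧ ∀ y (h : y ∈ B), F y = g ⟨y, h⟩ := by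
  classical
  let F : Y → X := fun y => if h : y ∈ A then f ⟨y, h⟩ else g ⟨y, (hAB y).resolve_left h⟩
  have h1 : ∀ y (h : y ∈ A), F y = f ⟨y, h⟩ := fun y h => dif_pos h
  have h2 : ∀ y (h : y ∈ B), F y = g ⟨y, h⟩ := by
    intro y h
    by_cases h' : y ∈ A
    · rw [h1 y h', hfg y h' h]
    · exact dif_neg h'
  have c1 : ContinuousOn F A := by
    rw [continuousOn_iff_continuous_domRestrict]
    have : A.domRestrict F = f := funext fun y => h1 y.1 y.2
    rw [this]; exact f.continuous
  have c2 : ContinuousOn F B := by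
    rw [continuousOn_iff_continuous_domRestrict]
    have : B.domRestrict F = g := funext fun y => h2 y.1 y.2
    rw [this]; exact g.continuous
  have c3 := c1.union_of_isClosed c2 hA hB
  have e : A ∪ B = Set.univ := Set.eq_univ_iff_forall.mpr hAB
  rw [e, continuousOn_univ] at c3
  exact ⟨⟨F, c3⟩, h1, h2⟩

theorem co_cont {m : ℕ} (i : Fin m) : Continuous fun x : Dl m => x i :=
  (continuous_apply i).comp continuous_subtype_val

/-- minimal coordinate -/
noncomputable def mu {m : ℕ} (x : Dl (m + 1)) : ℝ :=
  Finset.univ.inf' (Finset.univ_nonempty (α := Fin (m + 1))) fun l => x l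

theorem mu_cont {m : ℕ} : Continuous (mu (m := m)) :=
  Continuous.finset_inf'_apply _ fun l _ => co_cont l

theorem mu_le {m : ℕ} (x : Dl (m + 1)) (l) : mu x ≤ x l := Finset.inf'_le _ (Finset.mem_univ l)

theorem mu_nonneg {m : ℕ} (x : Dl (m + 1)) : 0 ≤ mu x := Finset.le_inf' _ _ fun l _ => x.2.1 _

theorem mu_attain {m : ℕ} (x : Dl (m + 1)) : ∃ l, x l = mu x := by
  obtain ⟨l, -, hl⟩ := Finset.exists_mem_eq_inf' (Finset.univ_nonempty (α := Fin (m + 1))) (fun l => x l)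
  exact ⟨l, hl.symm⟩

theorem mu_zero_iff {m : ℕ} (x : Dl (m + 1)) : mu x = 0 ↔ x ∈ Fc (Set.univ : Set (Fin (m + 1))) := by
  constructor
  · intro h
    obtain ⟨l, hl⟩ := mu_attain x
    exact ⟨l, trivial, hl.trans h⟩
  · rintro ⟨l, -, hl⟩
    exact le_antisymm ((mu_le x l).trans hl.le) (mu_nonneg x)

/-- shrink s -/
noncomputable def ks (m : ℕ) (p : Dl (m + 1) × unitInterval) : ℝ := min ((p.2 : ℝ) / (2 * (m + 1))) (mu p.1)

theorem ks_cont (m : ℕ) : Continuous (ks m) := by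
  unfold ks
  exact ((continuous_subtype_val.comp continuous_snd).div_const _).min (mu_cont.comp continuous_fst)

theorem ks_nonneg {m : ℕ} (p : Dl (m + 1) × unitInterval) : 0 ≤ ks m p :=
  le_min (div_nonneg p.2.2.1 (by positivity)) (mu_nonneg _)

theorem ks_le {m : ℕ} (p : Dl (m + 1) × unitInterval) : 2 * ((m + 1) * ks m p) ≤ (p.2 : ℝ) := by
  have h : ks m p ≤ (p.2 : ℝ) / (2 * (m + 1)) := min_le_left _ _
  rw [le_div_iff₀ (by positivity)] at h
  linarith

theorem ks_half {m : ℕ} (p : Dl (m + 1) × unitInterval) : (1 : ℝ) / 2 ≤ 1 - (m + 1) * ks m p := by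
  have h := ks_le p
  have := p.2.2.2
  linarith

/-- shrink -/
noncomputable def ky (m : ℕ) : C(Dl (m + 1) × unitInterval, Dl (m + 1)) :=
  ⟨fun p => ⟨fun i => (p.1 i - ks m p) / (1 - (m + 1) * ks m p), by
    have h1 := ks_half p
    have h3 : (0 : ℝ) < 1 - (m + 1) * ks m p := by linarith
    constructor
    · intro i
      have h2 : ks m p ≤ p.1 i := (min_le_right _ _).trans (mu_le _ _)
      exact div_nonneg (by linarith) h3.le
    · rw [← Finset.sum_div, Finset.sum_sub_distrib]
      have : ∑ i, p.1 i = 1 := p.1.2.2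
      rw [this]
      simp
      exact h3.ne'⟩, by
    refine Continuous.subtype_mk (continuous_pi fun i => ?_) _
    refine Continuous.div (((co_cont i).comp continuous_fst).sub (ks_cont m))
      (continuous_const.sub (continuous_const.mul (ks_cont m))) fun p => ?_
    have h1 := ks_half p
    linarith⟩

/-- remaining time -/
noncomputable def ku (m : ℕ) : C(Dl (m + 1) × unitInterval, unitInterval) :=
  ⟨fun p => ⟨(p.2 : ℝ) - 2 * ((m + 1) * ks m p), by
    have h := ks_le p
    have h2 := p.2.2.2
    have h3 := ks_nonneg p
    have h4 : (0 : ℝ) ≤ (m + 1) * ks m p := by positivity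
    constructor <;> linarith⟩, by
    refine Continuous.subtype_mk ?_ _
    exact (continuous_subtype_val.comp continuous_snd).sub
      (continuous_const.mul (continuous_const.mul (ks_cont m)))⟩

theorem hep {m : ℕ} (F : C(Dl (m + 1), X))
    (H : C(Fc (Set.univ : Set (Fin (m + 1))), C(unitInterval, X))) (h0 : ∀ x, H x 0 = F x) :
    ∃ G : C(Dl (m + 1), C(unitInterval, X)), (∀ x, G x 0 = F x) ∧ ∀ x : Fc (Set.univ : Set (Fin (m + 1))), G x = H x := by
  let A : Set (Dl (m + 1) × unitInterval) := {p | mu p.1 ≤ (p.2 : ℝ) / (2 * (m + 1))}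
  let B : Set (Dl (m + 1) × unitInterval) := {p | (p.2 : ℝ) / (2 * (m + 1)) ≤ mu p.1}
  have c1 : Continuous fun p : Dl (m + 1) × unitInterval => mu p.1 := mu_cont.comp continuous_fst
  have c2 : Continuous fun p : Dl (m + 1) × unitInterval => (p.2 : ℝ) / (2 * (m + 1)) :=
    (continuous_subtype_val.comp continuous_snd).div_const _
  have hA : ∀ p : A, ky m p ∈ Fc (Set.univ : Set (Fin (m + 1))) := by
    intro p
    obtain ⟨l, hl⟩ := mu_attain p.1.1
    refine ⟨l, trivial, ?_⟩
    have : ks m p.1 = mu p.1.1 := min_eq_right p.2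
    change (p.1.1 l - ks m p.1) / _ = 0
    rw [hl, this, sub_self, zero_div]
  have hB : ∀ p ∈ B, ku m p = 0 := by
    intro p hp
    have : ks m p = (p.2 : ℝ) / (2 * (m + 1)) := min_eq_left hp
    apply Subtype.ext
    change (p.2 : ℝ) - 2 * ((m + 1) * ks m p) = 0
    rw [this]
    field_simp
    ring
  let f : C(A, X) := ⟨fun p => H ⟨ky m p, hA p⟩ (ku m p), by fun_prop⟩
  let g : C(B, X) := ⟨fun p => F (ky m p), by fun_prop⟩
  obtain ⟨G, hG1, hG2⟩ := glue2 A B (isClosed_le c1 c2) (isClosed_le c2 c1) (fun p => le_total (mu p.1) _) f g (by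
    intro y h h'
    change H _ (ku m y) = F _
    rw [hB y h', h0])
  have hs0 : ∀ x, ks m (x, 0) = 0 := by
    intro x
    unfold ks
    simp [mu_nonneg]
  refine ⟨G.curry, fun x => ?_, fun x => ContinuousMap.ext fun t => ?_⟩
  · have hb : (x, (0 : unitInterval)) ∈ B := by
      change ((0 : unitInterval) : ℝ) / _ ≤ mu x
      simp [mu_nonneg]
    change G (x, 0) = F x
    rw [hG2 _ hb]
    change F (ky m (x, 0)) = F x
    congr 1
    apply Subtype.ext
    funext i
    change (x i - ks m (x, 0)) / (1 - (m + 1) * ks m (x, 0)) = x i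
    rw [hs0]; simp
  · have h0 := (mu_zero_iff x.1).mpr x.2
    have hs : ks m (x.1, t) = 0 := by
      unfold ks
      rw [h0]
      exact min_eq_right (div_nonneg t.2.1 (by positivity))
    have ha : (x.1, t) ∈ A := by
      change mu x.1 ≤ _
      rw [h0]
      exact (div_nonneg t.2.1 (by positivity))
    change G (x, t) = H x t
    rw [hG1 _ ha]
    change H ⟨ky m (x.1, t), _⟩ (ku m (x.1, t)) = H x t
    have e1 : ky m (x.1, t) = x.1 := by
      apply Subtype.ext
      funext i
      change (x.1 i - ks m (x.1, t)) / (1 - (m + 1) * ks m (x.1, t)) = x.1 i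
      rw [hs]; simp
    have e2 : ku m (x.1, t) = t := by
      apply Subtype.ext
      change (t : ℝ) - 2 * ((m + 1) * ks m (x.1, t)) = t
      rw [hs]; simp
    simp only [e1, e2]

/-- maps from the boundary of the simplex extend -/
def Ext (X : Type) [TopologicalSpace X] (m : ℕ) : Prop :=
  ∀ f : C(Fc (Set.univ : Set (Fin m)), X), ∃ F : C(Dl m, X), ∀ x, F x.1 = f x

/-- fill a compatible family of faces -/
theorem Ext.fill {m : ℕ} (h : Ext X (m + 2)) (t : Fin (m + 2) → C(Dl (m + 1), X))
    (hc : ∀ i j : Fin (m + 1), i ≤ j → (t j.succ).comp (cof i) = (t i.castSucc).comp (cof j)) :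
    ∃ F : C(Dl (m + 2), X), ∀ i, F.comp (cof i) = t i := by
  obtain ⟨f, hf⟩ := glue Set.univ t (compat_pt Set.univ t fun i j hij _ _ => hc i j hij)
  obtain ⟨F, hF⟩ := h f
  refine ⟨F, fun i => ContinuousMap.ext fun y => ?_⟩
  rw [← hf i trivial y]
  exact hF ⟨cof i y, i, trivial, cof_self i y⟩

instance : IsEmpty (Dl 0) := ⟨fun x => by have := x.2.2; simp at this⟩

instance : IsEmpty (Fc (Set.univ : Set (Fin (0 + 1)))) := ⟨fun x => by
  obtain ⟨i, -, hi⟩ := x.2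
  have h := x.1.2.2
  have h0 : i = 0 := Subsingleton.elim (α := Fin 1) i 0
  subst h0
  simp at h
  change x.1 0 = 1 at h
  rw [hi] at h
  exact zero_ne_one h⟩

theorem cones (n : ℕ) (hE : ∀ k, k ≤ n → Ext X (k + 1)) :
    ∃ c : ∀ m, C(Dl m, X) → C(Dl (m + 1), X), (∀ m ≤ n, ∀ σ, (c m σ).comp (cof (Fin.last m)) = σ) ∧
      ∀ m, m + 1 ≤ n → ∀ σ (i : Fin (m + 1)), (c (m + 1) σ).comp (cof i.castSucc) = c m (σ.comp (cof i)) := by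
  induction n with
  | zero =>
    obtain ⟨F, -⟩ := hE 0 le_rfl ⟨fun x => isEmptyElim x, continuous_of_discreteTopology⟩
    refine ⟨fun m _ => ContinuousMap.const _ (F (stdSimplex.vertex 0)), ?_, ?_⟩
    · intro m hm σ
      obtain rfl : m = 0 := by omega
      exact ContinuousMap.ext fun x => isEmptyElim x
    · intro m hm; omega
  | succ n ih =>
    obtain ⟨c, h1, h2⟩ := ih fun k hk => hE k (by omega)
    have key : ∀ σ : C(Dl (n + 1), X), ∃ F : C(Dl (n + 2), X), F.comp (cof (Fin.last (n + 1))) = σ ∧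
        ∀ i : Fin (n + 1), F.comp (cof i.castSucc) = c n (σ.comp (cof i)) := by
      intro σ
      have := (hE (n + 1) le_rfl).fill (Fin.lastCases (motive := fun _ => C(Dl (n + 1), X)) σ fun i => c n (σ.comp (cof i))) (by
        intro i j hij
        rw [Fin.lastCases_castSucc]
        induction j using Fin.lastCases with
        | last => rw [Fin.succ_last, Fin.lastCases_last, h1 n le_rfl]
        | cast j =>
          rw [Fin.succ_castSucc, Fin.lastCases_castSucc]
          cases n with
          | zero => exact j.elim0
          | succ n =>
            induction i using Fin.lastCases with
            | last => exfalso; have := j.2; simp [Fin.le_def] at hij; omega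
            | cast i =>
              rw [h2 n le_rfl, h2 n le_rfl]
              congr 1
              rw [ContinuousMap.comp_assoc, ContinuousMap.comp_assoc, cof_cof i j (by simpa using hij)])
      obtain ⟨F, hF⟩ := this
      refine ⟨F, ?_, fun i => ?_⟩
      · rw [hF, Fin.lastCases_last]
      · rw [hF, Fin.lastCases_castSucc]
    choose C hC1 hC2 using key
    refine ⟨Function.update c (n + 1) C, ?_, ?_⟩
    · intro m hm σ
      by_cases h : m = n + 1
      · subst h
        rw [Function.update_self]; exact hC1 σ
      · rw [Function.update_of_ne h]; exact h1 m (by omega) σ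
    · intro m hm σ i
      by_cases h : m = n
      · subst h
        rw [Function.update_self, Function.update_of_ne (by omega)]; exact hC2 σ i
      · rw [Function.update_of_ne (by omega), Function.update_of_ne (by omega)]; exact h2 m (by omega) σ i

end
end FLS

namespace FLS
section
variable {X : Type} [TopologicalSpace X]

/-- join with the last vertex -/
noncomputable def jn (m : ℕ) : C(Dl m × unitInterval, Dl (m + 1)) :=
  ⟨fun p => ⟨Fin.lastCases (p.2 : ℝ) (fun i => (1 - (p.2 : ℝ)) * p.1 i), by
    constructor
    · intro i
      induction i using Fin.lastCases with
      | last => simp only [Fin.lastCases_last]; exact p.2.2.1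
      | cast i =>
        simp only [Fin.lastCases_castSucc]
        exact mul_nonneg (by linarith [p.2.2.2]) (p.1.2.1 i)
    · rw [Fin.sum_univ_castSucc]
      simp only [Fin.lastCases_last, Fin.lastCases_castSucc, ← Finset.mul_sum]
      have : ∑ i, p.1 i = 1 := p.1.2.2
      rw [this]; ring⟩, by
    refine Continuous.subtype_mk (continuous_pi fun i => ?_) _
    induction i using Fin.lastCases with
    | last => simp only [Fin.lastCases_last]; fun_prop
    | cast i =>
      simp only [Fin.lastCases_castSucc]
      exact (continuous_const.sub (continuous_subtype_val.comp continuous_snd)).mul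
        ((co_cont i).comp continuous_fst)⟩

theorem jn_last {m : ℕ} (x : Dl m) (t : unitInterval) : jn m (x, t) (Fin.last m) = t :=
  Fin.lastCases_last (motive := fun _ => ℝ) (last := (t : ℝ)) (cast := fun i => (1 - (t : ℝ)) * x i)

theorem jn_cast {m : ℕ} (x : Dl m) (t : unitInterval) (i : Fin m) :
    jn m (x, t) i.castSucc = (1 - (t : ℝ)) * x i :=
  Fin.lastCases_castSucc (motive := fun _ => ℝ) (last := (t : ℝ)) (cast := fun i => (1 - (t : ℝ)) * x i) i

theorem Dl_ext {m : ℕ} {x y : Dl m} (h : ∀ i, x i = y i) : x = y := Subtype.ext (funext h)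

theorem cof_last_last {m : ℕ} (x : Dl m) : cof (Fin.last m) x (Fin.last m) = 0 := cof_self _ _
theorem cof_last_cast {m : ℕ} (x : Dl m) (i : Fin m) : cof (Fin.last m) x i.castSucc = x i := by
  have := cof_succAbove (Fin.last m) x i
  rwa [Fin.succAbove_last] at this

theorem jn_zero {m : ℕ} (x : Dl m) : jn m (x, 0) = cof (Fin.last m) x := by
  refine Dl_ext fun i => ?_
  induction i using Fin.lastCases with
  | last => rw [jn_last, cof_last_last]; rfl
  | cast i => rw [jn_cast, cof_last_cast]; simp

/-- last vertex -/
noncomputable def lv (m : ℕ) : Dl (m + 1) := stdSimplex.vertex (Fin.last m)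

theorem lv_cast (m : ℕ) (i : Fin m) : lv m i.castSucc = 0 := by
  change (stdSimplex.vertex (S := ℝ) (Fin.last m)).1 i.castSucc = 0
  simp [stdSimplex.vertex_coe, Fin.castSucc_ne_last]

theorem lv_last (m : ℕ) : lv m (Fin.last m) = 1 := by
  change (stdSimplex.vertex (S := ℝ) (Fin.last m)).1 _ = 1
  simp [stdSimplex.vertex_coe]

theorem jn_one {m : ℕ} (x : Dl m) : jn m (x, 1) = lv m := by
  refine Dl_ext fun i => ?_
  induction i using Fin.lastCases with
  | last => rw [jn_last, lv_last]; rfl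
  | cast i => rw [jn_cast, lv_cast]; simp

theorem cof_castSucc_last {m : ℕ} (i : Fin (m + 1)) (x : Dl (m + 1)) :
    cof i.castSucc x (Fin.last (m + 1)) = x (Fin.last m) := by
  have := cof_succAbove i.castSucc x (Fin.last m)
  rwa [Fin.succAbove_castSucc_of_le _ _ (Fin.le_last i), Fin.succ_last] at this

theorem jn_cof {m : ℕ} (i : Fin (m + 1)) (y : Dl m) (t : unitInterval) :
    jn (m + 1) (cof i y, t) = cof i.castSucc (jn m (y, t)) := by
  refine Dl_ext fun k => ?_
  induction k using Fin.lastCases with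
  | last => rw [jn_last, cof_castSucc_last, jn_last]
  | cast k =>
    rw [jn_cast]
    rcases Fin.eq_self_or_eq_succAbove i k with rfl | ⟨l, rfl⟩
    · have e1 : cof k y k = 0 := cof_self k y
      have e2 : cof k.castSucc (jn m (y, t)) k.castSucc = 0 := cof_self _ _
      rw [e1, e2, mul_zero]
    · have e1 := cof_succAbove i y l
      have e2 := cof_succAbove i.castSucc (jn m (y, t)) l.castSucc
      rw [Fin.castSucc_succAbove_castSucc] at e2
      exact (congrArg _ e1).trans ((jn_cast y t l).symm.trans e2.symm)

theorem cof_lv {m : ℕ} (i : Fin (m + 1)) : cof i.castSucc (lv m) = lv (m + 1) := by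
  have : Nonempty (Dl (m + 1)) := ⟨lv m⟩
  refine Dl_ext fun k => ?_
  induction k using Fin.lastCases with
  | last => rw [cof_castSucc_last, lv_last, lv_last]
  | cast k =>
    rw [lv_cast]
    rcases Fin.eq_self_or_eq_succAbove i k with rfl | ⟨l, rfl⟩
    · exact cof_self _ _
    · have e2 := cof_succAbove i.castSucc (lv m) l.castSucc
      rw [Fin.castSucc_succAbove_castSucc] at e2
      exact e2.trans (lv_cast m l)

theorem deform0 (n : ℕ) (hE : ∀ k, k ≤ n → Ext X (k + 1)) :
    ∃ (x0 : X) (h : ∀ m, C(Dl m, X) → C(Dl m, C(unitInterval, X))), (∀ m ≤ n, ∀ σ x, h m σ x 0 = σ x) ∧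
      (∀ m ≤ n, ∀ σ x, h m σ x 1 = x0) ∧
      ∀ m, m + 1 ≤ n → ∀ σ (i : Fin (m + 1)), (h (m + 1) σ).comp (cof i) = h m (σ.comp (cof i)) := by
  obtain ⟨c, h1, h2⟩ := cones n hE
  let s0 : C(Dl 0, X) := ⟨fun x => isEmptyElim x, continuous_of_discreteTopology⟩
  refine ⟨c 0 s0 (lv 0), fun m σ => ((c m σ).comp (jn m)).curry, ?_, ?_, ?_⟩
  · intro m hm σ x
    change c m σ (jn m (x, 0)) = σ x
    rw [jn_zero]
    exact DFunLike.congr_fun (h1 m hm σ) x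
  · intro m hm σ x
    change c m σ (jn m (x, 1)) = _
    rw [jn_one]
    clear x
    induction m with
    | zero =>
      congr 2
      exact ContinuousMap.ext fun x => isEmptyElim x
    | succ m ih =>
      rw [← ih (by omega) (σ.comp (cof 0)), ← h2 m hm σ 0, ← cof_lv 0]
      rfl
  · intro m hm σ i
    refine ContinuousMap.ext fun y => ContinuousMap.ext fun t => ?_
    change c (m + 1) σ (jn (m + 1) (cof i y, t)) = c m (σ.comp (cof i)) (jn m (y, t))
    rw [jn_cof, ← h2 m hm]
    rfl

theorem deform (n : ℕ) (hn : 1 ≤ n) (hE : ∀ k, k ≤ n → Ext X (k + 1)) :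
    ∃ (x0 : X) (h : C(Dl (n + 1), X) → C(Dl (n + 1), C(unitInterval, X))), (∀ σ x, h σ x 0 = σ x) ∧
      (∀ σ, ∀ x ∈ Fc (Set.univ : Set (Fin (n + 1))), h σ x 1 = x0) ∧
      ∀ σ σ' i j, σ.comp (cof i) = σ'.comp (cof j) → (h σ).comp (cof i) = (h σ').comp (cof j) := by
  obtain ⟨x0, h, h1, h2, h3⟩ := deform0 n hE
  obtain ⟨n, rfl⟩ : ∃ k, n = k + 1 := ⟨n - 1, by omega⟩
  have key : ∀ σ : C(Dl (n + 2), X), ∃ G : C(Dl (n + 2), C(unitInterval, X)), (∀ x, G x 0 = σ x) ∧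
      ∀ i, G.comp (cof i) = h (n + 1) (σ.comp (cof i)) := by
    intro σ
    obtain ⟨f, hf⟩ := glue Set.univ (fun i => h (n + 1) (σ.comp (cof i)))
      (compat_pt Set.univ _ fun i j hij _ _ => by
        rw [h3 n le_rfl, h3 n le_rfl, ContinuousMap.comp_assoc, ContinuousMap.comp_assoc, cof_cof i j hij])
    obtain ⟨G, hG1, hG2⟩ := hep σ f (by
      rintro ⟨x, i, hi, hx⟩
      have e : cof i (drop i ⟨x, hx⟩) = x := cof_drop i _
      have := hf i trivial (drop i ⟨x, hx⟩)
      simp only [e] at this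
      rw [this, h1 _ le_rfl]
      change σ (cof i _) = σ x
      rw [e])
    refine ⟨G, hG1, fun i => ContinuousMap.ext fun y => ?_⟩
    have := hG2 ⟨cof i y, i, trivial, cof_self i y⟩
    exact this.trans (hf i trivial y)
  choose hh k1 k2 using key
  refine ⟨x0, hh, k1, ?_, ?_⟩
  · rintro σ x ⟨i, -, hx⟩
    have e : cof i (drop i ⟨x, hx⟩) = x := cof_drop i _
    rw [← e]
    have := DFunLike.congr_fun (k2 σ i) (drop i ⟨x, hx⟩)
    change hh σ (cof i _) = _ at this
    rw [this, h2 _ le_rfl]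
  · intro σ σ' i j hij
    rw [k2, k2, hij]

end
end FLS

namespace FLS
section
variable {X : Type} [TopologicalSpace X]

/-- degeneracy -/
noncomputable def dgn {m : ℕ} (p : Fin m) : C(Dl (m + 1), Dl m) :=
  ⟨stdSimplex.map p.predAbove, stdSimplex.continuous_map _⟩

theorem dgn_cof_left {m : ℕ} (p : Fin m) (x : Dl m) : dgn p (cof p.castSucc x) = x := by
  change stdSimplex.map _ (stdSimplex.map _ x) = x
  rw [stdSimplex.map_comp_apply]
  have : p.predAbove ∘ p.castSucc.succAbove = id := by
    funext k; simp
  rw [this, stdSimplex.map_id_apply]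

theorem dgn_cof_right {m : ℕ} (p : Fin m) (x : Dl m) : dgn p (cof p.succ x) = x := by
  change stdSimplex.map _ (stdSimplex.map _ x) = x
  rw [stdSimplex.map_comp_apply]
  have : p.predAbove ∘ p.succ.succAbove = id := by
    funext k
    change p.predAbove (p.succ.succAbove k) = k
    rcases le_or_gt k p with h | h
    · rw [Fin.succAbove_of_castSucc_lt _ _ (Fin.castSucc_lt_succ_iff.mpr h), Fin.predAbove_castSucc_of_le _ _ h]
    · rw [Fin.succAbove_of_le_castSucc _ _ (by
        rw [Fin.le_def]; simp only [Fin.val_succ, Fin.val_castSucc]; exact h), Fin.predAbove_succ_of_le _ _ h.le]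
  rw [this, stdSimplex.map_id_apply]

theorem dgn_apply {m : ℕ} (p : Fin m) (x : Dl (m + 1)) (k : Fin m) :
    dgn p x k = ∑ i with p.predAbove i = k, x i := by
  change (stdSimplex.map p.predAbove x) k = _
  rw [stdSimplex.map_coe, FunOnFinite.linearMap_apply_apply]

theorem dgn_Fc {m : ℕ} (p : Fin m) (x : Dl (m + 1)) (i : Fin (m + 1)) (h1 : i ≠ p.castSucc) (h2 : i ≠ p.succ)
    (hx : x i = 0) : dgn p x (p.predAbove i) = 0 := by
  rw [dgn_apply]
  refine Finset.sum_eq_zero fun j hj => ?_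
  have : j = i := by
    have h3 := (Finset.mem_filter.mp hj).2
    have a1 : p.castSucc.succAbove (p.predAbove i) = i := Fin.succAbove_predAbove h1
    by_cases hj1 : j = p.castSucc
    · subst hj1
      exfalso
      rw [Fin.predAbove_castSucc_self] at h3
      rw [← h3] at a1
      apply h2
      rw [← a1, Fin.succAbove_castSucc_self]
    · have a2 : p.castSucc.succAbove (p.predAbove j) = j := Fin.succAbove_predAbove hj1
      rw [← a1, ← a2, h3]
  rw [this, hx]

theorem cof_swap {m : ℕ} (k : Fin (m + 2)) (i : Fin (m + 1)) :
    ((i : ℕ) < k ∧ ∃ (h1 : (i : ℕ) < m + 2) (h2 : (k : ℕ) - 1 < m + 1),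
      (cof k).comp (cof i) = (cof ⟨i, h1⟩).comp (cof ⟨k - 1, h2⟩)) ∨
    ((k : ℕ) ≤ i ∧ ∃ (h1 : (i : ℕ) + 1 < m + 2) (h2 : (k : ℕ) < m + 1),
      (cof k).comp (cof i) = (cof ⟨i + 1, h1⟩).comp (cof ⟨k, h2⟩)) := by
  rcases lt_or_ge (i : ℕ) k with h | h
  · refine Or.inl ⟨h, by omega, by omega, ?_⟩
    have := cof_cof i ⟨k - 1, by omega⟩ (by rw [Fin.le_def]; simp; omega)
    convert this using 3
    · apply Fin.ext; simp; omega
    · rfl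
  · refine Or.inr ⟨h, by omega, by omega, ?_⟩
    have := cof_cof ⟨k, by omega⟩ i (by rw [Fin.le_def]; simpa using h)
    exact this.symm

/-- based simplices -/
abbrev Bs (n : ℕ) (x0 : X) : Type := {z : C(Dl (n + 1), X) // ∀ x ∈ Fc (Set.univ : Set (Fin (n + 1))), z x = x0}

/-- the filling relation -/
noncomputable def rs (n : ℕ) (x0 : X) : RS (n + 2) (Bs n x0) where
  e := ⟨ContinuousMap.const _ x0, fun _ _ => ContinuousMap.const_apply _ _⟩
  R t := ∃ F : C(Dl (n + 2), X), ∀ i : Fin (n + 2), F.comp (cof i) = (t i).1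
  loc t t' h := by
    rintro ⟨F, hF⟩
    exact ⟨F, fun i => by rw [hF, h i i.2]⟩
  horn k hk t := by
    have hz : ∀ (z : Bs n x0) i y, z.1 (cof i y) = x0 := fun z i y => z.2 _ ⟨i, trivial, cof_self i y⟩
    have hc : ∀ i j : Fin (n + 1), (t j.succ).1.comp (cof i) = (t i.castSucc).1.comp (cof j) := by
      intro i j
      refine ContinuousMap.ext fun y => ?_
      exact (hz _ i y).trans (hz _ j y).symm
    obtain ⟨F, hF⟩ := horn_fill (⟨k, hk⟩ : Fin (n + 2)) (fun i => (t i).1) fun i j _ _ _ => hc i j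
    refine ⟨⟨F.comp (cof ⟨k, hk⟩), ?_⟩, F, fun i => ?_⟩
    · rintro x ⟨i, -, hx⟩
      have e : cof i (drop i ⟨x, hx⟩) = x := cof_drop i _
      rw [← e]
      generalize drop i ⟨x, hx⟩ = y
      rcases cof_swap (⟨k, hk⟩ : Fin (n + 2)) i with ⟨h, h1, h2, h3⟩ | ⟨h, h1, h2, h3⟩
      · have h4 := DFunLike.congr_fun h3 y
        change cof _ (cof i y) = cof _ (cof _ y) at h4
        change F (cof _ (cof i y)) = x0
        rw [h4]
        refine (DFunLike.congr_fun (hF ⟨i, h1⟩ ?_) _).trans (hz _ _ _)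
        intro h5; have := congrArg Fin.val h5; simp at this h; omega
      · have h4 := DFunLike.congr_fun h3 y
        change cof _ (cof i y) = cof _ (cof _ y) at h4
        change F (cof _ (cof i y)) = x0
        rw [h4]
        refine (DFunLike.congr_fun (hF ⟨i + 1, h1⟩ ?_) _).trans (hz _ _ _)
        intro h5; have := congrArg Fin.val h5; simp at this h; omega
    · by_cases h : (i : ℕ) = k
      · subst h
        rw [Function.update_self]
      · rw [Function.update_of_ne h, hF i (by intro h'; exact h (congrArg Fin.val h'))]
  arr b i hi h := by
    have hch : ∀ j : Fin (n + 3), ∃ F : C(Dl (n + 2), X), (j : ℕ) ≠ i → ∀ l : Fin (n + 2), F.comp (cof l) = (row b j l).1 := by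
      intro j
      by_cases hj : (j : ℕ) = i
      · exact ⟨ContinuousMap.const _ x0, fun h => absurd hj h⟩
      · obtain ⟨F, hF⟩ := h j (by omega) hj
        exact ⟨F, fun _ => hF⟩
    choose F hF using hch
    obtain ⟨G, hG⟩ := horn_fill (⟨i, by omega⟩ : Fin (n + 3)) F (by
      intro k l hkl h1 h2
      rw [hF l.succ (by intro h'; exact h2 (Fin.ext h')), hF k.castSucc (by intro h'; exact h1 (Fin.ext h'))]
      have : (k : ℕ) ≤ l := hkl
      simp only [row, Fin.val_succ, Fin.val_castSucc]
      rw [if_pos (by omega), if_neg (by omega)])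
    refine ⟨G.comp (cof ⟨i, by omega⟩), fun l => ?_⟩
    rcases cof_swap (⟨i, by omega⟩ : Fin (n + 3)) l with ⟨h, h1, h2, h3⟩ | ⟨h, h1, h2, h3⟩
    · simp only at h
      have hne : (⟨l, h1⟩ : Fin (n + 3)) ≠ ⟨i, by omega⟩ := by
        intro h5; have := congrArg Fin.val h5; simp at this; omega
      rw [ContinuousMap.comp_assoc, h3, ← ContinuousMap.comp_assoc, hG _ hne, hF _ (by simp; omega)]
      simp only [row]
      rw [if_neg (by omega), if_pos h, Nat.sub_add_cancel (by omega)]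
    · simp only at h
      have hne : (⟨l + 1, h1⟩ : Fin (n + 3)) ≠ ⟨i, by omega⟩ := by
        intro h5; have := congrArg Fin.val h5; simp at this; omega
      rw [ContinuousMap.comp_assoc, h3, ← ContinuousMap.comp_assoc, hG _ hne, hF _ (by simp; omega)]
      simp only [row]
      rw [if_pos (by omega), if_neg (by omega)]
  deg p hp a := by
    let p' : Fin (n + 1) := ⟨p, by omega⟩
    refine ⟨a.1.comp (dgn p'), fun i => ContinuousMap.ext fun y => ?_⟩
    change a.1 (dgn p' (cof i y)) = (if (i : ℕ) = p then a else if (i : ℕ) = p + 1 then a else ⟨ContinuousMap.const _ x0, fun _ _ => ContinuousMap.const_apply _ _⟩ : Bs n x0).1 y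
    by_cases h1 : (i : ℕ) = p
    · have : i = p'.castSucc := Fin.ext h1
      rw [if_pos h1, this, dgn_cof_left]
    by_cases h2 : (i : ℕ) = p + 1
    · have : i = p'.succ := Fin.ext h2
      rw [if_neg h1, if_pos h2, this, dgn_cof_right]
    rw [if_neg h1, if_neg h2]
    refine a.2 _ ⟨p'.predAbove i, trivial, dgn_Fc p' _ i ?_ ?_ (cof_self i y)⟩
    · intro h; exact h1 (congrArg Fin.val h)
    · intro h; exact h2 (congrArg Fin.val h)

/-- fundamental cycle of the boundary of a simplex -/
theorem bdry_cycle (n : ℕ) (f : C(Fc (Set.univ : Set (Fin (n + 2))), X)) (t : Fin (n + 2) → C(Dl (n + 1), X))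
    (ht : ∀ i y, t i y = f ⟨cof i y, i, trivial, cof_self i y⟩) :
    (Sing X).bd (∑ i : Fin (n + 2), (-1 : ℤ) ^ (i : ℕ) • (Sing X).g (m := n + 1) (t i)) = 0 := by
  let Y := Fc (Set.univ : Set (Fin (n + 2)))
  let k : Fin (n + 2) → C(Dl (n + 1), Y) := fun i =>
    ⟨fun y => ⟨cof i y, i, trivial, cof_self i y⟩, Continuous.subtype_mk (cof i).continuous _⟩
  let z : (Sing Y).C (n + 1) := ∑ i : Fin (n + 2), (-1 : ℤ) ^ (i : ℕ) • (Sing Y).g (m := n + 1) (k i)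
  let inc : C(Y, Dl (n + 2)) := ⟨Subtype.val, continuous_subtype_val⟩
  have h1 : (sMap inc).push z = (Sing (Dl (n + 2))).bd ((Sing (Dl (n + 2))).g (m := n + 2) (ContinuousMap.id _)) := by
    rw [PSS.bd_g, map_sum]
    refine Finset.sum_congr rfl fun i _ => ?_
    rw [map_smul]
    have e := (sMap inc).push_g (m := n + 1) (k i)
    rw [e]
    rfl
  have h2 : (Sing Y).bd z = 0 := by
    apply push_injective inc Subtype.val_injective
    rw [← PSS.Hom.bd_push, h1, PSS.bd_bd, map_zero]
  have h3 : (sMap f).push z = ∑ i : Fin (n + 2), (-1 : ℤ) ^ (i : ℕ) • (Sing X).g (m := n + 1) (t i) := by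
    rw [map_sum]
    refine Finset.sum_congr rfl fun i _ => ?_
    rw [map_smul]
    have e := (sMap f).push_g (m := n + 1) (k i)
    rw [e]
    have e2 : (sMap f).f (m := n + 1) (k i) = t i := ContinuousMap.ext fun y => (ht i y).symm
    rw [e2]
  rw [← h3, PSS.Hom.bd_push, h2, map_zero]

theorem hurewicz (n : ℕ) (hn : 2 ≤ n) (hE : ∀ k, k ≤ n → Ext X (k + 1))
    (hH : ∀ z : (Sing X).C (n + 1), (Sing X).bd z = 0 → ∃ w, (Sing X).bd w = z) : Ext X (n + 2) := by
  obtain ⟨x0, h, h1, h2, h3⟩ := deform n (by omega) hE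
  obtain ⟨A, _, q, hq⟩ := (rs n x0).altsum (by omega)
  let ev1 : C(C(unitInterval, X), X) := ⟨fun γ => γ 1, by fun_prop⟩
  let ρ : C(Dl (n + 1), X) → Bs n x0 := fun σ => ⟨ev1.comp (h σ), fun x hx => h2 σ x hx⟩
  -- fillable iff rho fillable
  have key : ∀ f : C(Fc (Set.univ : Set (Fin (n + 2))), X), ∀ t : Fin (n + 2) → C(Dl (n + 1), X),
      (∀ i y, t i y = f ⟨cof i y, i, trivial, cof_self i y⟩) →
      ((∃ F : C(Dl (n + 2), X), ∀ x, F x.1 = f x) ↔ ∑ i : Fin (n + 2), (-1 : ℤ) ^ (i : ℕ) • q (ρ (t i)) = 0) := by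
    intro f t ht
    have e : ∑ i : Fin (n + 2), (-1 : ℤ) ^ (i : ℕ) • q (ρ (t i)) =
        ∑ i ∈ Finset.range (n + 2), (-1 : ℤ) ^ i • q ((fun k : ℕ => ρ (t (Fin.ofNat (n + 2) k))) i) := by
      rw [Finset.sum_range]
      refine Finset.sum_congr rfl fun i _ => ?_
      simp
    rw [e, ← hq]
    have hc : ∀ i j : Fin (n + 1), i ≤ j → (t j.succ).comp (cof i) = (t i.castSucc).comp (cof j) := by
      intro i j hij
      refine ContinuousMap.ext fun y => ?_
      change t j.succ (cof i y) = t i.castSucc (cof j y)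
      rw [ht, ht]
      congr 2
      exact DFunLike.congr_fun (cof_cof i j hij) y
    obtain ⟨H, hHH⟩ := glue Set.univ (fun i => h (t i)) (compat_pt Set.univ _ fun i j hij _ _ => h3 _ _ _ _ (hc i j hij))
    have hpt : ∀ x : Fc (Set.univ : Set (Fin (n + 2))), ∃ i y, x = ⟨cof i y, i, trivial, cof_self i y⟩ := by
      rintro ⟨x, i, hi, hx⟩
      exact ⟨i, drop i ⟨x, hx⟩, Subtype.ext (cof_drop i ⟨x, hx⟩).symm⟩
    have hH0 : ∀ x, H x 0 = f x := by
      intro x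
      obtain ⟨i, y, rfl⟩ := hpt x
      rw [hHH i trivial, h1, ht]
    constructor
    · rintro ⟨F, hF⟩
      obtain ⟨G, hG1, hG2⟩ := hep F H fun x => by rw [hH0, hF]
      refine ⟨ev1.comp G, fun i => ContinuousMap.ext fun y => ?_⟩
      change G (cof i y) 1 = h (t (Fin.ofNat (n + 2) i)) y 1
      have := hG2 ⟨cof i y, i, trivial, cof_self i y⟩
      rw [this, hHH i trivial]
      simp
    · rintro ⟨F, hF⟩
      let sy : C(C(unitInterval, X), C(unitInterval, X)) := ⟨fun γ => γ.comp ⟨unitInterval.symm, unitInterval.continuous_symm⟩, by fun_prop⟩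
      obtain ⟨G, hG1, hG2⟩ := hep F (sy.comp H) fun x => by
        obtain ⟨i, y, rfl⟩ := hpt x
        change H _ (unitInterval.symm 0) = F (cof i y)
        rw [unitInterval.symm_zero, hHH i trivial]
        have := DFunLike.congr_fun (hF i) y
        change F (cof i y) = h (t (Fin.ofNat (n + 2) i)) y 1 at this
        rw [this]
        simp
      refine ⟨ev1.comp G, fun x => ?_⟩
      change G x.1 1 = f x
      rw [hG2]
      change H x (unitInterval.symm 1) = f x
      rw [unitInterval.symm_one, hH0]
  let Q : (Sing X).C (n + 1) →ₗ[ℤ] A := lext fun σ : C(Dl (n + 1), X) => q (ρ σ)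
  have hQ : ∀ t : Fin (n + 2) → C(Dl (n + 1), X),
      Q (∑ i : Fin (n + 2), (-1 : ℤ) ^ (i : ℕ) • (Sing X).g (m := n + 1) (t i)) =
      ∑ i : Fin (n + 2), (-1 : ℤ) ^ (i : ℕ) • q (ρ (t i)) := by
    intro t
    rw [map_sum]
    refine Finset.sum_congr rfl fun i _ => ?_
    rw [map_smul]
    congr 1
    exact lext_single _ _
  have hQ0 : ∀ w : (Sing X).C (n + 2), Q ((Sing X).bd w) = 0 := by
    intro w
    have : Q ∘ₗ (Sing X).bd = 0 := by
      apply lin_ext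
      intro σ
      rw [LinearMap.comp_apply]
      have e := (Sing X).bd_g (m := n + 1) σ
      rw [e, hQ]
      exact (key (σ.comp ⟨Subtype.val, continuous_subtype_val⟩) _ fun i y => rfl).mp ⟨σ, fun x => rfl⟩
    exact LinearMap.congr_fun this w
  intro f
  let t : Fin (n + 2) → C(Dl (n + 1), X) := fun i =>
    f.comp ⟨fun y => ⟨cof i y, i, trivial, cof_self i y⟩, Continuous.subtype_mk (cof i).continuous _⟩
  obtain ⟨w, hw⟩ := hH _ (bdry_cycle n f t fun i y => rfl)
  rw [key f t fun i y => rfl, ← hQ, ← hw, hQ0]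

end
end FLS

namespace FLS
section
variable {X : Type} [TopologicalSpace X]

/-- split the first coordinate -/
noncomputable def sp (m : ℕ) : C(Dl (m + 1) × unitInterval, Dl (m + 2)) :=
  ⟨fun p => ⟨Fin.cases ((1 - (p.2 : ℝ)) * p.1 0) (Fin.cases ((p.2 : ℝ) * p.1 0) fun k => p.1 k.succ), by
    have h0 := p.2.2.1
    have h1 := p.2.2.2
    constructor
    · intro i
      induction i using Fin.cases with
      | zero => exact mul_nonneg (by linarith) (p.1.2.1 0)
      | succ i =>
        induction i using Fin.cases with
        | zero => exact mul_nonneg h0 (p.1.2.1 0)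
        | succ i => exact p.1.2.1 _
    · rw [Fin.sum_univ_succ, Fin.sum_univ_succ]
      have := p.1.2.2
      rw [Fin.sum_univ_succ] at this
      simp only [Fin.cases_zero, Fin.cases_succ]
      change p.1 0 + ∑ i : Fin m, p.1 i.succ = 1 at this
      linarith⟩, by
    refine Continuous.subtype_mk (continuous_pi fun i => ?_) _
    have c1 : Continuous fun p : Dl (m + 1) × unitInterval => (p.2 : ℝ) := continuous_subtype_val.comp continuous_snd
    have c2 : ∀ l, Continuous fun p : Dl (m + 1) × unitInterval => p.1 l := fun l => (co_cont l).comp continuous_fst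
    induction i using Fin.cases with
    | zero => exact (continuous_const.sub c1).mul (c2 0)
    | succ i =>
      induction i using Fin.cases with
      | zero => exact c1.mul (c2 0)
      | succ i => exact c2 _⟩

theorem sp_zero {m : ℕ} (x : Dl (m + 1)) (t) : sp m (x, t) 0 = (1 - (t : ℝ)) * x 0 := rfl
theorem sp_one {m : ℕ} (x : Dl (m + 1)) (t) : sp m (x, t) (Fin.succ 0) = (t : ℝ) * x 0 := rfl
theorem sp_succ {m : ℕ} (x : Dl (m + 1)) (t) (k : Fin m) : sp m (x, t) k.succ.succ = x k.succ := rfl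

theorem dgn_zero_zero {m : ℕ} (w : Dl (m + 2)) : dgn (0 : Fin (m + 1)) w 0 = w 0 + w (Fin.succ 0) := by
  rw [dgn_apply, Finset.sum_filter, Fin.sum_univ_succ, Fin.sum_univ_succ]
  have h1 : (0 : Fin (m + 1)).predAbove 0 = 0 := by simp
  have h2 : (0 : Fin (m + 1)).predAbove (Fin.succ 0) = 0 := by simp
  rw [if_pos h1, if_pos h2, Finset.sum_eq_zero, add_zero]
  intro k _
  rw [if_neg]
  rw [Fin.predAbove_succ_of_le _ _ (Fin.zero_le _)]
  exact Fin.succ_ne_zero k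

theorem dgn_zero_succ {m : ℕ} (w : Dl (m + 2)) (k : Fin m) : dgn (0 : Fin (m + 1)) w k.succ = w k.succ.succ := by
  rw [dgn_apply, Finset.sum_filter, Finset.sum_eq_single k.succ.succ]
  · rw [if_pos (Fin.predAbove_succ_of_le _ _ (Fin.zero_le _))]
  · intro b _ hb
    rw [if_neg]
    intro h
    induction b using Fin.cases with
    | zero =>
      have h1 : (0 : Fin (m + 1)).predAbove 0 = 0 := by simp
      rw [h1] at h
      exact Fin.succ_ne_zero k h.symm
    | succ b =>
      rw [Fin.predAbove_succ_of_le _ _ (Fin.zero_le _)] at h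
      exact hb (h ▸ rfl)
  · intro h; exact absurd (Finset.mem_univ _) h

theorem dgn_sp {m : ℕ} (x : Dl (m + 1)) (t) : dgn 0 (sp m (x, t)) = x := by
  refine Dl_ext fun i => ?_
  induction i using Fin.cases with
  | zero => rw [dgn_zero_zero, sp_zero, sp_one]; ring
  | succ k => rw [dgn_zero_succ, sp_succ]

theorem rel_homotopy {m : ℕ} (hE : Ext X (m + 2)) (a b : C(Dl (m + 1), X))
    (hab : ∀ x ∈ Fc (Set.univ : Set (Fin (m + 1))), a x = b x) :
    ∃ H : C(Dl (m + 1), C(unitInterval, X)), (∀ x, H x 0 = a x) ∧ (∀ x, H x 1 = b x) ∧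
      ∀ x ∈ Fc (Set.univ : Set (Fin (m + 1))), ∀ t, H x t = a x := by
  let u : Fin (m + 2) → C(Dl (m + 1), X) := fun i => if i = Fin.succ 0 then a else b
  have hu : ∀ i x, x ∈ Fc (Set.univ : Set (Fin (m + 1))) → u i x = a x := by
    intro i x hx
    by_cases h : i = Fin.succ 0
    · simp only [u, if_pos h]
    · simp only [u, if_neg h]; exact (hab x hx).symm
  have key : ∀ i j (w : Dl (m + 2)), w i = 0 → w j = 0 → i ≠ j → i = Fin.succ 0 →
      dgn 0 w ∈ Fc (Set.univ : Set (Fin (m + 1))) := by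
    rintro i j w hi hj hij rfl
    induction j using Fin.cases with
    | zero => exact ⟨0, trivial, by rw [dgn_zero_zero, hi, hj, add_zero]⟩
    | succ j =>
      induction j using Fin.cases with
      | zero => exact absurd rfl hij
      | succ j => exact ⟨j.succ, trivial, by rw [dgn_zero_succ, hj]⟩
  have key2 : ∀ i j (w : Dl (m + 2)), w i = 0 → w j = 0 → u i (dgn 0 w) = u j (dgn 0 w) := by
    intro i j w hi hj
    by_cases hij : i = j
    · rw [hij]
    · by_cases h1 : i = Fin.succ 0
      · have := key i j w hi hj hij h1
        rw [hu _ _ this, hu _ _ this]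
      · by_cases h2 : j = Fin.succ 0
        · have := key j i w hj hi (Ne.symm hij) h2
          rw [hu _ _ this, hu _ _ this]
        · simp only [u, if_neg h1, if_neg h2]
  obtain ⟨f, hf⟩ := glue Set.univ (fun i => (u i).comp ((dgn 0).comp (cof i))) (by
    intro i _ j _ y y' h
    change u i (dgn 0 (cof i y)) = u j (dgn 0 (cof j y'))
    rw [← h]
    exact key2 i j _ (cof_self i y) (by rw [h]; exact cof_self j y'))
  obtain ⟨F, hF⟩ := hE f
  have hF2 : ∀ i (w : Dl (m + 2)), w i = 0 → F w = u i (dgn 0 w) := by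
    intro i w hw
    have e := hf i trivial (drop i ⟨w, hw⟩)
    rw [← hF] at e
    change F (cof i (drop i ⟨w, hw⟩)) = u i (dgn 0 (cof i (drop i ⟨w, hw⟩))) at e
    rwa [cof_drop] at e
  have u1 : u (Fin.succ 0) = a := if_pos rfl
  have u0 : u 0 = b := if_neg (Fin.succ_ne_zero 0).symm
  refine ⟨(F.comp (sp m)).curry, ?_, ?_, ?_⟩
  · intro x
    change F (sp m (x, 0)) = a x
    rw [hF2 (Fin.succ 0) _ (by rw [sp_one]; simp), dgn_sp, u1]
  · intro x
    change F (sp m (x, 1)) = b x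
    rw [hF2 0 _ (by rw [sp_zero]; simp), dgn_sp, u0]
  · rintro x ⟨l, -, hl⟩ t
    change F (sp m (x, t)) = a x
    rcases Fin.eq_zero_or_eq_succ l with rfl | ⟨k, rfl⟩
    · rw [hF2 0 _ (by rw [sp_zero, hl, mul_zero]), dgn_sp, hu _ _ ⟨0, trivial, hl⟩]
    · rw [hF2 k.succ.succ _ (by rw [sp_succ, hl]), dgn_sp, hu _ _ ⟨_, trivial, hl⟩]


/-- first half speed -/
noncomputable def pm : C(unitInterval, unitInterval) :=
  ⟨fun r => ⟨min (2 * (r : ℝ)) 1, le_min (by linarith [r.2.1]) zero_le_one, min_le_right _ _⟩, by fun_prop⟩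

/-- second half speed -/
noncomputable def qm : C(unitInterval, unitInterval) :=
  ⟨fun r => ⟨max (2 * (r : ℝ) - 1) 0, le_max_right _ _, max_le (by linarith [r.2.2]) zero_le_one⟩, by fun_prop⟩

theorem mu_le_one {m : ℕ} (x : Dl (m + 1)) : mu x ≤ 1 := by
  refine (mu_le x 0).trans ?_
  have := x.2.2
  rw [← this]
  exact Finset.single_le_sum (f := fun i => x.1 i) (fun i _ => x.2.1 i) (Finset.mem_univ 0)

/-- reparametrisation -/
noncomputable def rpm (m : ℕ) : C(Dl (m + 1) × unitInterval, Dl (m + 1) × unitInterval) :=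
  ⟨fun p => (p.1, ⟨(pm p.2 : ℝ) * (1 - mu p.1 / 2) + (qm p.2 : ℝ) * (mu p.1 / 2), by
    have h1 := (pm p.2).2
    have h2 := (qm p.2).2
    have h3 := mu_nonneg p.1
    have h4 := mu_le_one p.1
    constructor
    · exact add_nonneg (mul_nonneg h1.1 (by linarith)) (mul_nonneg h2.1 (by linarith))
    · have e1 : (pm p.2 : ℝ) * (1 - mu p.1 / 2) ≤ 1 * (1 - mu p.1 / 2) :=
        mul_le_mul_of_nonneg_right h1.2 (by linarith)
      have e2 : (qm p.2 : ℝ) * (mu p.1 / 2) ≤ 1 * (mu p.1 / 2) :=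
        mul_le_mul_of_nonneg_right h2.2 (by linarith)
      linarith⟩), by
    have c1 : Continuous fun p : Dl (m + 1) × unitInterval => mu p.1 := mu_cont.comp continuous_fst
    have c2 : Continuous fun p : Dl (m + 1) × unitInterval => (pm p.2 : ℝ) := by fun_prop
    have c3 : Continuous fun p : Dl (m + 1) × unitInterval => (qm p.2 : ℝ) := by fun_prop
    refine continuous_fst.prodMk (Continuous.subtype_mk ?_ _)
    exact (c2.mul (continuous_const.sub (c1.div_const _))).add (c3.mul (c1.div_const _))⟩

theorem rpm_fst {m : ℕ} (p : Dl (m + 1) × unitInterval) : (rpm m p).1 = p.1 := rfl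
theorem rpm_snd {m : ℕ} (p : Dl (m + 1) × unitInterval) : ((rpm m p).2 : ℝ) =
  (pm p.2 : ℝ) * (1 - mu p.1 / 2) + (qm p.2 : ℝ) * (mu p.1 / 2) := rfl
theorem pm_val (r) : (pm r : ℝ) = min (2 * (r : ℝ)) 1 := rfl
theorem qm_val (r) : (qm r : ℝ) = max (2 * (r : ℝ) - 1) 0 := rfl
theorem pm_zero : pm 0 = 0 := Subtype.ext (by rw [pm_val]; simp)
theorem pm_one : pm 1 = 1 := Subtype.ext (by rw [pm_val]; simp)
theorem qm_zero : qm 0 = 0 := Subtype.ext (by rw [qm_val]; simp)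
theorem qm_one : qm 1 = 1 := Subtype.ext (by rw [qm_val]; simp; norm_num)

theorem rpm_zero {m : ℕ} (x : Dl (m + 1)) : rpm m (x, 0) = (x, 0) := by
  refine Prod.ext rfl (Subtype.ext ?_)
  rw [rpm_snd, pm_zero, qm_zero]; simp

theorem rpm_one {m : ℕ} (x : Dl (m + 1)) : rpm m (x, 1) = (x, 1) := by
  refine Prod.ext rfl (Subtype.ext ?_)
  rw [rpm_snd, pm_one, qm_one]; simp

theorem rpm_surj {m : ℕ} : Function.Surjective (rpm m) := by
  rintro ⟨x, t⟩
  have hc : Continuous fun r : unitInterval => ((rpm m (x, r)).2 : ℝ) :=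
    continuous_subtype_val.comp (continuous_snd.comp ((rpm m).continuous.comp (continuous_const.prodMk continuous_id)))
  obtain ⟨r, hr⟩ := mem_range_of_exists_le_of_exists_ge hc (c := (t : ℝ))
    ⟨0, by rw [rpm_zero]; exact t.2.1⟩ ⟨1, by rw [rpm_one]; exact t.2.2⟩
  exact ⟨(x, r), Prod.ext rfl (Subtype.ext hr)⟩

theorem rpm_ker {m : ℕ} (x : Dl (m + 1)) (r s : unitInterval) (hrs : (r : ℝ) ≤ s)
    (h : rpm m (x, r) = rpm m (x, s)) : r = s ∨ (mu x = 0 ∧ pm r = pm s) := by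
  have e := congrArg (fun p => (p.2 : ℝ)) h
  simp only [rpm_snd] at e
  have h3 := mu_nonneg x
  have h4 := mu_le_one x
  have h1 : (pm r : ℝ) ≤ pm s := by rw [pm_val, pm_val]; exact min_le_min (by linarith) le_rfl
  have h2 : (qm r : ℝ) ≤ qm s := by rw [qm_val, qm_val]; exact max_le_max (by linarith) le_rfl
  have a1 : 0 ≤ ((pm s : ℝ) - pm r) * (1 - mu x / 2) := mul_nonneg (by linarith) (by linarith)
  have a2 : 0 ≤ ((qm s : ℝ) - qm r) * (mu x / 2) := mul_nonneg (by linarith) (by linarith)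
  have b1 : ((pm s : ℝ) - pm r) * (1 - mu x / 2) = 0 := by linarith
  have b2 : ((qm s : ℝ) - qm r) * (mu x / 2) = 0 := by linarith
  have c1 : (pm r : ℝ) = pm s := by
    rcases mul_eq_zero.mp b1 with h | h <;> linarith
  rcases mul_eq_zero.mp b2 with h | h
  · left
    apply Subtype.ext
    have sum : ∀ r, (pm r : ℝ) + qm r = 2 * r := by
      intro r
      rw [pm_val, qm_val]
      rcases le_total (2 * (r : ℝ)) 1 with h | h
      · rw [min_eq_left h, max_eq_right (by linarith)]; ring
      · rw [min_eq_right h, max_eq_left (by linarith)]; ring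
    have := sum r
    have := sum s
    linarith
  · right
    exact ⟨by linarith, Subtype.ext c1⟩

theorem box_fill {m : ℕ} (hE : Ext X (m + 2)) (a b : C(Dl (m + 1), X))
    (S : C(Fc (Set.univ : Set (Fin (m + 1))), C(unitInterval, X)))
    (h0 : ∀ x, S x 0 = a x) (h1 : ∀ x, S x 1 = b x) :
    ∃ E : C(Dl (m + 1) × unitInterval, X), (∀ x, E (x, 0) = a x) ∧ (∀ x, E (x, 1) = b x) ∧
      ∀ x t, E (x.1, t) = S x t := by
  obtain ⟨G, hG0, hG⟩ := hep a S h0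
  let ev1 : C(C(unitInterval, X), X) := ⟨fun γ => γ 1, by fun_prop⟩
  obtain ⟨H, hH0, hH1, hH⟩ := rel_homotopy hE (ev1.comp G) b (fun x hx => by
    change G x 1 = b x
    rw [hG ⟨x, hx⟩, h1])
  have hH0 : ∀ x, H x 0 = G x 1 := hH0
  have hH : ∀ x ∈ Fc (Set.univ : Set (Fin (m + 1))), ∀ t, H x t = G x 1 := hH
  let cc : Dl (m + 1) × unitInterval → X := fun p =>
    if (p.2 : ℝ) ≤ 1 / 2 then G p.1 (pm p.2) else H p.1 (qm p.2)
  have hcc : Continuous cc := by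
    refine Continuous.if_le (by fun_prop) (by fun_prop) (by fun_prop) (by fun_prop) ?_
    rintro ⟨x, r⟩ (h : (r : ℝ) = 1 / 2)
    have e1 : pm r = 1 := Subtype.ext (by rw [pm_val, h]; simp)
    have e2 : qm r = 0 := Subtype.ext (by rw [qm_val, h]; simp)
    change G x (pm r) = H x (qm r)
    rw [e1, e2, hH0]
  have cfc : ∀ x ∈ Fc (Set.univ : Set (Fin (m + 1))), ∀ r, cc (x, r) = G x (pm r) := by
    intro x hx r
    change (if (r : ℝ) ≤ 1 / 2 then G x (pm r) else H x (qm r)) = _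
    split_ifs with h
    · rfl
    · have e1 : pm r = 1 := Subtype.ext (by rw [pm_val, min_eq_right (by linarith)]; rfl)
      rw [hH x hx, e1]
  have hq : Topology.IsQuotientMap (rpm m) :=
    IsClosedMap.isQuotientMap (rpm m).continuous.isClosedMap (rpm m).continuous rpm_surj
  have hk : ∀ (x : Dl (m + 1)) (r s : unitInterval), (r : ℝ) ≤ (s : ℝ) → rpm m (x, r) = rpm m (x, s) → cc (x, r) = cc (x, s) := by
    intro x r s hrs h
    rcases rpm_ker x r s hrs h with rfl | ⟨h1, h2⟩
    · rfl
    · have hx := (mu_zero_iff x).mp h1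
      rw [cfc x hx, cfc x hx, h2]
  have hker : ∀ p q, rpm m p = rpm m q → cc p = cc q := by
    rintro ⟨x, r⟩ ⟨y, s⟩ h
    obtain rfl : x = y := congrArg Prod.fst h
    rcases le_total (r : ℝ) s with h' | h'
    · exact hk x r s h' h
    · exact (hk x s r h' h.symm).symm
  let E : C(Dl (m + 1) × unitInterval, X) := hq.lift ⟨cc, hcc⟩ hker
  have hE2 : ∀ p, E (rpm m p) = cc p := fun p =>
    DFunLike.congr_fun (hq.lift_comp ⟨cc, hcc⟩ hker) p
  refine ⟨E, fun x => ?_, fun x => ?_, fun x t => ?_⟩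
  · have := hE2 (x, 0)
    rw [rpm_zero] at this
    rw [this]
    change (if (0 : ℝ) ≤ 1 / 2 then G x (pm 0) else H x (qm 0)) = _
    rw [if_pos (by norm_num), pm_zero, hG0]
  · have := hE2 (x, 1)
    rw [rpm_one] at this
    rw [this]
    change (if (1 : ℝ) ≤ 1 / 2 then G x (pm 1) else H x (qm 1)) = _
    rw [if_neg (by norm_num), qm_one, hH1]
  · let r : unitInterval := ⟨(t : ℝ) / 2, by linarith [t.2.1], by linarith [t.2.2]⟩
    have hr : (r : ℝ) = t / 2 := rfl
    have e1 : pm r = t := Subtype.ext (by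
      rw [pm_val, hr, min_eq_left (by linarith [t.2.2])]; ring)
    have e2 : rpm m (x.1, r) = (x.1, t) := by
      refine Prod.ext rfl (Subtype.ext ?_)
      rw [rpm_snd, e1]
      simp only [(mu_zero_iff x.1).mpr x.2]
      ring
    rw [← e2, hE2, cfc x.1 x.2, e1, hG]

end
end FLS

namespace FLS
section
variable {X : Type} [TopologicalSpace X]

theorem ext_of_rel {m : ℕ} (R : ∀ a b : C(Dl (m + 1), X),
    (∀ x ∈ Fc (Set.univ : Set (Fin (m + 1))), a x = b x) →
    ∃ H : C(Dl (m + 1), C(unitInterval, X)), (∀ x, H x 0 = a x) ∧ (∀ x, H x 1 = b x) ∧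
      ∀ x ∈ Fc (Set.univ : Set (Fin (m + 1))), ∀ t, H x t = a x) : Ext X (m + 2) := by
  intro f
  obtain ⟨r, hr⟩ := horn_retract (m := m) 0
  let inc : C(Fc {i : Fin (m + 2) | i ≠ 0}, Fc (Set.univ : Set (Fin (m + 2)))) :=
    ⟨fun x => ⟨x.1, by obtain ⟨i, -, h⟩ := x.2; exact ⟨i, trivial, h⟩⟩, by fun_prop⟩
  let G : C(Dl (m + 2), X) := (f.comp inc).comp r
  have hG : ∀ (w : Dl (m + 2)) (h : w ∈ Fc {i : Fin (m + 2) | i ≠ 0}), G w = f (inc ⟨w, h⟩) := by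
    intro w h
    change f (inc (r w)) = _
    have := hr ⟨w, h⟩
    change r w = _ at this
    rw [this]
  let fc : ∀ i : Fin (m + 2), C(Dl (m + 1), X) := fun i => f.comp ⟨fun y => ⟨cof i y, i, trivial, cof_self i y⟩, by fun_prop⟩
  have hbd : ∀ (i : Fin (m + 2)) (y : Dl (m + 1)), y ∈ Fc (Set.univ : Set (Fin (m + 1))) →
      ∃ j, j ≠ i ∧ cof i y j = 0 := by
    rintro i y ⟨l, -, hl⟩
    exact ⟨i.succAbove l, Fin.succAbove_ne _ _, by rw [cof_succAbove, hl]⟩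
  obtain ⟨K, hK0, hK1, hK⟩ := R (G.comp (cof 0)) (fc 0) (by
    intro x hx
    obtain ⟨j, hj, h⟩ := hbd 0 x hx
    exact hG _ ⟨j, hj, h⟩)
  have hK' : ∀ x ∈ Fc (Set.univ : Set (Fin (m + 1))), ∀ t, K x t = fc 0 x := by
    intro x hx t
    rw [hK x hx]
    obtain ⟨j, hj, h⟩ := hbd 0 x hx
    exact hG _ ⟨j, hj, h⟩
  let cst : C(X, C(unitInterval, X)) := ⟨fun x => ContinuousMap.const _ x, ContinuousMap.continuous_const'⟩
  let T : Fin (m + 2) → C(Dl (m + 1), C(unitInterval, X)) := fun i => if i = 0 then K else cst.comp (fc i)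
  have hT0 : T 0 = K := if_pos rfl
  have hT : ∀ i, i ≠ 0 → T i = cst.comp (fc i) := fun i hi => if_neg hi
  have key : ∀ (i j : Fin (m + 2)) y y', cof i y = cof j y' → i ≠ j → ∀ t, T i y t = fc i y := by
    intro i j y y' h hij t
    by_cases h0 : i = 0
    · subst h0
      rw [hT0]
      apply hK'
      obtain ⟨l, rfl⟩ := Fin.exists_succAbove_eq (Ne.symm hij)
      exact ⟨l, trivial, by rw [← cof_succAbove 0 y l, h]; exact cof_self _ _⟩
    · rw [hT i h0]; rfl
  obtain ⟨H, hH⟩ := glue Set.univ T (by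
    intro i _ j _ y y' h
    by_cases hij : i = j
    · subst hij; rw [cof_inj i h]
    · refine ContinuousMap.ext fun t => ?_
      rw [key i j y y' h hij, key j i y' y h.symm (Ne.symm hij)]
      change f _ = f _
      congr 1
      exact Subtype.ext h)
  have hH' : ∀ (i : Fin (m + 2)) (w : Dl (m + 2)) (hw : w i = 0) t,
      H ⟨w, i, trivial, hw⟩ t = T i (drop i ⟨w, hw⟩) t := by
    intro i w hw t
    have e := hH i trivial (drop i ⟨w, hw⟩)
    rw [← e]
    congr 2
    exact Subtype.ext (cof_drop i ⟨w, hw⟩).symm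
  have hfc : ∀ (i : Fin (m + 2)) (w : Dl (m + 2)) (hw : w i = 0),
      fc i (drop i ⟨w, hw⟩) = f ⟨w, i, trivial, hw⟩ := by
    intro i w hw
    change f _ = f _
    congr 1
    exact Subtype.ext (cof_drop i ⟨w, hw⟩)
  obtain ⟨G', hG0, hG1⟩ := hep G H (by
    rintro ⟨w, i, -, hw⟩
    rw [hH' i w hw]
    by_cases h0 : i = 0
    · subst h0
      rw [hT0, hK0]
      change G (cof 0 (drop 0 ⟨w, hw⟩)) = G w
      rw [cof_drop]
    · rw [hT i h0]
      change fc i _ = _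
      rw [hfc]
      exact (hG w ⟨i, h0, hw⟩).symm)
  refine ⟨⟨fun x => G' x 1, by fun_prop⟩, ?_⟩
  rintro ⟨w, i, -, hw⟩
  change G' w 1 = _
  rw [hG1 ⟨w, i, trivial, hw⟩, hH' i w hw]
  by_cases h0 : i = 0
  · subst h0
    rw [hT0, hK1, hfc]
  · rw [hT i h0]
    change fc i _ = _
    rw [hfc]

theorem ext_one [Nonempty X] : Ext X 1 := fun f =>
  ⟨ContinuousMap.const _ (Classical.arbitrary X), fun x => isEmptyElim (α := Fc (Set.univ : Set (Fin (0 + 1)))) x⟩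

theorem ext_two [PathConnectedSpace X] : Ext X 2 := by
  refine ext_of_rel (m := 0) fun a b _ => ?_
  let p : Path (a default) (b default) := PathConnectedSpace.somePath _ _
  refine ⟨ContinuousMap.const _ p.toContinuousMap, fun x => ?_, fun x => ?_, ?_⟩
  · rw [Subsingleton.elim x default]; exact p.source
  · rw [Subsingleton.elim x default]; exact p.target
  · intro x hx
    exact isEmptyElim (α := Fc (Set.univ : Set (Fin (0 + 1)))) ⟨x, hx⟩

theorem ext_three [SimplyConnectedSpace X] : Ext X 3 := by
  refine ext_of_rel (m := 1) fun a b hab => ?_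
  let φ : Dl 2 ≃ₜ unitInterval := stdSimplexHomeomorphUnitInterval
  have hφ1 : ∀ t, (φ.symm t) 1 = (t : ℝ) := fun t => congrArg Subtype.val (φ.apply_symm_apply t)
  have hφ0 : ∀ t, (φ.symm t) 0 = 1 - (t : ℝ) := fun t => rfl
  have e0 : a (φ.symm 0) = b (φ.symm 0) := hab _ ⟨1, trivial, by rw [hφ1]; rfl⟩
  have e1 : a (φ.symm 1) = b (φ.symm 1) := hab _ ⟨0, trivial, by rw [hφ0]; simp⟩
  let p : Path (a (φ.symm 0)) (a (φ.symm 1)) := ⟨a.comp ⟨φ.symm, φ.symm.continuous⟩, rfl, rfl⟩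
  let q : Path (a (φ.symm 0)) (a (φ.symm 1)) := ⟨b.comp ⟨φ.symm, φ.symm.continuous⟩, e0.symm, e1.symm⟩
  obtain ⟨H⟩ := SimplyConnectedSpace.paths_homotopic p q
  let L : C(Dl 2 × unitInterval, X) := ⟨fun z => H (z.2, φ z.1), by
    have := φ.continuous
    fun_prop⟩
  refine ⟨L.curry, fun x => ?_, fun x => ?_, ?_⟩
  · change H (0, φ x) = _
    rw [H.apply_zero]
    change a (φ.symm (φ x)) = _
    rw [φ.symm_apply_apply]
  · change H (1, φ x) = _
    rw [H.apply_one]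
    change b (φ.symm (φ x)) = _
    rw [φ.symm_apply_apply]
  · rintro x ⟨i, -, hi⟩ t
    change H (t, φ x) = _
    obtain ⟨s, rfl⟩ := φ.symm.surjective x
    rw [φ.apply_symm_apply]
    fin_cases i
    · have : s = 1 := Subtype.ext (by have := hφ0 s; change (φ.symm s) 0 = 0 at hi; rw [hi] at this; change (s : ℝ) = 1; linarith)
      subst this
      exact H.target t
    · have : s = 0 := Subtype.ext (by have := hφ1 s; change (φ.symm s) 1 = 0 at hi; rw [hi] at this; change (s : ℝ) = 0; linarith)
      subst this
      exact H.source t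

theorem all_ext [SimplyConnectedSpace X] [T2Space X] (hX : Surf X)
    (hnc : ∀ (x : X) (K : Set X), IsCompact K → ∃ y ∈ connectedComponent x, y ∉ K) :
    ∀ k, Ext X (k + 1) := by
  have : PathConnectedSpace X := inferInstance
  intro k
  induction k using Nat.strong_induction_on with
  | _ k ih =>
    match k with
    | 0 => exact ext_one
    | 1 => exact ext_two
    | 2 => exact ext_three
    | n + 3 =>
      exact hurewicz (n + 2) (by omega) (fun k hk => ih k (by omega))
        fun z hz => surf_cycle hX hnc (by omega) z hz

end
end FLS

namespace FLS

/-- local systems of sets -/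
structure LS (M : Type) [TopologicalSpace M] where
  F : M → Type
  tr : ∀ {x y : M}, Path x y → F x → F y
  tr_refl : ∀ {x : M} (s : F x), tr (Path.refl x) s = s
  tr_trans : ∀ {x y z : M} (p : Path x y) (q : Path y z) (s : F x), tr (p.trans q) s = tr q (tr p s)
  tr_hom : ∀ {x y : M} {p q : Path x y} (s : F x), p.Homotopic q → tr p s = tr q s

section
variable {M : Type} [TopologicalSpace M]

/-- total space -/
def LS.E (L : LS M) : Type := Σ x, L.F x

instance (L : LS M) : TopologicalSpace L.E where
  IsOpen O := ∀ e ∈ O, ∃ V : Set M, IsOpen V ∧ e.1 ∈ V ∧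
    ∀ y (γ : Path e.1 y), (∀ t, γ t ∈ V) → (⟨y, L.tr γ e.2⟩ : Σ x, L.F x) ∈ O
  isOpen_univ := fun e _ => ⟨Set.univ, isOpen_univ, trivial, fun _ _ _ => trivial⟩
  isOpen_inter := fun O O' h h' e he => by
    obtain ⟨V, h1, h2, h3⟩ := h e he.1
    obtain ⟨V', h1', h2', h3'⟩ := h' e he.2
    exact ⟨V ∩ V', h1.inter h1', ⟨h2, h2'⟩, fun y γ hγ =>
      ⟨h3 y γ fun t => (hγ t).1, h3' y γ fun t => (hγ t).2⟩⟩
  isOpen_sUnion := fun S hS e he => by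
    obtain ⟨O, hO, heO⟩ := he
    obtain ⟨V, h1, h2, h3⟩ := hS O hO e heO
    exact ⟨V, h1, h2, fun y γ hγ => ⟨O, hO, h3 y γ hγ⟩⟩

namespace LS
variable (L : LS M)

theorem isOpen_iff (O : Set L.E) : IsOpen O ↔ ∀ e ∈ O, ∃ V : Set M, IsOpen V ∧ e.1 ∈ V ∧
    ∀ y (γ : Path e.1 y), (∀ t, γ t ∈ V) → (⟨y, L.tr γ e.2⟩ : Σ x, L.F x) ∈ O := Iff.rfl

/-- projection -/
def pr : C(L.E, M) := ⟨fun e => e.1, by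
  constructor
  intro V hV
  rw [isOpen_iff]
  intro e he
  refine ⟨V, hV, he, fun y γ hγ => ?_⟩
  have := hγ 1
  rwa [γ.target] at this⟩

theorem tr_symm_tr {x y : M} (p : Path x y) (s : L.F x) : L.tr p.symm (L.tr p s) = s := by
  rw [← L.tr_trans, L.tr_hom s (Path.Homotopic.trans_symm p), L.tr_refl]

theorem tr_inj {x y : M} (p : Path x y) : Function.Injective (L.tr p) := fun s s' h => by
  rw [← L.tr_symm_tr p s, h, L.tr_symm_tr]

theorem cont_of_tr {Y : Type} [TopologicalSpace Y] [LocallyPathConnectedSpace Y] (f : C(Y, M))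
    (g : ∀ y, L.F (f y)) (h : ∀ y y' (δ : Path y y'), L.tr (δ.map f.continuous) (g y) = g y') :
    Continuous (Y := L.E) (fun y => ⟨f y, g y⟩) := by
  constructor
  intro O hO
  rw [isOpen_iff_mem_nhds]
  intro y hy
  obtain ⟨V, h1, h2, h3⟩ := (L.isOpen_iff O).mp hO _ hy
  have hW : f ⁻¹' V ∈ nhds y := (h1.preimage f.continuous).mem_nhds h2
  obtain ⟨W, ⟨hW1, hW2⟩, hW3⟩ := (LocallyPathConnectedSpace.path_connected_basis y).mem_iff.mp hW
  refine Filter.mem_of_superset hW1 fun y' hy' => ?_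
  obtain ⟨δ, hδ⟩ := hW2.joinedIn y (mem_of_mem_nhds hW1) y' hy'
  have := h3 (f y') (δ.map f.continuous) fun t => hW3 (hδ t)
  change (⟨f y', L.tr (δ.map f.continuous) (g y)⟩ : L.E) ∈ O at this
  rw [h] at this
  exact this

section
variable {Y : Type} [TopologicalSpace Y] [LocallyPathConnectedSpace Y] [SimplyConnectedSpace Y]

theorem tr_map_eq (f : C(Y, M)) {y y' : Y} (δ δ' : Path y y') (s : L.F (f y)) :
    L.tr (δ.map f.continuous) s = L.tr (δ'.map f.continuous) s :=
  L.tr_hom s ((SimplyConnectedSpace.paths_homotopic δ δ').map f)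

/-- fibre component of the lift -/
noncomputable def lt (f : C(Y, M)) (y0 : Y) (s : L.F (f y0)) (y : Y) : L.F (f y) :=
  L.tr ((PathConnectedSpace.somePath y0 y).map f.continuous) s

theorem lt_eq (f : C(Y, M)) (y0 : Y) (s : L.F (f y0)) (y : Y) (δ : Path y0 y) :
    L.lt f y0 s y = L.tr (δ.map f.continuous) s := L.tr_map_eq f _ _ s

theorem lt_self (f : C(Y, M)) (y0 : Y) (s : L.F (f y0)) : L.lt f y0 s y0 = s := by
  rw [L.lt_eq f y0 s y0 (Path.refl y0)]
  have : (Path.refl y0).map f.continuous = Path.refl (f y0) := by ext; rfl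
  rw [this, L.tr_refl]

theorem lt_tr (f : C(Y, M)) (y0 : Y) (s : L.F (f y0)) {y y' : Y} (δ : Path y y') :
    L.tr (δ.map f.continuous) (L.lt f y0 s y) = L.lt f y0 s y' := by
  rw [L.lt_eq f y0 s y' ((PathConnectedSpace.somePath y0 y).trans δ), Path.map_trans, L.tr_trans]
  rfl

/-- lifts -/
noncomputable def lift (f : C(Y, M)) (y0 : Y) (s : L.F (f y0)) : C(Y, L.E) :=
  ⟨fun y => ⟨f y, L.lt f y0 s y⟩, L.cont_of_tr f _ fun _ _ δ => L.lt_tr f y0 s δ⟩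

theorem lift_open (f : C(Y, M)) (hf : Topology.IsOpenEmbedding f) (y0 : Y) (s : L.F (f y0)) :
    Topology.IsOpenEmbedding (L.lift f y0 s) := by
  refine Topology.IsOpenEmbedding.of_continuous_injective_isOpenMap (L.lift f y0 s).continuous ?_ ?_
  · intro y y' h
    exact hf.injective (congrArg Sigma.fst h)
  · intro U hU
    rw [isOpen_iff]
    rintro _ ⟨y, hy, rfl⟩
    refine ⟨Set.image f U, hf.isOpenMap U hU, ⟨y, hy, rfl⟩, fun z γ hγ => ?_⟩
    choose d hd1 hd2 using hγ
    have hd : Continuous d := by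
      rw [hf.isInducing.continuous_iff]
      have : f ∘ d = γ := funext hd2
      rw [this]; exact γ.continuous
    have e0 : d 0 = y := hf.injective (by rw [hd2, γ.source]; rfl)
    obtain ⟨z', hz'⟩ : ∃ z', z' = d 1 := ⟨_, rfl⟩
    have hzU : z' ∈ U := hz' ▸ hd1 1
    have e1 : f z' = z := by rw [hz', hd2, γ.target]
    subst e1
    let δ : Path y z' := ⟨⟨d, hd⟩, e0, hz'.symm⟩
    refine ⟨z', hzU, ?_⟩
    change (⟨f z', L.lt f y0 s z'⟩ : L.E) = _
    have : γ = δ.map f.continuous := by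
      ext t; exact (hd2 t).symm
    rw [this]
    change _ = (⟨f z', L.tr (δ.map f.continuous) (L.lt f y0 s y)⟩ : L.E)
    rw [L.lt_tr]
end

variable {L}

theorem chart (hM : Surf M) (e : L.E) : ∃ (j : C(ℝ × ℝ, M)) (s : L.F (j 0)), Topology.IsOpenEmbedding j ∧
    L.lift j 0 s 0 = e := by
  obtain ⟨x, s⟩ := e
  obtain ⟨j, hj, rfl⟩ := hM x
  refine ⟨j, s, hj, ?_⟩
  change (⟨j 0, L.lt j 0 s 0⟩ : L.E) = _
  rw [L.lt_self]

theorem surfE (hM : Surf M) : Surf L.E := by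
  intro e
  obtain ⟨j, s, hj, h⟩ := chart hM e
  exact ⟨L.lift j 0 s, L.lift_open j hj 0 s, h⟩

theorem t2E [T2Space M] (hM : Surf M) : T2Space L.E := by
  constructor
  intro e e' hne
  by_cases hx : e.1 = e'.1
  · obtain ⟨x, s⟩ := e
    obtain ⟨x', s'⟩ := e'
    obtain rfl : x = x' := hx
    obtain ⟨j, hj, rfl⟩ := hM x
    refine ⟨Set.range (L.lift j 0 s), Set.range (L.lift j 0 s'), (L.lift_open j hj 0 s).isOpen_range,
      (L.lift_open j hj 0 s').isOpen_range, ⟨0, ?_⟩, ⟨0, ?_⟩, ?_⟩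
    · change (⟨j 0, L.lt j 0 s 0⟩ : L.E) = _
      rw [L.lt_self]
    · change (⟨j 0, L.lt j 0 s' 0⟩ : L.E) = _
      rw [L.lt_self]
    · rw [Set.disjoint_left]
      rintro _ ⟨y, rfl⟩ ⟨y', h⟩
      obtain rfl : y' = y := hj.injective (congrArg Sigma.fst h)
      have h2 : L.lt j 0 s' y' = L.lt j 0 s y' := eq_of_heq (Sigma.mk.inj h).2
      apply hne
      rw [L.tr_inj _ h2]
  · obtain ⟨U, V, hU, hV, h1, h2, h3⟩ := t2_separation hx
    exact ⟨L.pr ⁻¹' U, L.pr ⁻¹' V, hU.preimage L.pr.continuous, hV.preimage L.pr.continuous, h1, h2,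
      h3.preimage _⟩

theorem locE (hM : Surf M) : IsLocalHomeomorph L.pr := by
  rw [isLocalHomeomorph_iff_isOpenEmbedding_restrict]
  intro e
  obtain ⟨j, s, hj, h⟩ := chart hM e
  have ho := L.lift_open j hj 0 s
  refine ⟨Set.range (L.lift j 0 s), ho.isOpen_range.mem_nhds ⟨0, h⟩, ?_⟩
  let φ := ho.isEmbedding.toHomeomorph
  have : (Set.range (L.lift j 0 s)).domRestrict L.pr = j ∘ φ.symm := by
    funext z
    obtain ⟨y, rfl⟩ := φ.surjective z
    rw [Function.comp_apply, φ.symm_apply_apply]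
    rfl
  rw [this]
  exact hj.comp φ.symm.isOpenEmbedding

instance : LocallyPathConnectedSpace unitInterval := (convex_Icc (0 : ℝ) 1).locallyPathConnectedSpace

instance : ContractibleSpace unitInterval := (convex_Icc (0 : ℝ) 1).contractibleSpace ⟨0, by simp⟩

theorem path_lift {x y : M} (p : Path x y) (s : L.F x) : ∃ Γ : C(unitInterval, L.E),
    (∀ t, (Γ t).1 = p t) ∧ Γ 0 = ⟨x, s⟩ ∧ Γ 1 = ⟨y, L.tr p s⟩ := by
  obtain ⟨f, rfl, rfl⟩ := p
  refine ⟨L.lift f 0 s, fun t => rfl, ?_, ?_⟩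
  · change (⟨f 0, L.lt f 0 s 0⟩ : L.E) = _
    rw [L.lt_self]; rfl
  · change (⟨f 1, L.lt f 0 s 1⟩ : L.E) = _
    let δ : Path (0 : unitInterval) 1 := ⟨ContinuousMap.id _, rfl, rfl⟩
    rw [L.lt_eq f 0 s 1 δ]
    rfl

theorem lift_uniq [T2Space M] (hM : Surf M) {A : Type} [TopologicalSpace A] [PreconnectedSpace A] (g g' : C(A, L.E))
    (h : ∀ a, (g a).1 = (g' a).1) (a : A) (ha : g a = g' a) : g = g' := by
  have := t2E (L := L) hM
  have := (T2Space.isSeparatedMap L.pr).eq_of_comp_eq (locE hM).isLocallyInjective g.continuous g'.continuous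
    (funext h) a ha
  exact ContinuousMap.ext fun x => congrFun this x

theorem tr_of_path [T2Space M] (hM : Surf M) {e e' : L.E} (Γ : Path e e') :
    L.tr (Γ.map L.pr.continuous : Path e.1 e'.1) e.2 = e'.2 := by
  obtain ⟨Γ', h1, h2, h3⟩ := path_lift (L := L) (Γ.map L.pr.continuous : Path e.1 e'.1) e.2
  have := lift_uniq hM Γ' Γ.toContinuousMap (fun t => h1 t) 0 (h2.trans Γ.source.symm)
  rw [this] at h3
  have h4 : e' = ⟨e'.1, L.tr (Γ.map L.pr.continuous : Path e.1 e'.1) e.2⟩ := Γ.target.symm.trans h3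
  exact (eq_of_heq (Sigma.mk.inj (h4 : (⟨e'.1, e'.2⟩ : Σ x, L.F x) = _)).2).symm

theorem homotopy_lift [T2Space M] (hM : Surf M) {A : Type} [TopologicalSpace A] (H : C(unitInterval × A, M))
    (f : C(A, L.E)) (h0 : ∀ a, H (0, a) = (f a).1) :
    ∃ G : C(unitInterval × A, L.E), (∀ z, (G z).1 = H z) ∧ ∀ a, G (0, a) = f a := by
  have := t2E (L := L) hM
  have key : ∀ a, ∃ Γ : C(unitInterval, L.E), (∀ t, (Γ t).1 = H (t, a)) ∧ Γ 0 = f a := by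
    intro a
    let p : Path (f a).1 (H (1, a)) := ⟨⟨fun t => H (t, a), by fun_prop⟩, h0 a, rfl⟩
    obtain ⟨Γ, h1, h2, -⟩ := path_lift (L := L) p (f a).2
    exact ⟨Γ, h1, h2⟩
  choose Γ h1 h2 using key
  refine ⟨⟨fun z => Γ z.2 z.1, ?_⟩, fun z => h1 _ _, h2⟩
  refine (locE hM).continuous_lift (T2Space.isSeparatedMap L.pr) H ?_ ?_ ?_
  · funext z; exact h1 _ _
  · simp only [h2]; exact f.continuous
  · intro a; exact (Γ a).continuous

theorem noncompactE [T2Space M] [PathConnectedSpace M] (hnc : ¬ CompactSpace M)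
    (e : L.E) (K : Set L.E) (hK : IsCompact K) : ∃ y ∈ connectedComponent e, y ∉ K := by
  by_contra! hcon
  apply hnc
  constructor
  have : (Set.univ : Set M) = Set.image L.pr K := by
    symm
    rw [Set.eq_univ_iff_forall]
    intro y
    obtain ⟨Γ, h1, h2, h3⟩ := path_lift (L := L) (PathConnectedSpace.somePath e.1 y) e.2
    refine ⟨Γ 1, hcon _ ?_, by rw [h3]; rfl⟩
    have hj : Joined e (Γ 1) := ⟨⟨Γ, h2, rfl⟩⟩
    exact pathComponent_subset_component e hj
  rw [this]
  exact hK.image L.pr.continuous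

end LS
end
end FLS

namespace FLS
section
variable {M : Type} [TopologicalSpace M]

theorem pathConn [ConnectedSpace M] (hM : Surf M) : PathConnectedSpace M := by
  have hop : ∀ x : M, IsOpen (pathComponent x) := by
    intro x
    rw [isOpen_iff_mem_nhds]
    intro y hy
    obtain ⟨j, hj, rfl⟩ := hM y
    refine Filter.mem_of_superset (hj.isOpen_range.mem_nhds ⟨0, rfl⟩) ?_
    rintro _ ⟨v, rfl⟩
    have : Joined (0 : ℝ × ℝ) v := ⟨PathConnectedSpace.somePath _ _⟩
    exact Joined.trans hy (this.map j.continuous)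
  have hcl : ∀ x : M, IsClosed (pathComponent x) := by
    intro x
    rw [← isOpen_compl_iff, isOpen_iff_mem_nhds]
    intro y hy
    refine Filter.mem_of_superset ((hop y).mem_nhds (mem_pathComponent_self y)) ?_
    intro z hz hxz
    exact hy (Joined.trans hxz (Joined.symm hz))
  refine ⟨inferInstance, fun x y => ?_⟩
  have := IsClopen.eq_univ ⟨hcl x, hop x⟩ ⟨x, mem_pathComponent_self x⟩
  have hy : y ∈ pathComponent x := this ▸ Set.mem_univ y
  exact hy

abbrev PQ (x y : M) := Path.Homotopic.Quotient x y

theorem pq_cancel {x y z : M} (s : PQ x y) (p q : PQ y z) (h : s.trans p = s.trans q) : p = q := by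
  have := congrArg (fun r => s.symm.trans r) h
  simpa only [← Path.Homotopic.Quotient.trans_assoc, Path.Homotopic.Quotient.symm_trans,
    Path.Homotopic.Quotient.refl_trans] using this

theorem pq_alg {x y z : M} (g : PQ x y) (l : PQ y y) (d : PQ y z) :
    (g.trans l).trans d = (g.trans d).trans (d.symm.trans (l.trans d)) := by
  rw [Path.Homotopic.Quotient.trans_assoc, Path.Homotopic.Quotient.trans_assoc,
    ← Path.Homotopic.Quotient.trans_assoc d,
    Path.Homotopic.Quotient.trans_symm, Path.Homotopic.Quotient.refl_trans]

theorem pq_conj {x y : M} (l : PQ x x) (l' : PQ y y) (d : PQ x y) (h : l.trans d = d.trans l') :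
    d.symm.trans (l.trans d) = l' := by
  rw [h, ← Path.Homotopic.Quotient.trans_assoc, Path.Homotopic.Quotient.symm_trans,
    Path.Homotopic.Quotient.refl_trans]

/-- universal cover -/
noncomputable def UC (x0 : M) : LS M where
  F x := PQ x0 x
  tr p s := s.trans (Path.Homotopic.Quotient.mk p)
  tr_refl s := Path.Homotopic.Quotient.trans_refl s
  tr_trans p q s := by
    rw [Path.Homotopic.Quotient.mk_trans, Path.Homotopic.Quotient.trans_assoc]
  tr_hom s h := by rw [Path.Homotopic.Quotient.eq.mpr h]

theorem pq_symm_trans_rev {x y z : M} (p : PQ x y) (q : PQ y z) : (p.trans q).symm = q.symm.trans p.symm := by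
  apply pq_cancel (p.trans q)
  rw [Path.Homotopic.Quotient.trans_symm, Path.Homotopic.Quotient.trans_assoc,
    ← Path.Homotopic.Quotient.trans_assoc q, Path.Homotopic.Quotient.trans_symm,
    Path.Homotopic.Quotient.refl_trans, Path.Homotopic.Quotient.trans_symm]

theorem pq_symm_refl (x : M) : (Path.Homotopic.Quotient.refl x).symm = Path.Homotopic.Quotient.refl x := by
  apply pq_cancel (Path.Homotopic.Quotient.refl x)
  rw [Path.Homotopic.Quotient.trans_symm, Path.Homotopic.Quotient.trans_refl]

/-- the covering of conjugation -/
noncomputable def LN (M : Type) [TopologicalSpace M] : LS M where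
  F x := PQ x x
  tr p s := (Path.Homotopic.Quotient.mk p).symm.trans (s.trans (Path.Homotopic.Quotient.mk p))
  tr_refl {x} s := by
    rw [Path.Homotopic.Quotient.mk_refl, Path.Homotopic.Quotient.trans_refl, pq_symm_refl,
      Path.Homotopic.Quotient.refl_trans]
  tr_trans p q s := by
    rw [Path.Homotopic.Quotient.mk_trans, pq_symm_trans_rev]
    simp only [Path.Homotopic.Quotient.trans_assoc]
  tr_hom s h := by rw [Path.Homotopic.Quotient.eq.mpr h]

theorem UC_sc [T2Space M] [PathConnectedSpace M] (hM : Surf M) (x0 : M) : SimplyConnectedSpace (UC x0).E := by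
  rw [simply_connected_iff_paths_homotopic']
  constructor
  · have base : ∀ e : (UC x0).E, Joined (X := (UC x0).E) ⟨x0, Path.Homotopic.Quotient.refl x0⟩ e := by
      rintro ⟨x, s⟩
      obtain ⟨p, rfl⟩ := Path.Homotopic.Quotient.mk_surjective s
      obtain ⟨Γ, -, h2, h3⟩ := LS.path_lift (L := UC x0) p (Path.Homotopic.Quotient.refl x0)
      refine ⟨⟨Γ, h2, h3.trans ?_⟩⟩
      change (⟨x, (Path.Homotopic.Quotient.refl x0).trans (Path.Homotopic.Quotient.mk p)⟩ : (UC x0).E) = _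
      rw [Path.Homotopic.Quotient.refl_trans]
    exact ⟨⟨⟨x0, Path.Homotopic.Quotient.refl x0⟩⟩, fun e e' => (base e).symm.trans (base e')⟩
  · intro e e' Γ1 Γ2
    have h1 := LS.tr_of_path hM Γ1
    have h2 := LS.tr_of_path hM Γ2
    have h3 := pq_cancel _ _ _ (h1.trans h2.symm)
    obtain ⟨H⟩ := Path.Homotopic.Quotient.eq.mp h3
    let H' : C(unitInterval × unitInterval, M) := ⟨fun z => H (z.2, z.1), by fun_prop⟩
    obtain ⟨G, hG1, hG2⟩ := LS.homotopy_lift hM H' (ContinuousMap.const _ e) (by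
      intro a
      exact H.source a)
    have hG2 : ∀ a, G (0, a) = e := hG2
    have k1 := LS.lift_uniq hM (⟨fun t => G (t, 0), by fun_prop⟩ : C(unitInterval, (UC x0).E)) Γ1.toContinuousMap (by
      intro t
      refine (hG1 _).trans (H.apply_zero t)) 0 ((hG2 0).trans Γ1.source.symm)
    have k2 := LS.lift_uniq hM (⟨fun t => G (t, 1), by fun_prop⟩ : C(unitInterval, (UC x0).E)) Γ2.toContinuousMap (by
      intro t
      refine (hG1 _).trans (H.apply_one t)) 0 ((hG2 1).trans Γ2.source.symm)
    have k3 := LS.lift_uniq hM (⟨fun s => G (1, s), by fun_prop⟩ : C(unitInterval, (UC x0).E)) (ContinuousMap.const _ e') (by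
      intro t
      refine (hG1 _).trans (H.target t)) 0 (by
        have := DFunLike.congr_fun k1 1
        exact this.trans Γ1.target)
    refine ⟨⟨⟨⟨fun z => G (z.2, z.1), by fun_prop⟩, ?_, ?_⟩, ?_⟩⟩
    · intro t; exact DFunLike.congr_fun k1 t
    · intro t; exact DFunLike.congr_fun k2 t
    · intro s t ht
      rcases ht with rfl | ht
      · exact (hG2 s).trans Γ1.source.symm
      · rw [Set.mem_singleton_iff] at ht
        subst ht
        exact (DFunLike.congr_fun k3 s).trans Γ1.target.symm

/-- the quotient map onto the circle -/
noncomputable def qc : C(unitInterval, Circle) := ⟨fun t => Circle.exp (2 * Real.pi * t), by fun_prop⟩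

theorem qc_zero : qc 0 = 1 := by
  change Circle.exp _ = 1
  simp
theorem qc_one : qc 1 = 1 := by
  change Circle.exp _ = 1
  simp
theorem qc_surj : Function.Surjective qc := by
  intro z
  have hp := Real.two_pi_pos
  refine ⟨⟨Int.fract ((Complex.arg z) / (2 * Real.pi)), Int.fract_nonneg _, (Int.fract_lt_one _).le⟩, ?_⟩
  change Circle.exp (2 * Real.pi * Int.fract ((Complex.arg z) / (2 * Real.pi))) = z
  conv_rhs => rw [← Circle.exp_arg z]
  rw [Circle.exp_eq_exp]
  refine ⟨-⌊(Complex.arg z) / (2 * Real.pi)⌋, ?_⟩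
  rw [← Int.self_sub_floor]
  push_cast
  field_simp
  ring
theorem qc_inj (s t : unitInterval) (h : qc s = qc t) : s = t ∨ (s = 0 ∧ t = 1) ∨ (s = 1 ∧ t = 0) := by
  have h' : Circle.exp (2 * Real.pi * s) = Circle.exp (2 * Real.pi * t) := h
  rw [Circle.exp_eq_exp] at h'
  obtain ⟨n, hn⟩ := h'
  have hp := Real.two_pi_pos
  have e : (s : ℝ) = t + n := by
    have : 2 * Real.pi * (s : ℝ) = 2 * Real.pi * (t + n) := by rw [hn]; ring
    exact mul_left_cancel₀ hp.ne' this
  have s0 := s.2.1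
  have s1 := s.2.2
  have t0 := t.2.1
  have t1 := t.2.2
  have n1 : (n : ℝ) ≤ 1 := by linarith
  have n2 : (-1 : ℝ) ≤ n := by linarith
  have n1' : n ≤ 1 := by exact_mod_cast n1
  have n2' : -1 ≤ n := by exact_mod_cast n2
  have : n = 0 ∨ n = 1 ∨ n = -1 := by omega
  rcases this with rfl | rfl | rfl
  · left; apply Subtype.ext; rw [e]; simp
  · right; right
    push_cast at e
    exact ⟨Subtype.ext (by change (s : ℝ) = 1; linarith), Subtype.ext (by change (t : ℝ) = 0; linarith)⟩
  · right; left
    push_cast at e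
    exact ⟨Subtype.ext (by change (s : ℝ) = 0; linarith), Subtype.ext (by change (t : ℝ) = 1; linarith)⟩

theorem descend {Y : Type} [TopologicalSpace Y] [CompactSpace Y] [T2Space Y] (E : C(Y × unitInterval, M))
    (h : ∀ y, E (y, 0) = E (y, 1)) : ∃ c : C(Y, C(Circle, M)), ∀ y t, c y (qc t) = E (y, t) := by
  let Q : C(Y × unitInterval, Y × Circle) := ⟨fun z => (z.1, qc z.2), by fun_prop⟩
  have hq : Topology.IsQuotientMap Q := by
    refine IsClosedMap.isQuotientMap Q.continuous.isClosedMap Q.continuous ?_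
    rintro ⟨y, z⟩
    obtain ⟨t, rfl⟩ := qc_surj z
    exact ⟨(y, t), rfl⟩
  have hk : ∀ p r, Q p = Q r → E p = E r := by
    rintro ⟨y, s⟩ ⟨y', t⟩ hh
    obtain rfl : y = y' := congrArg Prod.fst hh
    rcases qc_inj s t (congrArg Prod.snd hh) with rfl | ⟨rfl, rfl⟩ | ⟨rfl, rfl⟩
    · rfl
    · exact h y
    · exact (h y).symm
  refine ⟨(hq.lift E hk).curry, fun y t => ?_⟩
  exact DFunLike.congr_fun (hq.lift_comp E hk) (y, t)

/-- loop of a map from the circle -/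
noncomputable def lp (γ : C(Circle, M)) : Path (γ 1) (γ 1) :=
  ⟨γ.comp qc, congrArg γ qc_zero, congrArg γ qc_one⟩

/-- class of a loop -/
noncomputable def cls (γ : C(Circle, M)) : (LN M).E := ⟨γ 1, Path.Homotopic.Quotient.mk (lp γ)⟩

theorem square (K : C(unitInterval × unitInterval, M)) {x y x' y' : M} (p : Path x y) (p' : Path x' y')
    (r : Path x x') (r' : Path y y') (h1 : ∀ s, p s = K (0, s)) (h2 : ∀ s, p' s = K (1, s))
    (h3 : ∀ t, r t = K (t, 0)) (h4 : ∀ t, r' t = K (t, 1)) :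
    (Path.Homotopic.Quotient.mk p).trans (Path.Homotopic.Quotient.mk r') =
      (Path.Homotopic.Quotient.mk r).trans (Path.Homotopic.Quotient.mk p') := by
  obtain rfl : K (0, 0) = x := (h1 0).symm.trans p.source
  obtain rfl : K (0, 1) = y := (h1 1).symm.trans p.target
  obtain rfl : K (1, 0) = x' := (h2 0).symm.trans p'.source
  obtain rfl : K (1, 1) = y' := (h2 1).symm.trans p'.target
  let a1 : Path ((0, 0) : unitInterval × unitInterval) (0, 1) := ⟨⟨fun s => (0, s), by fun_prop⟩, rfl, rfl⟩
  let a2 : Path ((1, 0) : unitInterval × unitInterval) (1, 1) := ⟨⟨fun s => (1, s), by fun_prop⟩, rfl, rfl⟩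
  let a3 : Path ((0, 0) : unitInterval × unitInterval) (1, 0) := ⟨⟨fun s => (s, 0), by fun_prop⟩, rfl, rfl⟩
  let a4 : Path ((0, 1) : unitInterval × unitInterval) (1, 1) := ⟨⟨fun s => (s, 1), by fun_prop⟩, rfl, rfl⟩
  have e1 : p = a1.map K.continuous := by ext s; exact h1 s
  have e2 : p' = a2.map K.continuous := by ext s; exact h2 s
  have e3 : r = a3.map K.continuous := by ext s; exact h3 s
  have e4 : r' = a4.map K.continuous := by ext s; exact h4 s
  rw [e1, e2, e3, e4, ← Path.Homotopic.Quotient.mk_trans, ← Path.Homotopic.Quotient.mk_trans,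
    ← Path.map_trans, ← Path.map_trans, Path.Homotopic.Quotient.eq]
  exact (SimplyConnectedSpace.paths_homotopic _ _).map K

theorem cls_cont {Y : Type} [TopologicalSpace Y] [LocallyPathConnectedSpace Y] (c : C(Y, C(Circle, M))) :
    Continuous (Y := (LN M).E) (fun y => cls (c y)) := by
  refine (LN M).cont_of_tr ⟨fun y => c y 1, by fun_prop⟩ (fun y => Path.Homotopic.Quotient.mk (lp (c y))) ?_
  intro y y' δ
  let K : C(unitInterval × unitInterval, M) := ⟨fun z => c (δ z.1) (qc z.2), by fun_prop⟩
  let fb : C(Y, M) := ⟨fun y => c y 1, by fun_prop⟩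
  have := square K (lp (c y)) (lp (c y')) (δ.map fb.continuous) (δ.map fb.continuous)
    (fun s => by change c y (qc s) = c (δ 0) (qc s); rw [δ.source])
    (fun s => by change c y' (qc s) = c (δ 1) (qc s); rw [δ.target])
    (fun t => by change c (δ t) 1 = c (δ t) (qc 0); rw [qc_zero])
    (fun t => by change c (δ t) 1 = c (δ t) (qc 1); rw [qc_one])
  exact pq_conj _ _ _ this

theorem end2 [T2Space M] (hM : Surf M) (x0 : M) (γ : C(Circle, M)) (n : (LN M).E) (hn : cls γ = n)
    (s : PQ x0 n.1) (Γ : C(unitInterval, (UC x0).E)) (h : ∀ t, (Γ t).1 = γ (qc t)) (h0 : Γ 0 = ⟨n.1, s⟩) :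
    Γ 1 = ⟨n.1, Path.Homotopic.Quotient.trans s n.2⟩ := by
  subst hn
  obtain ⟨Γ', h1, h2, h3⟩ := LS.path_lift (L := UC x0) (lp γ) s
  have := LS.lift_uniq hM Γ Γ' (fun t => (h t).trans (h1 t).symm) 0 (h0.trans h2.symm)
  rw [this]
  exact h3

theorem end3 [T2Space M] (hM : Surf M) (x0 : M) (γ : C(Circle, M)) (n : (LN M).E) (hn : γ 1 = n.1)
    (s : PQ x0 n.1) (Γ : C(unitInterval, (UC x0).E)) (h : ∀ t, (Γ t).1 = γ (qc t)) (h0 : Γ 0 = ⟨n.1, s⟩)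
    (h1 : Γ 1 = ⟨n.1, Path.Homotopic.Quotient.trans s n.2⟩) : cls γ = n := by
  obtain ⟨x, l⟩ := n
  obtain rfl : γ 1 = x := hn
  have := end2 hM x0 γ (cls γ) rfl s Γ h h0
  rw [h1] at this
  have h2 : Path.Homotopic.Quotient.trans s l = Path.Homotopic.Quotient.trans s (Path.Homotopic.Quotient.mk (lp γ)) :=
    eq_of_heq (Sigma.mk.inj this).2
  have h3 := pq_cancel s _ _ h2
  rw [h3]; rfl

instance (m : ℕ) : LocallyPathConnectedSpace (Dl m) := (convex_stdSimplex ℝ (Fin m)).locallyPathConnectedSpace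

instance (m : ℕ) : ContractibleSpace (Dl (m + 1)) :=
  (convex_stdSimplex ℝ (Fin (m + 1))).contractibleSpace ⟨_, (lv m).2⟩

theorem top_rlp [T2Space M] [PathConnectedSpace M] (hM : Surf M) (x0 : M) {m : ℕ} (hE : Ext (UC x0).E (m + 2))
    (b : C(Dl (m + 1), (LN M).E)) (a : C(Fc (Set.univ : Set (Fin (m + 1))), C(Circle, M)))
    (h : ∀ x, cls (a x) = b x) :
    ∃ c : C(Dl (m + 1), C(Circle, M)), (∀ x : Fc (Set.univ : Set (Fin (m + 1))), c x.1 = a x) ∧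
      ∀ x, cls (c x) = b x := by
  let β : C(Dl (m + 1), M) := (LN M).pr.comp b
  let v0 := lv m
  let g0 : PQ x0 (β v0) := Path.Homotopic.Quotient.mk (PathConnectedSpace.somePath _ _)
  let u := (UC x0).lift β v0 g0
  let u' := (UC x0).lift β v0 (Path.Homotopic.Quotient.trans g0 (b v0).2)
  let w : ∀ y, PQ x0 (b y).1 := fun y => (UC x0).lt β v0 g0 y
  have hu : ∀ y, u y = ⟨(b y).1, w y⟩ := fun y => rfl
  have hu' : ∀ y, u' y = ⟨(b y).1, Path.Homotopic.Quotient.trans (w y) (b y).2⟩ := by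
    intro y
    let δ : Path v0 y := PathConnectedSpace.somePath v0 y
    have e1 := (UC x0).lt_eq β v0 g0 y δ
    have e2 := (UC x0).lt_eq β v0 (Path.Homotopic.Quotient.trans g0 (b v0).2) y δ
    have e3 := LS.tr_of_path hM (δ.map b.continuous)
    change (⟨(b y).1, (UC x0).lt β v0 (Path.Homotopic.Quotient.trans g0 (b v0).2) y⟩ : (UC x0).E) = _
    rw [e2]
    have e4 : w y = Path.Homotopic.Quotient.trans g0 (Path.Homotopic.Quotient.mk (δ.map β.continuous)) := e1
    rw [e4, ← e3]
    congr 1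
    exact pq_alg g0 (b v0).2 (Path.Homotopic.Quotient.mk (δ.map β.continuous))
  let H : C(unitInterval × Fc (Set.univ : Set (Fin (m + 1))), M) := ⟨fun z => a z.2 (qc z.1), by fun_prop⟩
  obtain ⟨G, hG1, hG2⟩ := LS.homotopy_lift hM H (u.comp ⟨Subtype.val, continuous_subtype_val⟩) (by
    intro x
    change a x (qc 0) = (b x).1
    rw [qc_zero, ← h x]; rfl)
  let S : C(Fc (Set.univ : Set (Fin (m + 1))), C(unitInterval, (UC x0).E)) :=
    (G.comp ⟨fun z => (z.2, z.1), by fun_prop⟩ : C(Fc (Set.univ : Set (Fin (m + 1))) × unitInterval, (UC x0).E)).curry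
  have hS : ∀ x t, S x t = G (t, x) := fun x t => rfl
  obtain ⟨E, hE0, hE1, hES⟩ := box_fill hE u u' S (fun x => hG2 x) (by
    intro x
    rw [hu']
    exact end2 hM x0 (a x) (b x) (h x) (w x) (S x) (fun t => hG1 (t, x)) (hG2 x))
  obtain ⟨c, hc⟩ := descend ((UC x0).pr.comp E) (by
    intro y
    change (E (y, 0)).1 = (E (y, 1)).1
    rw [hE0, hE1]; rfl)
  have hc : ∀ y t, c y (qc t) = (E (y, t)).1 := hc
  refine ⟨c, fun x => ContinuousMap.ext fun z => ?_, fun y => ?_⟩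
  · obtain ⟨t, rfl⟩ := qc_surj z
    rw [hc, hES, hS]
    exact hG1 (t, x)
  · refine end3 hM x0 (c y) (b y) ?_ (w y) ⟨fun t => E (y, t), by fun_prop⟩ (fun t => (hc y t).symm)
      (hE0 y) ((hE1 y).trans (hu' y))
    rw [← qc_zero, hc, hE0]; rfl

end
end FLS

namespace FLS
section
open MonoidalCategory CartesianMonoidalCategory Simplicial

/-- ends of the cylinder -/
def ends (X : SSet.{0}) : (X ⊗ Δ[1]).Subcomplex where
  obj n := {z | SSet.ι₀.app n z.1 = z ∨ SSet.ι₁.app n z.1 = z}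
  map {n m} f := by
    rintro z (h | h)
    · left
      conv_rhs => rw [← h]
      rfl
    · right
      conv_rhs => rw [← h]
      rfl

theorem ends_ne (X : SSet.{0}) {n} (x : X.obj n) : SSet.ι₀.app n x ≠ SSet.ι₁.app n x := by
  induction n using Opposite.rec with | _ n
  induction n using SimplexCategory.rec with | _ n
  intro h
  have h1 := SSet.ι₀_app_snd_apply x 0
  have h2 := SSet.ι₁_app_snd_apply x 0
  have h3 : ((SSet.ι₀.app (Opposite.op ⦋n⦌) x).2 0 : Fin 2) = (SSet.ι₁.app (Opposite.op ⦋n⦌) x).2 0 := by rw [h]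
  exact absurd (h1.symm.trans (h3.trans h2)) (by decide)

open Classical in
/-- map on the ends -/
noncomputable def endsMap {X Z : SSet.{0}} (f g : X ⟶ Z) : (ends X : SSet) ⟶ Z where
  app n := ↾fun z => if SSet.ι₀.app n z.1.1 = z.1 then f.app n z.1.1 else g.app n z.1.1
  naturality n m φ := by
    ext ⟨z, hz⟩
    change (if SSet.ι₀.app m (X.map φ z.1) = (X ⊗ Δ[1]).map φ z then f.app m (X.map φ z.1) else g.app m (X.map φ z.1)) =
      Z.map φ (if SSet.ι₀.app n z.1 = z then f.app n z.1 else g.app n z.1)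
    by_cases h : SSet.ι₀.app n z.1 = z
    · have h' : SSet.ι₀.app m (X.map φ z.1) = (X ⊗ Δ[1]).map φ z := by
        conv_rhs => rw [← h]
        rfl
      rw [if_pos h, if_pos h']
      exact NatTrans.naturality_apply f φ z.1
    · have h1 := hz.resolve_left h
      have h' : ¬ SSet.ι₀.app m (X.map φ z.1) = (X ⊗ Δ[1]).map φ z := by
        intro h2
        apply ends_ne X (X.map φ z.1)
        rw [h2]
        conv_lhs => rw [← h1]
        rfl
      rw [if_neg h, if_neg h']
      exact NatTrans.naturality_apply g φ z.1

open Classical in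
theorem rlp_homotopy {X Y : SSet.{0}} (P : X ⟶ Y) (hP : SSet.modelCategoryQuillen.I.rlp P) :
    ∃ s : Y ⟶ X, Nonempty (SSet.Homotopy (𝟙 X) (P ≫ s)) := by
  rw [← SSet.rlp_monomorphisms] at hP
  have l1 : HasLiftingProperty (⊥ : Y.Subcomplex).ι P := hP _ (MorphismProperty.monomorphisms.infer_property _)
  have l2 : HasLiftingProperty (ends X).ι P := hP _ (MorphismProperty.monomorphisms.infer_property _)
  have sq1 : CommSq (SSet.Subcomplex.isInitialBot.to X) (⊥ : Y.Subcomplex).ι P (𝟙 Y) :=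
    ⟨SSet.Subcomplex.isInitialBot.hom_ext _ _⟩
  let s := sq1.lift
  have hs : s ≫ P = 𝟙 Y := sq1.fac_right
  have sq2 : CommSq (endsMap (𝟙 X) (P ≫ s)) (ends X).ι P (fst X Δ[1] ≫ P) := by
    constructor
    ext n ⟨z, hz⟩
    change P.app n (if SSet.ι₀.app n z.1 = z then z.1 else s.app n (P.app n z.1)) = P.app n z.1
    split_ifs
    · rfl
    · exact congrArg (fun q : Y ⟶ Y => q.app n (P.app n z.1)) hs
  refine ⟨s, ⟨⟨sq2.lift, ?_, ?_, ?_⟩⟩⟩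
  · ext n x
    have := congrArg (fun q => q.app n ⟨SSet.ι₀.app n x, Or.inl rfl⟩) sq2.fac_left
    refine this.trans ?_
    exact if_pos rfl
  · ext n x
    have := congrArg (fun q => q.app n ⟨SSet.ι₁.app n x, Or.inr rfl⟩) sq2.fac_left
    refine this.trans ?_
    exact if_neg (ends_ne X x)
  · ext n ⟨⟨x, hx⟩, y⟩
    exact absurd hx (by simp)

/-- homology of a simplicial set -/
noncomputable abbrev HS (n : ℕ) : SSet.{0} ⥤ AddCommGrpCat :=
  (SimplicialObject.whiskering (Type) AddCommGrpCat).obj AddCommGrpCat.free ⋙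
    AlgebraicTopology.alternatingFaceMapComplex AddCommGrpCat ⋙ HomologicalComplex.homologyFunctor _ _ n

theorem HS_zero {X Y : SSet.{0}} (P : X ⟶ Y) (hP : SSet.modelCategoryQuillen.I.rlp P) (n : ℕ)
    (h : Limits.IsZero ((HS n).obj Y)) : Limits.IsZero ((HS n).obj X) := by
  obtain ⟨s, ⟨H⟩⟩ := rlp_homotopy P hP
  have e : (HS n).map (𝟙 X) = (HS n).map (P ≫ s) :=
    (H.toSimplicialObjectHomotopy.whiskerRight AddCommGrpCat.free).map_homology_eq n
  rw [Limits.IsZero.iff_id_eq_zero, ← CategoryTheory.Functor.map_id, e, CategoryTheory.Functor.map_comp,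
    h.eq_zero_of_tgt ((HS n).map P), Limits.zero_comp]

/-- identification of the chain groups -/
noncomputable def br (X : Type) [TopologicalSpace X] (n : ℕ) :
    FreeAbelianGroup ((TopCat.toSSet.obj (TopCat.of X)).obj (Opposite.op ⦋n⦌)) →+ (Sing X).C (n + 1) :=
  FreeAbelianGroup.lift fun σ => (Sing X).g ((TopCat.of X).toSSetObjEquiv _ σ)

/-- inverse identification of the chain groups -/
noncomputable def br' (X : Type) [TopologicalSpace X] (n : ℕ) :
    (Sing X).C (n + 1) →ₗ[ℤ] FreeAbelianGroup ((TopCat.toSSet.obj (TopCat.of X)).obj (Opposite.op ⦋n⦌)) :=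
  lext fun σ => FreeAbelianGroup.of (((TopCat.of X).toSSetObjEquiv (Opposite.op ⦋n⦌)).symm σ)

theorem br'_br (X : Type) [TopologicalSpace X] (n : ℕ) (z) : br' X n (br X n z) = z := by
  have : (br' X n).toAddMonoidHom.comp (br X n) = AddMonoidHom.id _ := by
    apply FreeAbelianGroup.lift_ext
    intro σ
    change br' X n (br X n (FreeAbelianGroup.of σ)) = FreeAbelianGroup.of σ
    rw [br, FreeAbelianGroup.lift_apply_of]
    have e := lext_single (fun σ => FreeAbelianGroup.of (((TopCat.of X).toSSetObjEquiv (Opposite.op ⦋n⦌)).symm σ))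
      ((TopCat.of X).toSSetObjEquiv _ σ)
    refine e.trans ?_
    rw [Equiv.symm_apply_apply]
  exact DFunLike.congr_fun this z

theorem br_br' (X : Type) [TopologicalSpace X] (n : ℕ) (z) : br X n (br' X n z) = z := by
  have : (br X n).toIntLinearMap ∘ₗ br' X n = LinearMap.id := by
    apply lin_ext
    intro σ
    change br X n (br' X n _) = _
    have e := lext_single (fun σ => FreeAbelianGroup.of (((TopCat.of X).toSSetObjEquiv (Opposite.op ⦋n⦌)).symm σ)) σ
    have e' : br' X n (Finsupp.single σ 1) = _ := e
    rw [e', br, FreeAbelianGroup.lift_apply_of]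
    rw [Equiv.apply_symm_apply]
    rfl
  exact DFunLike.congr_fun this z

/-- chain complex -/
noncomputable abbrev KX (X : Type) [TopologicalSpace X] : ChainComplex AddCommGrpCat ℕ :=
  (AlgebraicTopology.alternatingFaceMapComplex AddCommGrpCat).obj
    (((SimplicialObject.whiskering (Type) AddCommGrpCat).obj AddCommGrpCat.free).obj
      (TopCat.toSSet.obj (TopCat.of X)))

/-- the differential as a homomorphism of free abelian groups -/
noncomputable def dK (X : Type) [TopologicalSpace X] (n : ℕ) :
    FreeAbelianGroup ((TopCat.toSSet.obj (TopCat.of X)).obj (Opposite.op ⦋n + 1⦌)) →+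
      FreeAbelianGroup ((TopCat.toSSet.obj (TopCat.of X)).obj (Opposite.op ⦋n⦌)) := ((KX X).d (n + 1) n).hom

theorem hom_sum_ab {P Q : AddCommGrpCat.{0}} {ι : Type} (s : Finset ι) (f : ι → (P ⟶ Q)) :
    (∑ i ∈ s, f i : P ⟶ Q).hom = ∑ i ∈ s, (f i).hom :=
  map_sum (AddCommGrpCat.homAddEquiv (M := P) (N := Q)).toAddMonoidHom f s

theorem dK_of (X : Type) [TopologicalSpace X] (n : ℕ)
    (σ : (TopCat.toSSet.obj (TopCat.of X)).obj (Opposite.op ⦋n + 1⦌)) :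
    dK X n (FreeAbelianGroup.of σ) =
      ∑ i : Fin (n + 2), (-1 : ℤ) ^ (i : ℕ) • FreeAbelianGroup.of ((TopCat.toSSet.obj (TopCat.of X)).δ i σ) := by
  have e := congrArg AddCommGrpCat.Hom.hom (AlgebraicTopology.AlternatingFaceMapComplex.obj_d_eq
    (((SimplicialObject.whiskering (Type) AddCommGrpCat).obj AddCommGrpCat.free).obj
      (TopCat.toSSet.obj (TopCat.of X))) n)
  have e1 : dK X n = _ := e
  rw [e1]
  refine (DFunLike.congr_fun (hom_sum_ab _ _) _).trans ?_
  refine (AddMonoidHom.finsetSum_apply _ _ _).trans ?_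
  refine Finset.sum_congr rfl fun i _ => ?_
  refine congrArg (fun q : FreeAbelianGroup ((TopCat.toSSet.obj (TopCat.of X)).obj (Opposite.op ⦋n⦌)) => (-1 : ℤ) ^ (i : ℕ) • q) ?_
  exact FreeAbelianGroup.map_of_apply _

theorem br_d (X : Type) [TopologicalSpace X] (n : ℕ)
    (z : FreeAbelianGroup ((TopCat.toSSet.obj (TopCat.of X)).obj (Opposite.op ⦋n + 1⦌))) :
    br X n (dK X n z) = (Sing X).bd (br X (n + 1) z) := by
  have : (br X n).comp (dK X n) = (Sing X).bd.toAddMonoidHom.comp (br X (n + 1)) := by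
    apply FreeAbelianGroup.lift_ext
    intro σ
    change br X n (dK X n (FreeAbelianGroup.of σ)) = (Sing X).bd (br X (n + 1) (FreeAbelianGroup.of σ))
    rw [dK_of, map_sum, br, br, FreeAbelianGroup.lift_apply_of, PSS.bd_g]
    refine Finset.sum_congr rfl fun i _ => ?_
    rw [map_zsmul, FreeAbelianGroup.lift_apply_of]
    rfl
  exact DFunLike.congr_fun this z

theorem bridge_aux (X : Type) [TopologicalSpace X] (n : ℕ)
    (h : ∀ z : (Sing X).C (n + 2), (Sing X).bd z = 0 → ∃ w, (Sing X).bd w = z) (z) (hz : dK X n z = 0) :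
    ∃ w, dK X (n + 1) w = z := by
  obtain ⟨w, hw⟩ := h (br X (n + 1) z) (by rw [← br_d, hz, map_zero])
  refine ⟨br' X (n + 2) w, ?_⟩
  rw [← br'_br X (n + 1) z, ← hw, ← br'_br X (n + 1) (dK X (n + 1) _), br_d, br_br']

theorem bridge (X : Type) [TopologicalSpace X] (n : ℕ)
    (h : ∀ z : (Sing X).C (n + 2), (Sing X).bd z = 0 → ∃ w, (Sing X).bd w = z) :
    Limits.IsZero ((KX X).homology (n + 1)) := by
  rw [← HomologicalComplex.exactAt_iff_isZero_homology,
    HomologicalComplex.exactAt_iff' _ (n + 2) (n + 1) n (by simp) (by simp), ShortComplex.ab_exact_iff]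
  intro z hz
  exact bridge_aux X n h z hz

/-- the map of singular sets -/
noncomputable def PM (M : Type) [TopologicalSpace M] :
    TopCat.toSSet.obj (TopCat.of C(Circle, M)) ⟶ TopCat.toSSet.obj (TopCat.of (LN M).E) where
  app n := ↾fun σ => ((TopCat.of (LN M).E).toSSetObjEquiv n).symm
    ⟨fun x => cls ((TopCat.of C(Circle, M)).toSSetObjEquiv n σ x), cls_cont (Y := Dl (n.unop.len + 1)) _⟩
  naturality n m φ := by
    ext σ
    rfl

theorem bdry_compat {k : ℕ} (i j : Fin (k + 2)) (h : i ≤ j) :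
    SSet.stdSimplex.δ.{0} i ≫ SSet.boundary.ι j.succ = SSet.stdSimplex.δ j ≫ SSet.boundary.ι i.castSucc := by
  rw [← cancel_mono (SSet.boundary (k + 2)).ι, Category.assoc, Category.assoc, SSet.boundary.ι_ι, SSet.boundary.ι_ι]
  exact CosimplicialObject.δ_comp_δ _ h

/-- simplices of the singular set as continuous maps -/
noncomputable def mt (X : Type) [TopologicalSpace X] (n : ℕ) :
    (Δ[n] ⟶ TopCat.toSSet.obj (TopCat.of X)) ≃ C(Dl (n + 1), X) :=
  SSet.yonedaEquiv.trans ((TopCat.of X).toSSetObjEquiv (Opposite.op ⦋n⦌))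

theorem mt_δ (X : Type) [TopologicalSpace X] (n : ℕ) (i : Fin (n + 2)) (f : Δ[n + 1] ⟶ TopCat.toSSet.obj (TopCat.of X)) :
    mt X n (SSet.stdSimplex.δ i ≫ f) = (mt X (n + 1) f).comp (cof i) := by
  change (TopCat.of X).toSSetObjEquiv (Opposite.op ⦋n⦌) (SSet.yonedaEquiv (SSet.stdSimplex.δ i ≫ f)) = _
  rw [SSet.stdSimplex.yonedaEquiv_δ_comp]
  rfl

theorem mt_PM (M : Type) [TopologicalSpace M] (n : ℕ) (f : Δ[n] ⟶ TopCat.toSSet.obj (TopCat.of C(Circle, M))) (x) :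
    mt _ n (f ≫ PM M) x = cls (mt _ n f x) := by
  change (TopCat.of (LN M).E).toSSetObjEquiv (Opposite.op ⦋n⦌) (SSet.yonedaEquiv (f ≫ PM M)) x = _
  rw [SSet.yonedaEquiv_comp]
  rfl

theorem Fc_cases {m : ℕ} {I : Set (Fin (m + 1))} (x : Fc I) : ∃ i, ∃ hi : i ∈ I, ∃ y, x = ⟨cof i y, i, hi, cof_self i y⟩ := by
  obtain ⟨i, hi, h⟩ := x.2
  refine ⟨i, hi, drop i ⟨x.1, h⟩, Subtype.ext ?_⟩
  exact (cof_drop i ⟨x.1, h⟩).symm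

theorem PM_rlp {M : Type} [TopologicalSpace M] [T2Space M] [PathConnectedSpace M] (hM : Surf M) (x0 : M)
    (hE : ∀ k, Ext (UC x0).E (k + 1)) : SSet.modelCategoryQuillen.I.rlp (PM M) := by
  rintro A B _ ⟨n⟩
  constructor
  intro f b sq
  obtain ⟨t, h1, h2, h3⟩ : ∃ t : Fin (n + 1) → C(Dl n, C(Circle, M)),
      (∀ i ∈ Set.univ, ∀ j ∈ Set.univ, ∀ y y', cof i y = cof j y' → t i y = t j y') ∧
      (∀ i y, cls (t i y) = mt _ n b (cof i y)) ∧
      (∀ l : Δ[n] ⟶ TopCat.toSSet.obj (TopCat.of C(Circle, M)), (∀ i, (mt _ n l).comp (cof i) = t i) →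
        (SSet.boundary n).ι ≫ l = f) := by
    cases n with
    | zero =>
      refine ⟨fun i => ⟨fun y => (IsEmpty.false y).elim, continuous_of_discreteTopology⟩, ?_, ?_, ?_⟩
      · intro i _ j _ y
        exact (IsEmpty.false y).elim
      · intro i y
        exact (IsEmpty.false y).elim
      · intro l hl
        exact SSet.boundary.hom_ext₀
    | succ n =>
      refine ⟨fun i => mt _ n (SSet.boundary.ι i ≫ f), ?_, ?_, ?_⟩
      · cases n with
        | zero =>
          refine compat_pt _ _ ?_
          intro i j hij _ _
          refine ContinuousMap.ext fun y => (IsEmpty.false y).elim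
        | succ n =>
          refine compat_pt _ _ ?_
          intro i j hij _ _
          rw [← mt_δ, ← mt_δ, ← Category.assoc, ← Category.assoc, bdry_compat i j hij]
      · intro i y
        rw [← mt_PM, Category.assoc, sq.w, ← Category.assoc, SSet.boundary.ι_ι, mt_δ]
        rfl
      · intro l hl
        refine SSet.boundary.hom_ext fun i => ?_
        apply (mt _ n).injective
        refine Eq.trans ?_ (hl i)
        rw [← Category.assoc, SSet.boundary.ι_ι, mt_δ]
  obtain ⟨a, ha⟩ := glue Set.univ t h1
  obtain ⟨c, hc1, hc2⟩ := top_rlp hM x0 (hE (n + 1)) (mt _ n b) a (by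
    intro x
    obtain ⟨i, hi, y, rfl⟩ := Fc_cases x
    rw [ha i hi, h2])
  refine ⟨⟨(mt _ n).symm c, ?_, ?_⟩⟩
  · apply h3
    intro i
    rw [Equiv.apply_symm_apply]
    refine ContinuousMap.ext fun y => ?_
    exact (hc1 ⟨cof i y, i, Set.mem_univ i, cof_self i y⟩).trans (ha i (Set.mem_univ i) y)
  · apply (mt _ n).injective
    refine ContinuousMap.ext fun y => ?_
    rw [mt_PM, Equiv.apply_symm_apply, hc2]

theorem surf_of {M : Type} [TopologicalSpace M]
    (hloc : ∀ x : M, ∃ U : Set M, IsOpen U ∧ x ∈ U ∧ Nonempty (U ≃ₜ (ℝ × ℝ))) : Surf M := by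
  intro x
  obtain ⟨U, hU, hx, ⟨e⟩⟩ := hloc x
  let e' : (ℝ × ℝ) ≃ₜ U := (Homeomorph.addRight (e ⟨x, hx⟩)).trans e.symm
  refine ⟨⟨fun v => (e' v).1, continuous_subtype_val.comp e'.continuous⟩,
    hU.isOpenEmbedding_subtypeVal.comp e'.isOpenEmbedding, ?_⟩
  change ((e.symm (0 + e ⟨x, hx⟩)) : M) = x
  rw [zero_add, e.symm_apply_apply]

theorem main_thm (M : Type) [TopologicalSpace M] [T2Space M]
    (hloc : ∀ x : M, ∃ U : Set M, IsOpen U ∧ x ∈ U ∧ Nonempty (U ≃ₜ (ℝ × ℝ)))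
    [ConnectedSpace M] (hnc : ¬ CompactSpace M) (j : ℕ) (hj : 2 ≤ j) :
    Limits.IsZero ((KX C(Circle, M)).homology j) := by
  have hM := surf_of hloc
  have := pathConn hM
  obtain ⟨x0⟩ : Nonempty M := inferInstance
  have hsc := UC_sc hM x0
  have ht := LS.t2E (L := UC x0) hM
  have ht' := LS.t2E (L := LN M) hM
  have hE := all_ext (LS.surfE (L := UC x0) hM) (fun e K hK => LS.noncompactE hnc e K hK)
  refine HS_zero (PM M) (PM_rlp hM x0 hE) j ?_
  obtain ⟨n, rfl⟩ : ∃ n, j = n + 1 := ⟨j - 1, by omega⟩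
  refine bridge (LN M).E n ?_
  intro z hz
  exact surf_cycle (LS.surfE (L := LN M) hM) (fun e K hK => LS.noncompactE hnc e K hK) hj z hz

end
end FLS

/-- if `M` is a connected, non-compact surface (a Hausdorff,
second-countable space, locally homeomorphic to `ℝ²`), then the singular homology
`H_j(ΛM; ℤ)` of its free loop space vanishes for all `j ≥ 2`. -/
theorem stmt1 (M : Type) [TopologicalSpace M] [T2Space M] [SecondCountableTopology M]
    (hloc : ∀ x : M, ∃ U : Set M, IsOpen U ∧ x ∈ U ∧ Nonempty (U ≃ₜ (ℝ × ℝ)))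
    [ConnectedSpace M] (hnc : ¬ CompactSpace M) :
    ∀ j : ℕ, 2 ≤ j →
      Limits.IsZero (singularHomology (TopCat.of (freeLoopSpace M)) j) := by
  intro j hj
  exact FLS.main_thm M hloc hnc j hj
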